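/- Every finite simple graph with maximum degree at most 3 admits a (1,2^7)-packing edge-coloring in which the 1-color class contains only edges whose two endpoints both have degree 3; that is, there is a partition of the edge set into sets E_0, E_1, ..., E_7 such that E_0 is a matching all of whose edges have both endpoints of degree 3, and each E_i for 1 ≤ i ≤ 7 is an induced matching. -/

import Mathlib

open SimpleGraph

/-- A `(1,2^k)`-packing edge-coloring encoded as a function assigning a color in
`Fin (k+1)` to each unordered pair. Color `0` is the 1-color (its class must be a
matching) and each color `i ≠ 0` is a 2-color (its class must be an induced matching). -/
def IsPackingEC {V : Type} (G : SimpleGraph V) (k : ℕ)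
    (c : Sym2 V → Fin (k + 1)) : Prop :=
  (∀ a b x y : V, G.Adj a b → G.Adj x y → s(a, b) ≠ s(x, y) →
      c s(a, b) = 0 → c s(x, y) = 0 →
      a ≠ x ∧ a ≠ y ∧ b ≠ x ∧ b ≠ y) ∧
  ∀ a b x y : V, G.Adj a b → G.Adj x y → s(a, b) ≠ s(x, y) →
      c s(a, b) = c s(x, y) → c s(a, b) ≠ 0 →
      (a ≠ x ∧ a ≠ y ∧ b ≠ x ∧ b ≠ y) ∧
      ¬G.Adj a x ∧ ¬G.Adj a y ∧ ¬G.Adj b x ∧ ¬G.Adj b y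

/-- A good coloring: a `(1,2^7)`-packing edge-coloring in which every edge of the
1-color class (color `0`) has both endpoints of degree 3. -/
def GoodColoring {V : Type} (G : SimpleGraph V) (c : Sym2 V → Fin 8) : Prop :=
  IsPackingEC G 7 c ∧
  ∀ a b : V, G.Adj a b → c s(a, b) = 0 →
    (G.neighborSet a).ncard = 3 ∧ (G.neighborSet b).ncard = 3

/-- A graph is subcubic if every vertex has degree at most 3. -/
def Subcubic {V : Type} (G : SimpleGraph V) : Prop :=
  ∀ v : V, (G.neighborSet v).ncard ≤ 3

/-- A minimal counterexample: a finite subcubic simple graph with no good coloring such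
that every finite subcubic simple graph with smaller `|V| + |E|` has a good coloring. -/
def MinCounter (V : Type) [Finite V] (G : SimpleGraph V) : Prop :=
  Subcubic G ∧
  (¬∃ c : Sym2 V → Fin 8, GoodColoring G c) ∧
  ∀ (W : Type) [Finite W] (H : SimpleGraph W), Subcubic H →
    Nat.card W + H.edgeSet.ncard < Nat.card V + G.edgeSet.ncard →
    ∃ c : Sym2 W → Fin 8, GoodColoring H c

section Nullstellensatz

variable {α : Type*}

/-- Lower the exponent of `a` by one. -/
def lower [DecidableEq α] (d : α → ℕ) (a : α) : α → ℕ := Function.update d a (d a - 1)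

/-- The coefficient of the monomial with exponents `d` in the product of the differences
`X a - X b` over the pairs `(a, b)` of a list, computed by expanding the product. -/
def edgeCoeff [DecidableEq α] [Fintype α] : List (α × α) → (α → ℕ) → ℤ
  | [], d => if ∀ a, d a = 0 then 1 else 0
  | (a, b) :: es, d =>
    (if d a = 0 then 0 else edgeCoeff es (lower d a)) -
      (if d b = 0 then 0 else edgeCoeff es (lower d b))

open MvPolynomial in
/-- The product of the differences `X a - X b` over a list of pairs. -/
noncomputable def edgePoly (es : List (α × α)) : MvPolynomial α ℤ :=
  (es.map fun e => X e.1 - X e.2).prod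

open MvPolynomial in
lemma coeff_X_mul_eq [DecidableEq α] [Fintype α] (a : α) (p : MvPolynomial α ℤ) (d : α → ℕ) :
    coeff (Finsupp.equivFunOnFinite.symm d) (X a * p) =
      if d a = 0 then 0 else coeff (Finsupp.equivFunOnFinite.symm (lower d a)) p := by
  rw [coeff_X_mul']
  by_cases h : d a = 0
  · simp [h]
  · rw [if_pos (by simpa using h), if_neg h]
    congr 1
    ext b
    simp only [lower, Finsupp.coe_tsub, Pi.sub_apply, Finsupp.equivFunOnFinite_symm_apply_apply,
      Function.update_apply, Finsupp.single_apply]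
    by_cases hb : b = a
    · subst hb; simp
    · simp [hb, Ne.symm hb]

open MvPolynomial in
lemma coeff_edgePoly [DecidableEq α] [Fintype α] (es : List (α × α)) (d : α → ℕ) :
    coeff (Finsupp.equivFunOnFinite.symm d) (edgePoly es) = edgeCoeff es d := by
  induction es generalizing d with
  | nil =>
    simp only [edgePoly, edgeCoeff, List.map_nil, List.prod_nil, coeff_one]
    congr 1
    rw [eq_iff_iff, DFunLike.ext_iff]
    simp [eq_comm]
  | cons e es ih =>
    obtain ⟨a, b⟩ := e
    have : edgePoly ((a, b) :: es) = X a * edgePoly es - X b * edgePoly es := by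
      simp [edgePoly, sub_mul]
    rw [this, coeff_sub, coeff_X_mul_eq, coeff_X_mul_eq, ih, ih]
    rfl

open MvPolynomial in
lemma isHomogeneous_edgePoly (es : List (α × α)) : (edgePoly es).IsHomogeneous es.length := by
  induction es with
  | nil => exact isHomogeneous_one _ _
  | cons e es ih =>
    have : edgePoly (e :: es) = (X e.1 - X e.2) * edgePoly es := by simp [edgePoly]
    rw [this, List.length_cons, add_comm]
    exact ((isHomogeneous_X _ _).sub (isHomogeneous_X _ _)).mul ih

/-- If the coefficient of a monomial in the edge polynomial does not vanish, then lists larger than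
the exponents admit a proper choice. -/
lemma exists_choice_of_edgeCoeff [DecidableEq α] [Fintype α] {k : ℕ} (es : List (α × α)) (d : α → ℕ)
    (h : edgeCoeff es d ≠ 0) (L : α → Finset (Fin k)) (hL : ∀ a, d a < (L a).card) :
    ∃ c : α → Fin k, (∀ a, c a ∈ L a) ∧ ∀ e ∈ es, c e.1 ≠ c e.2 := by
  rw [← coeff_edgePoly] at h
  have hhom := isHomogeneous_edgePoly es
  have hne : edgePoly es ≠ 0 := by
    intro h0
    simp [h0] at h
  have hinj : Function.Injective (fun x : Fin k => ((x : ℕ) : ℤ)) := fun x y hxy => by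
    simpa [Fin.ext_iff] using hxy
  obtain ⟨s, hs, hs'⟩ := MvPolynomial.combinatorial_nullstellensatz_exists_eval_nonzero
    (edgePoly es) _ h
    (by rw [hhom.totalDegree hne, Finsupp.degree_eq_weight_one]; exact (hhom h).symm)
    (fun a => (L a).image fun x : Fin k => ((x : ℕ) : ℤ))
    (fun a => by rw [Finset.card_image_of_injective _ hinj]; exact hL a)
  have : ∀ a, ∃ x ∈ L a, ((x : ℕ) : ℤ) = s a := fun a => by simpa using hs a
  choose c hc hc' using this
  refine ⟨c, hc, fun e he heq => hs' ?_⟩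
  rw [edgePoly, map_list_prod, List.prod_eq_zero_iff, List.map_map, List.mem_map]
  exact ⟨e, he, by simp [← hc', heq]⟩

end Nullstellensatz

section Gadget

/-- The coefficient at `d` stays zero whatever subset of the listed half-edges is charged to `d`. -/
def VanishOn {m : ℕ} (es : List (Fin m × Fin m)) : List (Bool × Fin m) → (Fin m → ℕ) → Prop
  | [], d => (List.ofFn d).sum ≠ es.length ∨ edgeCoeff es d = 0
  | (_, g) :: bd, d => (d g ≠ 0 → VanishOn es bd (lower d g)) ∧ VanishOn es bd d

/-- Exactly the half-edges marked `true` have to be charged to `d` to get a nonzero coefficient. -/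
def ForcedOn {m : ℕ} (es : List (Fin m × Fin m)) : List (Bool × Fin m) → (Fin m → ℕ) → Prop
  | [], d => edgeCoeff es d ≠ 0
  | (true, g) :: bd, d => d g ≠ 0 ∧ ForcedOn es bd (lower d g) ∧ VanishOn es bd d
  | (false, g) :: bd, d => (d g ≠ 0 → VanishOn es bd (lower d g)) ∧ ForcedOn es bd d

instance {m : ℕ} (es : List (Fin m × Fin m)) :
    ∀ bd d, Decidable (VanishOn es bd d)
  | [], d => inferInstanceAs (Decidable ((List.ofFn d).sum ≠ es.length ∨ edgeCoeff es d = 0))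
  | (_, g) :: bd, d =>
    have := instDecidableVanishOn es bd (lower d g)
    have := instDecidableVanishOn es bd d
    inferInstanceAs (Decidable ((d g ≠ 0 → VanishOn es bd (lower d g)) ∧ VanishOn es bd d))

instance {m : ℕ} (es : List (Fin m × Fin m)) :
    ∀ bd d, Decidable (ForcedOn es bd d)
  | [], d => inferInstanceAs (Decidable (edgeCoeff es d ≠ 0))
  | (true, g) :: bd, d =>
    have := instDecidableForcedOn es bd (lower d g)
    inferInstanceAs (Decidable (d g ≠ 0 ∧ ForcedOn es bd (lower d g) ∧ VanishOn es bd d))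
  | (false, g) :: bd, d =>
    have := instDecidableForcedOn es bd d
    inferInstanceAs (Decidable ((d g ≠ 0 → VanishOn es bd (lower d g)) ∧ ForcedOn es bd d))

theorem forcedOn_short :
    ∀ tr : Fin 4, ∀ tq : Fin 2, ForcedOn (m := 7)
      [(0,1),(0,2),(0,3),(1,2),(1,3),(2,3),(2,4),(3,4),(3,5),(3,6),(4,5),(4,6),(5,6)]
      (List.replicate 3 (true, 0) ++ [(true, 1)] ++ List.replicate tq (false, 5) ++
        List.replicate tr (false, 6)) ![3,2,2,4,1,2,3] := by
  decide +kernel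

theorem forcedOn_long :
    ∀ tr : Fin 4, ∀ tq : Fin 2, ForcedOn (m := 8)
      [(0,1),(0,2),(0,3),(1,2),(1,3),(2,3),(2,4),(3,4),(3,5),(4,5),(4,6),(4,7),(5,6),(5,7),(6,7)]
      (List.replicate 3 (true, 0) ++ [(true, 1)] ++ List.replicate tq (false, 6) ++
        List.replicate tr (false, 7)) ![3,2,2,3,2,2,2,3] := by
  decide +kernel

lemma sum_lower {m : ℕ} (d : Fin m → ℕ) (a : Fin m) (h : d a ≠ 0) :
    ∑ i, lower d a i + 1 = ∑ i, d i := by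
  rw [lower, Finset.sum_update_of_mem (Finset.mem_univ _),
    ← Finset.add_sum_erase _ d (Finset.mem_univ a), Finset.sdiff_singleton_eq_erase]
  omega

lemma edgeCoeff_eq_zero_of_sum {m : ℕ} (es : List (Fin m × Fin m)) (d : Fin m → ℕ)
    (h : ∑ i, d i ≠ es.length) : edgeCoeff es d = 0 := by
  induction es generalizing d with
  | nil =>
    rw [edgeCoeff, if_neg]
    intro h0
    exact h (by simp [h0])
  | cons e es ih =>
    obtain ⟨a, b⟩ := e
    have key : ∀ a, (if d a = 0 then 0 else edgeCoeff es (lower d a)) = 0 := fun a => by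
      split_ifs with h0
      · rfl
      · refine ih _ fun hs => h ?_
        rw [← sum_lower d a h0, hs, List.length_cons]
    rw [edgeCoeff, key, key, sub_zero]

variable {ρ : Type*} [DecidableEq ρ] [Fintype ρ] {m : ℕ}

/-- The edges inside the two parts of a disjoint union. -/
def sumEdges (es : List (Fin m × Fin m)) (rs : List (ρ × ρ)) :
    List ((Fin m ⊕ ρ) × (Fin m ⊕ ρ)) :=
  es.map (fun e => (Sum.inl e.1, Sum.inl e.2)) ++ rs.map fun e => (Sum.inr e.1, Sum.inr e.2)

/-- The edges between the two parts of a disjoint union. -/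
def crossEdges (bd : List (Bool × Fin m × ρ)) : List ((Fin m ⊕ ρ) × (Fin m ⊕ ρ)) :=
  bd.map fun e => (Sum.inl e.2.1, Sum.inr e.2.2)

omit [Fintype ρ] in
lemma lower_inl (d : Fin m → ℕ) (e : ρ → ℕ) (a : Fin m) :
    lower (Sum.elim d e) (Sum.inl a) = Sum.elim (lower d a) e := by
  funext x
  rcases x with x | x <;> simp [lower, Function.update_apply]

omit [Fintype ρ] in
lemma lower_inr (d : Fin m → ℕ) (e : ρ → ℕ) (a : ρ) :
    lower (Sum.elim d e) (Sum.inr a) = Sum.elim d (lower e a) := by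
  funext x
  rcases x with x | x <;> simp [lower, Function.update_apply]

lemma edgeCoeff_cons_inl_inr (E : List ((Fin m ⊕ ρ) × (Fin m ⊕ ρ))) (g : Fin m) (r : ρ)
    (d : Fin m → ℕ) (e : ρ → ℕ) :
    edgeCoeff ((Sum.inl g, Sum.inr r) :: E) (Sum.elim d e) =
      (if d g = 0 then 0 else edgeCoeff E (Sum.elim (lower d g) e)) -
        if e r = 0 then 0 else edgeCoeff E (Sum.elim d (lower e r)) := by
  rw [edgeCoeff, lower_inl, lower_inr]
  rfl

lemma edgeCoeff_cons_inl_inl (E : List ((Fin m ⊕ ρ) × (Fin m ⊕ ρ))) (g r : Fin m)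
    (d : Fin m → ℕ) (e : ρ → ℕ) :
    edgeCoeff ((Sum.inl g, Sum.inl r) :: E) (Sum.elim d e) =
      (if d g = 0 then 0 else edgeCoeff E (Sum.elim (lower d g) e)) -
        if d r = 0 then 0 else edgeCoeff E (Sum.elim (lower d r) e) := by
  rw [edgeCoeff, lower_inl, lower_inl]
  rfl

lemma edgeCoeff_cons_inr_inr (E : List ((Fin m ⊕ ρ) × (Fin m ⊕ ρ))) (g r : ρ)
    (d : Fin m → ℕ) (e : ρ → ℕ) :
    edgeCoeff ((Sum.inr g, Sum.inr r) :: E) (Sum.elim d e) =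
      (if e g = 0 then 0 else edgeCoeff E (Sum.elim d (lower e g))) -
        if e r = 0 then 0 else edgeCoeff E (Sum.elim d (lower e r)) := by
  rw [edgeCoeff, lower_inr, lower_inr]
  rfl

lemma edgeCoeff_sumEdges (es : List (Fin m × Fin m)) (rs : List (ρ × ρ)) (d : Fin m → ℕ)
    (e : ρ → ℕ) :
    edgeCoeff (sumEdges es rs) (Sum.elim d e) = edgeCoeff es d * edgeCoeff rs e := by
  induction es generalizing d with
  | nil =>
    induction rs generalizing e with
    | nil =>
      simp only [sumEdges, edgeCoeff, List.map_nil, List.append_nil, Sum.forall, Sum.elim_inl,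
        Sum.elim_inr]
      split_ifs <;> simp_all
    | cons p rs ih =>
      obtain ⟨a, b⟩ := p
      have : sumEdges ([] : List (Fin m × Fin m)) ((a, b) :: rs) =
        (Sum.inr a, Sum.inr b) :: sumEdges [] rs := rfl
      rw [this, edgeCoeff_cons_inr_inr, ih, ih, edgeCoeff.eq_2 e, mul_sub, mul_ite, mul_ite, mul_zero]
  | cons p es ih =>
    obtain ⟨a, b⟩ := p
    have : sumEdges ((a, b) :: es) rs = (Sum.inl a, Sum.inl b) :: sumEdges es rs := rfl
    rw [this, edgeCoeff_cons_inl_inl, edgeCoeff, ih, ih, sub_mul, ite_mul, ite_mul, zero_mul]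

lemma edgeCoeff_of_vanishOn (es : List (Fin m × Fin m)) (rs : List (ρ × ρ))
    (bd : List (Bool × Fin m × ρ)) (d : Fin m → ℕ) (e : ρ → ℕ)
    (h : VanishOn es (bd.map fun x => (x.1, x.2.1)) d) :
    edgeCoeff (crossEdges bd ++ sumEdges es rs) (Sum.elim d e) = 0 := by
  induction bd generalizing d e with
  | nil =>
    have h0 : edgeCoeff es d = 0 := by
      rcases h with h | h
      · exact edgeCoeff_eq_zero_of_sum es d (by rwa [← List.sum_ofFn])
      · exact h
    simp [crossEdges, edgeCoeff_sumEdges, h0]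
  | cons p bd ih =>
    obtain ⟨s, g, r⟩ := p
    obtain ⟨h1, h2⟩ := h
    have : crossEdges ((s, g, r) :: bd) ++ sumEdges es rs =
      (Sum.inl g, Sum.inr r) :: (crossEdges bd ++ sumEdges es rs) := rfl
    rw [this, edgeCoeff_cons_inl_inr, ih _ _ h2, ite_self, sub_zero, ite_eq_left_iff]
    exact fun h0 => ih _ _ (h1 h0)

lemma edgeCoeff_of_forcedOn (es : List (Fin m × Fin m)) (rs : List (ρ × ρ))
    (bd : List (Bool × Fin m × ρ)) (d : Fin m → ℕ) (e : ρ → ℕ)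
    (h : ForcedOn es (bd.map fun x => (x.1, x.2.1)) d) (he : edgeCoeff rs e ≠ 0) :
    edgeCoeff (crossEdges bd ++ sumEdges es rs)
      (Sum.elim d fun r => e r + bd.countP fun x => x.1 = false ∧ x.2.2 = r) ≠ 0 := by
  induction bd generalizing d with
  | nil =>
    have h0 : edgeCoeff es d ≠ 0 := h
    simpa [crossEdges, edgeCoeff_sumEdges] using And.intro h0 he
  | cons p bd ih =>
    obtain ⟨s, g, r⟩ := p
    have : crossEdges ((s, g, r) :: bd) ++ sumEdges es rs =
      (Sum.inl g, Sum.inr r) :: (crossEdges bd ++ sumEdges es rs) := rfl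
    rw [this, edgeCoeff_cons_inl_inr]
    cases s with
    | true =>
      obtain ⟨h1, h2, h3⟩ := h
      rw [edgeCoeff_of_vanishOn _ _ _ _ _ h3, ite_self, sub_zero]
      simpa [h1] using ih _ h2
    | false =>
      obtain ⟨h1, h2⟩ := h
      rw [ite_eq_left_iff.2 fun h0 => edgeCoeff_of_vanishOn _ _ _ _ _ (h1 h0), zero_sub,
        neg_ne_zero, if_neg (by simp)]
      convert ih _ h2 using 3
      funext r'
      simp only [lower, Function.update_apply, List.countP_cons]
      by_cases hr : r' = r
      · subst hr; simp
      · simp [hr, Ne.symm hr]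

omit [DecidableEq ρ] in
lemma weight_le_of_edgeCoeff [DecidableEq ρ] (rk : ρ → ℕ) (rs : List (ρ × ρ))
    (hrs : ∀ p ∈ rs, rk p.1 < rk p.2) (e : ρ → ℕ) (h : edgeCoeff rs e ≠ 0) :
    ∑ r, rk r * e r ≤ (rs.map fun p => rk p.2).sum := by
  induction rs generalizing e with
  | nil =>
    have : ∀ r, e r = 0 := by
      by_contra h0
      simp [edgeCoeff, h0] at h
    simp [this]
  | cons p rs ih =>
    obtain ⟨a, b⟩ := p
    have hab : rk a < rk b := hrs (a, b) (by simp)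
    have key : ∀ x, e x ≠ 0 → edgeCoeff rs (lower e x) ≠ 0 → rk x ≤ rk b →
        ∑ r, rk r * e r ≤ (((a, b) :: rs).map fun p => rk p.2).sum := by
      intro x hx hne hxb
      have := ih (fun p hp => hrs p (by simp [hp])) _ hne
      have hs : ∑ r, rk r * e r = ∑ r, rk r * lower e x r + rk x := by
        rw [← Finset.add_sum_erase _ _ (Finset.mem_univ x),
          ← Finset.add_sum_erase _ (fun r => rk r * lower e x r) (Finset.mem_univ x)]
        have : ∀ r ∈ Finset.univ.erase x, rk r * lower e x r = rk r * e r := fun r hr => by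
          simp [lower, Finset.ne_of_mem_erase hr]
        rw [Finset.sum_congr rfl this]
        obtain ⟨k, hk⟩ := Nat.exists_eq_succ_of_ne_zero hx
        simp only [lower, Function.update_self, hk]
        simp; ring
      simp only [List.map_cons, List.sum_cons]
      omega
    rw [edgeCoeff] at h
    by_cases h1 : (if e a = 0 then 0 else edgeCoeff rs (lower e a)) = 0
    · rw [h1, zero_sub, neg_ne_zero] at h
      split_ifs at h with h0
      · exact absurd rfl h
      · exact key b h0 h le_rfl
    · split_ifs at h1 with h0
      · exact absurd rfl h1
      · exact key a h0 h1 hab.le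

lemma edgeCoeff_later (rk : ρ → ℕ) (rs : List (ρ × ρ)) (hrs : ∀ p ∈ rs, rk p.1 < rk p.2) :
    edgeCoeff rs (fun r => rs.countP fun p => p.2 = r) ≠ 0 := by
  induction rs with
  | nil => simp [edgeCoeff]
  | cons p rs ih =>
    obtain ⟨a, b⟩ := p
    have hab : rk a < rk b := hrs (a, b) (by simp)
    have hrs' : ∀ p ∈ rs, rk p.1 < rk p.2 := fun p hp => hrs p (by simp [hp])
    have hsum : ∀ rs : List (ρ × ρ), ∑ r, rk r * rs.countP (fun p => p.2 = r) =
        (rs.map fun p => rk p.2).sum := by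
      intro rs
      induction rs with
      | nil => simp
      | cons q rs ih =>
        simp only [List.countP_cons, mul_add, Finset.sum_add_distrib, ih, List.map_cons,
          List.sum_cons]
        simp [add_comm]
    set e : ρ → ℕ := fun r => ((a, b) :: rs).countP fun p => p.2 = r with he
    have hb : lower e b = fun r => rs.countP fun p => p.2 = r := by
      funext r
      simp only [lower, he, Function.update_apply, List.countP_cons]
      by_cases hr : r = b
      · subst hr; simp
      · simp [hr, Ne.symm hr]
    have ha : (if e a = 0 then 0 else edgeCoeff rs (lower e a)) = 0 := by
      simp only [ite_eq_left_iff]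
      intro h0
      by_contra hne
      have h1 := weight_le_of_edgeCoeff rk rs hrs' _ hne
      have h2 : ∑ r, rk r * e r = _ := hsum ((a, b) :: rs)
      have hs : ∑ r, rk r * e r = ∑ r, rk r * lower e a r + rk a := by
        rw [← Finset.add_sum_erase _ _ (Finset.mem_univ a),
          ← Finset.add_sum_erase _ (fun r => rk r * lower e a r) (Finset.mem_univ a)]
        have : ∀ r ∈ Finset.univ.erase a, rk r * lower e a r = rk r * e r := fun r hr => by
          simp [lower, Finset.ne_of_mem_erase hr]
        rw [Finset.sum_congr rfl this]
        obtain ⟨k, hk⟩ := Nat.exists_eq_succ_of_ne_zero h0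
        simp only [lower, Function.update_self, hk]
        simp; ring
      simp only [List.map_cons, List.sum_cons] at h2
      omega
    rw [edgeCoeff, ha, hb, zero_sub, neg_ne_zero, if_neg]
    · exact ih hrs'
    · simp [he]

/-- Colouring a gadget together with an ordered remainder: an element of the remainder only has
to avoid its predecessors and the half-edges marked `false`. -/
lemma exists_choice_of_forcedOn {k : ℕ} (es : List (Fin m × Fin m)) (rs : List (ρ × ρ))
    (bd : List (Bool × Fin m × ρ)) (d : Fin m → ℕ)
    (h : ForcedOn es (bd.map fun x => (x.1, x.2.1)) d) (rk : ρ → ℕ)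
    (hrs : ∀ p ∈ rs, rk p.1 < rk p.2) (L : Fin m → Finset (Fin k)) (L' : ρ → Finset (Fin k))
    (hL : ∀ g, d g < (L g).card)
    (hL' : ∀ r, (rs.countP fun p => p.2 = r) +
      (bd.countP fun x => x.1 = false ∧ x.2.2 = r) < (L' r).card) :
    ∃ (c : Fin m → Fin k) (c' : ρ → Fin k), (∀ g, c g ∈ L g) ∧ (∀ r, c' r ∈ L' r) ∧
      (∀ p ∈ es, c p.1 ≠ c p.2) ∧ (∀ p ∈ rs, c' p.1 ≠ c' p.2) ∧
      ∀ x ∈ bd, c x.2.1 ≠ c' x.2.2 := by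
  obtain ⟨c, hc, hc'⟩ := exists_choice_of_edgeCoeff _ _
    (edgeCoeff_of_forcedOn es rs bd d _ h (edgeCoeff_later rk rs hrs)) (Sum.elim L L')
    (by rintro (g | r); exacts [hL g, hL' r])
  refine ⟨fun g => c (Sum.inl g), fun r => c (Sum.inr r), fun g => hc (Sum.inl g),
    fun r => hc (Sum.inr r), fun p hp => hc' (Sum.inl p.1, Sum.inl p.2) ?_,
    fun p hp => hc' (Sum.inr p.1, Sum.inr p.2) ?_,
    fun x hx => hc' (Sum.inl x.2.1, Sum.inr x.2.2) ?_⟩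
  · exact List.mem_append_right _ (List.mem_append_left _ (List.mem_map.2 ⟨p, hp, rfl⟩))
  · exact List.mem_append_right _ (List.mem_append_right _ (List.mem_map.2 ⟨p, hp, rfl⟩))
  · exact List.mem_append_left _ (List.mem_map.2 ⟨x, hx, rfl⟩)

end Gadget

section Colouring

open Classical

variable {V : Type} [Fintype V] {G : SimpleGraph V}

/-- Two edges are near if they share a vertex or are joined by an edge. -/
def Near (G : SimpleGraph V) (e f : Sym2 V) : Prop := ∃ x ∈ e, ∃ y ∈ f, x = y ∨ G.Adj x y

omit [Fintype V] in
lemma Near.symm {e f : Sym2 V} (h : Near G e f) : Near G f e := by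
  obtain ⟨x, hx, y, hy, h⟩ := h
  exact ⟨y, hy, x, hx, h.imp Eq.symm SimpleGraph.Adj.symm⟩

/-- A colouring of the edges in `A` with nonzero colours in which near edges get different
colours. -/
def ProperOn (G : SimpleGraph V) (A : Finset (Sym2 V)) (c : Sym2 V → Fin 8) : Prop :=
  ∀ e ∈ A, c e ≠ 0 ∧ ∀ f ∈ A, e ≠ f → Near G e f → c e ≠ c f

/-- The edges of `A` that are near `e` and different from `e`. -/
noncomputable def conf (G : SimpleGraph V) (A : Finset (Sym2 V)) (e : Sym2 V) :
    Finset (Sym2 V) := A.filter fun f => f ≠ e ∧ Near G e f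

/-- The nonzero colours available for `e` once the edges in `A` have been coloured. -/
noncomputable def avail (G : SimpleGraph V) (A : Finset (Sym2 V)) (c : Sym2 V → Fin 8)
    (e : Sym2 V) : Finset (Fin 8) := Finset.univ.erase 0 \ (conf G A e).image c

/-- The edges of `A` at the vertex `t`. -/
noncomputable def inc (A : Finset (Sym2 V)) (t : V) : Finset (Sym2 V) := A.filter (t ∈ ·)

/-- The vertices outside the edge `s(x, y)` adjacent to it. -/
noncomputable def nbrs (G : SimpleGraph V) (x y : V) : Finset V :=
  (G.neighborFinset x).erase y ∪ (G.neighborFinset y).erase x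

omit [Fintype V] in
lemma mem_conf {A : Finset (Sym2 V)} {e f : Sym2 V} :
    f ∈ conf G A e ↔ f ∈ A ∧ f ≠ e ∧ Near G e f := by simp [conf]

omit [Fintype V] in
lemma mem_inc {A : Finset (Sym2 V)} {e : Sym2 V} {t : V} : e ∈ inc A t ↔ e ∈ A ∧ t ∈ e := by
  simp [inc]

lemma mem_nbrs {x y t : V} :
    t ∈ nbrs G x y ↔ (t ≠ y ∧ G.Adj x t) ∨ (t ≠ x ∧ G.Adj y t) := by simp [nbrs]

omit [Fintype V] in
lemma mem_avail {A : Finset (Sym2 V)} {c : Sym2 V → Fin 8} {e : Sym2 V} {k : Fin 8} :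
    k ∈ avail G A c e ↔ k ≠ 0 ∧ ∀ f ∈ A, f ≠ e → Near G e f → c f ≠ k := by
  simp [avail, mem_conf]

omit [Fintype V] in
lemma card_avail (A : Finset (Sym2 V)) (c : Sym2 V → Fin 8) (e : Sym2 V) :
    7 ≤ (avail G A c e).card + (conf G A e).card := by
  have h1 := Finset.le_card_sdiff ((conf G A e).image c) (Finset.univ.erase (0 : Fin 8))
  have h2 := Finset.card_image_le (s := conf G A e) (f := c)
  have h3 : (Finset.univ.erase (0 : Fin 8)).card = 7 := by decide
  rw [avail]
  omega

omit [Fintype V] in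
lemma ProperOn.union {A B : Finset (Sym2 V)} {c c' : Sym2 V → Fin 8} (hA : ProperOn G A c)
    (hB : ∀ e ∈ B, c' e ∈ avail G A c e)
    (hBB : ∀ e ∈ B, ∀ f ∈ B, e ≠ f → Near G e f → c' e ≠ c' f) :
    ProperOn G (A ∪ B) fun e => if e ∈ B then c' e else c e := by
  intro e he
  refine ⟨?_, fun f hf hef hn => ?_⟩
  · by_cases h : e ∈ B
    · simpa [h] using (mem_avail.1 (hB e h)).1
    · simpa [h] using (hA e (by simpa [h] using he)).1
  · by_cases h : e ∈ B <;> by_cases h' : f ∈ B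
    · simpa [h, h'] using hBB e h f h' hef hn
    · simpa [h, h'] using ((mem_avail.1 (hB e h)).2 f (by simpa [h'] using hf) hef.symm hn).symm
    · simpa [h, h'] using (mem_avail.1 (hB f h')).2 e (by simpa [h] using he) hef hn.symm
    · simpa [h, h'] using (hA e (by simpa [h] using he)).2 f (by simpa [h'] using hf) hef hn

omit [Fintype V] in
lemma ProperOn.mono {A B : Finset (Sym2 V)} {c : Sym2 V → Fin 8} (hA : ProperOn G A c)
    (h : B ⊆ A) : ProperOn G B c :=
  fun e he => ⟨(hA e (h he)).1, fun f hf => (hA e (h he)).2 f (h hf)⟩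

omit [Fintype V] in
/-- Greedy colouring: every edge sees at most six edges of smaller or equal rank. -/
lemma exists_properOn_of_rank (A : Finset (Sym2 V)) (rk : Sym2 V → ℕ)
    (h : ∀ e ∈ A, (conf G (A.filter fun f => rk f ≤ rk e) e).card ≤ 6) :
    ∃ c, ProperOn G A c := by
  induction A using Finset.strongInduction with
  | H A ih =>
    rcases A.eq_empty_or_nonempty with rfl | hne
    · exact ⟨fun _ => 0, by simp [ProperOn]⟩
    obtain ⟨e, he, hmax⟩ := A.exists_max_image rk hne
    obtain ⟨c, hc⟩ := ih (A.erase e) (Finset.erase_ssubset he) fun f hf => by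
      refine (Finset.card_le_card ?_).trans (h f (Finset.mem_of_mem_erase hf))
      intro g hg
      simp only [mem_conf, Finset.mem_filter, Finset.mem_erase] at hg ⊢
      tauto
    have h6 : (conf G (A.erase e) e).card ≤ 6 := by
      refine (Finset.card_le_card ?_).trans (h e he)
      intro g hg
      simp only [mem_conf, Finset.mem_filter, Finset.mem_erase] at hg ⊢
      exact ⟨⟨hg.1.2, hmax g hg.1.2⟩, hg.2⟩
    have hav := card_avail (G := G) (A.erase e) c e
    obtain ⟨k, hk⟩ : (avail G (A.erase e) c e).Nonempty := by
      rw [← Finset.card_pos]; omega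
    have := hc.union (B := {e}) (c' := fun _ => k) (by simpa using hk) (by simp)
    exact ⟨_, this.mono (by intro f; by_cases hf : f = e <;> simp [hf])⟩

/-- The edges conflicting with `s(x, y)` are grouped by the neighbours of `s(x, y)`. -/
lemma conf_subset {A : Finset (Sym2 V)} (hA : ∀ e ∈ A, e ∈ G.edgeSet) {x y : V} :
    conf G A s(x, y) ⊆ (nbrs G x y).biUnion (inc A) := by
  have key : ∀ x y z : V, s(x, z) ∈ A → s(x, z) ≠ s(x, y) → z ∈ nbrs G x y := by
    intro x y z hz hne
    have : G.Adj x z := hA _ hz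
    exact mem_nbrs.2 (Or.inl ⟨by rintro rfl; exact hne rfl, this⟩)
  intro f hf
  obtain ⟨hfA, hne, a, ha, b, hb, hab⟩ := mem_conf.1 hf
  simp only [Finset.mem_biUnion, mem_inc]
  by_cases hx : x ∈ f
  · obtain ⟨z, rfl⟩ := Sym2.mem_iff_exists.1 hx
    exact ⟨z, key x y z hfA hne, hfA, by simp⟩
  by_cases hy : y ∈ f
  · obtain ⟨z, rfl⟩ := Sym2.mem_iff_exists.1 hy
    refine ⟨z, ?_, hfA, by simp⟩
    have := key y x z hfA (by rwa [Sym2.eq_swap (a := y) (b := x)])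
    rw [mem_nbrs] at this ⊢
    tauto
  refine ⟨b, ?_, hfA, hb⟩
  rw [mem_nbrs]
  rcases Sym2.mem_iff.1 ha with rfl | rfl
  · rcases hab with rfl | hab
    · exact absurd hb hx
    · exact Or.inl ⟨by rintro rfl; exact hy hb, hab⟩
  · rcases hab with rfl | hab
    · exact absurd hb hy
    · exact Or.inr ⟨by rintro rfl; exact hx hb, hab⟩

lemma card_conf_le {A : Finset (Sym2 V)} (hA : ∀ e ∈ A, e ∈ G.edgeSet) {x y : V} :
    (conf G A s(x, y)).card ≤ ∑ t ∈ nbrs G x y, (inc A t).card :=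
  (Finset.card_le_card (conf_subset hA)).trans Finset.card_biUnion_le

lemma card_nbrs_le {x y : V} (hxy : G.Adj x y) :
    (nbrs G x y).card + 2 ≤ G.degree x + G.degree y := by
  have h1 := Finset.card_union_le ((G.neighborFinset x).erase y) ((G.neighborFinset y).erase x)
  have h2 := Finset.card_erase_of_mem (show y ∈ G.neighborFinset x by simpa)
  have h3 := Finset.card_erase_of_mem (show x ∈ G.neighborFinset y by simpa using hxy.symm)
  have h4 : 0 < G.degree x := Finset.card_pos.2 ⟨y, by simpa⟩
  have h5 : 0 < G.degree y := Finset.card_pos.2 ⟨x, by simpa using hxy.symm⟩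
  rw [G.card_neighborFinset_eq_degree] at h2 h3
  rw [nbrs]
  omega

/-- An edge sees at most six edges if one of the at most four groups is empty. -/
lemma card_conf_le_six {A : Finset (Sym2 V)} (hA : ∀ e ∈ A, e ∈ G.edgeSet)
    (h2 : ∀ t, (inc A t).card ≤ 2) {x y : V}
    (h : (nbrs G x y).card ≤ 3 ∨ (nbrs G x y).card ≤ 4 ∧ ∃ t ∈ nbrs G x y, inc A t = ∅) :
    (conf G A s(x, y)).card ≤ 6 := by
  refine (card_conf_le hA).trans ?_
  rcases h with h | ⟨h, t, ht, ht0⟩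
  · exact (Finset.sum_le_card_nsmul _ _ 2 fun t _ => h2 t).trans (by simp; omega)
  · rw [← Finset.add_sum_erase _ _ ht, ht0]
    refine (add_le_add_right (Finset.sum_le_card_nsmul _ _ 2 fun t _ => h2 t) _).trans ?_
    rw [Finset.card_erase_of_mem ht]
    simp; omega

/-- A matching of edges between vertices of degree three, together with a proper colouring of the
remaining edges, gives a good colouring. -/
lemma goodColoring_of_properOn {c : Sym2 V → Fin 8} {A : Finset (Sym2 V)}
    (hM : ∀ x y z, G.Adj x y → G.Adj x z → s(x, y) ∉ A → s(x, z) ∉ A → y = z)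
    (hdeg : ∀ x y, G.Adj x y → s(x, y) ∉ A → G.degree x = 3)
    (hc : ProperOn G A c) : ∃ c, GoodColoring G c := by
  refine ⟨fun e => if e ∈ A then c e else 0, ⟨?_, ?_⟩, ?_⟩
  · intro a b x y hab hxy hne h1 h2
    have h1' : s(a, b) ∉ A := fun h => (hc _ h).1 (by simpa [h] using h1)
    have h2' : s(x, y) ∉ A := fun h => (hc _ h).1 (by simpa [h] using h2)
    refine ⟨?_, ?_, ?_, ?_⟩
    · rintro rfl; exact hne (by rw [hM a b y hab hxy h1' h2'])
    · rintro rfl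
      exact hne (by rw [hM a b x hab hxy.symm h1' (by rwa [Sym2.eq_swap]), Sym2.eq_swap])
    · rintro rfl
      exact hne (by rw [hM b a y hab.symm hxy (by rwa [Sym2.eq_swap]) h2', Sym2.eq_swap])
    · rintro rfl
      exact hne (by rw [hM b a x hab.symm hxy.symm (by rwa [Sym2.eq_swap]) (by rwa [Sym2.eq_swap])])
  · intro a b x y hab hxy hne h1 h2
    have h1' : s(a, b) ∈ A := by by_contra h; simp [h] at h2
    have h2' : s(x, y) ∈ A := by by_contra h; rw [h1] at h2; simp [h] at h2
    have hcc : c s(a, b) = c s(x, y) := by simpa [h1', h2'] using h1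
    have hn : ¬ Near G s(a, b) s(x, y) := fun h => (hc _ h1').2 _ h2' hne h hcc
    simp only [Near, Sym2.mem_iff, not_exists, not_and, not_or] at hn
    have p1 := hn a (by simp) x (by simp)
    have p2 := hn a (by simp) y (by simp)
    have p3 := hn b (by simp) x (by simp)
    have p4 := hn b (by simp) y (by simp)
    tauto
  · intro a b hab h
    have h' : s(a, b) ∉ A := fun h' => (hc _ h').1 (by simpa [h'] using h)
    have e1 := hdeg a b hab h'
    have e2 := hdeg b a hab.symm (by rwa [Sym2.eq_swap])
    rw [← G.card_neighborFinset_eq_degree] at e1 e2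
    constructor
    · rw [Set.ncard_eq_toFinset_card']; exact e1
    · rw [Set.ncard_eq_toFinset_card']; exact e2

end Colouring

section Reductions

open Classical

variable {V : Type} [Fintype V] {G H : SimpleGraph V}

lemma Subcubic.degree_le (hG : Subcubic G) (v : V) : G.degree v ≤ 3 := by
  have := hG v
  rwa [Set.ncard_eq_toFinset_card', ← SimpleGraph.neighborFinset, G.card_neighborFinset_eq_degree]
    at this

lemma GoodColoring.degree_eq {c : Sym2 V → Fin 8} (h : GoodColoring G c) {x y : V}
    (hxy : G.Adj x y) (h0 : c s(x, y) = 0) : G.degree x = 3 := by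
  have := (h.2 x y hxy h0).1
  rwa [Set.ncard_eq_toFinset_card', ← SimpleGraph.neighborFinset, G.card_neighborFinset_eq_degree]
    at this

omit [Fintype V] in
lemma GoodColoring.eq_of_zero {c : Sym2 V → Fin 8} (h : GoodColoring G c) {x y z : V}
    (hxy : G.Adj x y) (hxz : G.Adj x z) (h0 : c s(x, y) = 0) (h0' : c s(x, z) = 0) : y = z := by
  by_contra hne
  exact (h.1.1 x y x z hxy hxz (fun h => hne (Sym2.congr_right.1 h)) h0 h0').1 rfl

omit [Fintype V] in
lemma GoodColoring.ne_of_near {c : Sym2 V → Fin 8} (h : GoodColoring G c) {e f : Sym2 V}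
    (he : e ∈ G.edgeSet) (hf : f ∈ G.edgeSet) (hne : e ≠ f) (h0 : c e ≠ 0) (hn : Near G e f) :
    c e ≠ c f := by
  induction e with | h a b =>
  induction f with | h x y =>
  intro hc
  have := h.1.2 a b x y he hf hne hc h0
  obtain ⟨p, hp, q, hq, hpq⟩ := hn
  rcases Sym2.mem_iff.1 hp with rfl | rfl <;> rcases Sym2.mem_iff.1 hq with rfl | rfl <;> tauto

/-- The edges of `G` with nonzero colour. -/
noncomputable def nonzero (G : SimpleGraph V) (c : Sym2 V → Fin 8) : Finset (Sym2 V) :=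
  G.edgeFinset.filter fun e => c e ≠ 0

lemma mem_nonzero {c : Sym2 V → Fin 8} {e : Sym2 V} :
    e ∈ nonzero G c ↔ e ∈ G.edgeSet ∧ c e ≠ 0 := by simp [nonzero]

/-- A good colouring of a subgraph `H` is proper in `G` if no edge of `G` outside `H` joins
edges of `H`. -/
lemma GoodColoring.properOn {c : Sym2 V → Fin 8} (h : GoodColoring H c)
    (hnear : ∀ x y p q, H.Adj x y → H.Adj p q → G.Adj x p → H.Adj x p) :
    ProperOn G (nonzero H c) c := by
  intro e he
  rw [mem_nonzero] at he
  refine ⟨he.2, fun f hf hne hn => h.ne_of_near he.1 (mem_nonzero.1 hf).1 hne he.2 ?_⟩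
  obtain ⟨x, hx, p, hp, hxp⟩ := hn
  refine ⟨x, hx, p, hp, hxp.imp id fun hxp => ?_⟩
  obtain ⟨y, rfl⟩ := Sym2.mem_iff_exists.1 hx
  obtain ⟨q, rfl⟩ := Sym2.mem_iff_exists.1 hp
  exact hnear x y p q he.1 (mem_nonzero.1 hf).1 hxp

lemma card_inc_le_degree {A : Finset (Sym2 V)} (hA : ∀ e ∈ A, e ∈ G.edgeSet) (t : V) :
    (inc A t).card ≤ G.degree t := by
  rw [← G.card_neighborFinset_eq_degree]
  refine (Finset.card_le_card (t := (G.neighborFinset t).image fun z => s(t, z)) ?_).trans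
    Finset.card_image_le
  intro e he
  obtain ⟨heA, hte⟩ := mem_inc.1 he
  obtain ⟨z, rfl⟩ := Sym2.mem_iff_exists.1 hte
  exact Finset.mem_image.2 ⟨z, by simpa using hA _ heA, rfl⟩

lemma degree_le_of_le (h : H ≤ G) (v : V) : H.degree v ≤ G.degree v := by
  rw [← H.card_neighborFinset_eq_degree, ← G.card_neighborFinset_eq_degree]
  exact Finset.card_le_card fun x hx => by
    rw [SimpleGraph.mem_neighborFinset] at hx ⊢
    exact h hx

/-- Colour the pendant edge at a leaf last. -/
lemma exists_goodColoring_of_leaf (hG : Subcubic G)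
    (ih : ∀ H < G, ∃ c, GoodColoring H c) {u : V} (hu : G.degree u = 1) :
    ∃ c, GoodColoring G c := by
  rw [← G.card_neighborFinset_eq_degree, Finset.card_eq_one] at hu
  obtain ⟨v, hv⟩ := hu
  have hu : ∀ w, G.Adj u w ↔ w = v := fun w => by
    rw [← SimpleGraph.mem_neighborFinset, hv, Finset.mem_singleton]
  have huv : G.Adj u v := (hu v).2 rfl
  set H := G.deleteEdges {s(u, v)} with hH
  have hHadj : ∀ x y, H.Adj x y ↔ G.Adj x y ∧ s(x, y) ≠ s(u, v) := fun x y => by simp [hH]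
  have hHu : ∀ w, ¬ H.Adj u w := fun w hw => by
    rw [hHadj, hu] at hw
    exact hw.2 (by rw [hw.1])
  have hle : H ≤ G := SimpleGraph.deleteEdges_le _
  have hlt : H < G := lt_of_le_of_ne hle fun h => hHu v (h ▸ huv)
  obtain ⟨c, hc⟩ := ih H hlt
  have hP : ProperOn G (nonzero H c) c := hc.properOn fun x y p q hxy hpq hxp => by
    rw [hHadj]
    refine ⟨hxp, fun h => ?_⟩
    rcases Sym2.eq_iff.1 h with ⟨rfl, rfl⟩ | ⟨rfl, rfl⟩
    · exact hHu y hxy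
    · exact hHu q hpq
  have hA : ∀ e ∈ nonzero H c, e ∈ G.edgeSet := fun e he =>
    SimpleGraph.edgeSet_mono hle (mem_nonzero.1 he).1
  have h6 : (conf G (nonzero H c) s(u, v)).card ≤ 6 := by
    refine (card_conf_le hA).trans ((Finset.sum_le_card_nsmul _ _ 3 fun t _ =>
      (card_inc_le_degree hA t).trans (hG.degree_le t)).trans ?_)
    have h1 := card_nbrs_le huv
    have h2 := hG.degree_le v
    have h3 : G.degree u = 1 := by rw [← G.card_neighborFinset_eq_degree, hv]; simp
    simp; omega
  have hav := card_avail (G := G) (nonzero H c) c s(u, v)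
  obtain ⟨k, hk⟩ : (avail G (nonzero H c) c s(u, v)).Nonempty := by
    rw [← Finset.card_pos]; omega
  have hP' := hP.union (B := {s(u, v)}) (c' := fun _ => k) (by simpa using hk)
    (by simp only [Finset.mem_singleton]; rintro _ rfl _ rfl h; exact absurd rfl h)
  have key : ∀ x y, G.Adj x y → s(x, y) ∉ nonzero H c ∪ {s(u, v)} →
      H.Adj x y ∧ c s(x, y) = 0 := fun x y hxy h => by
    rw [Finset.mem_union, Finset.mem_singleton, mem_nonzero, SimpleGraph.mem_edgeSet, hHadj] at h
    rw [hHadj]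
    tauto
  refine goodColoring_of_properOn (fun x y z hxy hxz h1 h2 => ?_) (fun x y hxy h => ?_) hP'
  · exact hc.eq_of_zero (key x y hxy h1).1 (key x z hxz h2).1 (key x y hxy h1).2 (key x z hxz h2).2
  · have h1 := hc.degree_eq (key x y hxy h).1 (key x y hxy h).2
    have h2 := degree_le_of_le hle x
    have h3 := hG.degree_le x
    omega

lemma exists_perm_disjoint (a : Fin 8) (P Q : Finset (Fin 8)) (hP : P.card ≤ 2) (hQ : Q.card ≤ 2)
    (hP0 : 0 ∉ P) (hQ0 : 0 ∉ Q) (hPa : a ∉ P) (hQa : a ∉ Q) :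
    ∃ π : Equiv.Perm (Fin 8), π 0 = 0 ∧ π a = a ∧ ∀ q ∈ Q, π q ∉ P := by
  induction hn : (P ∩ Q).card generalizing Q with
  | zero =>
    refine ⟨1, rfl, rfl, fun q hq hp => ?_⟩
    have := Finset.card_eq_zero.1 hn
    exact Finset.notMem_empty q (this ▸ Finset.mem_inter.2 ⟨hp, hq⟩)
  | succ n ih =>
    obtain ⟨q, hq⟩ : (P ∩ Q).Nonempty := by rw [← Finset.card_pos]; omega
    obtain ⟨hqP, hqQ⟩ := Finset.mem_inter.1 hq
    obtain ⟨r, hr⟩ : (Finset.univ \ (P ∪ Q ∪ {0, a})).Nonempty := by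
      rw [← Finset.card_pos]
      have h1 := Finset.le_card_sdiff (P ∪ Q ∪ {0, a}) (Finset.univ : Finset (Fin 8))
      have h2 := Finset.card_union_le (P ∪ Q) {0, a}
      have h3 := Finset.card_union_le P Q
      have h4 := Finset.card_union_add_card_inter P Q
      have h5 : ({0, a} : Finset (Fin 8)).card ≤ 2 := Finset.card_le_two
      simp only [Finset.card_univ, Fintype.card_fin] at h1
      omega
    simp only [Finset.mem_sdiff, Finset.mem_univ, Finset.mem_union, Finset.mem_insert,
      Finset.mem_singleton, true_and, not_or] at hr
    have h0q : 0 ≠ q := by rintro rfl; exact hP0 hqP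
    have haq : a ≠ q := by rintro rfl; exact hPa hqP
    have hs : ∀ x, x ≠ q → x ≠ r → Equiv.swap q r x = x := fun x => Equiv.swap_apply_of_ne_of_ne
    have hmem : ∀ x, x ∈ Q.image (Equiv.swap q r) ↔ (x ∈ Q ∧ x ≠ q) ∨ x = r := by
      intro x
      rw [Finset.mem_image]
      constructor
      · rintro ⟨y, hy, rfl⟩
        by_cases h : y = q
        · subst h; right; simp
        · left
          have : y ≠ r := by rintro rfl; exact hr.1.2 hy
          rw [hs y h this]
          exact ⟨hy, h⟩
      · rintro (⟨h, h'⟩ | rfl)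
        · exact ⟨x, h, hs x h' (by rintro rfl; exact hr.1.2 h)⟩
        · exact ⟨q, hqQ, by simp⟩
    obtain ⟨π, h0, ha, h⟩ := ih (Q.image (Equiv.swap q r))
      ((Finset.card_image_le).trans hQ) (by rw [hmem]; tauto) (by rw [hmem]; tauto) (by
        have : P ∩ Q.image (Equiv.swap q r) = (P ∩ Q).erase q := by
          ext x
          simp only [Finset.mem_inter, hmem, Finset.mem_erase]
          constructor
          · rintro ⟨hx, (⟨h, h'⟩ | rfl)⟩
            · tauto
            · tauto
          · tauto
        rw [this, Finset.card_erase_of_mem hq, hn]; rfl)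
    refine ⟨(Equiv.swap q r).trans π, ?_, ?_, fun x hx => ?_⟩
    · rw [Equiv.trans_apply, hs 0 h0q (Ne.symm hr.2.1), h0]
    · rw [Equiv.trans_apply, hs a haq (Ne.symm hr.2.2), ha]
    · exact h _ (Finset.mem_image_of_mem _ hx)

lemma exists_perm (a b : Fin 8) (P Q : Finset (Fin 8)) (hP : P.card ≤ 2) (hQ : Q.card ≤ 2)
    (ha : a ≠ 0) (hb : b ≠ 0) (hP0 : 0 ∉ P) (hQ0 : 0 ∉ Q) (hPa : a ∉ P) (hQb : b ∉ Q) :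
    ∃ π : Equiv.Perm (Fin 8), π 0 = 0 ∧ π b = a ∧ ∀ q ∈ Q, π q ∉ P := by
  have h0 : Equiv.swap b a 0 = 0 := Equiv.swap_apply_of_ne_of_ne hb.symm ha.symm
  obtain ⟨π, h1, h2, h3⟩ := exists_perm_disjoint a P (Q.image (Equiv.swap b a)) hP
    (Finset.card_image_le.trans hQ) hP0
    (by
      rw [Finset.mem_image]
      rintro ⟨x, hx, h⟩
      rw [← h0, (Equiv.swap b a).injective.eq_iff] at h
      exact hQ0 (h ▸ hx)) hPa
    (by
      rw [Finset.mem_image]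
      rintro ⟨x, hx, h⟩
      have := (Equiv.swap b a).injective (h.trans (Equiv.swap_apply_left b a).symm)
      exact hQb (this ▸ hx))
  refine ⟨(Equiv.swap b a).trans π, ?_, ?_, fun x hx => h3 _ (Finset.mem_image_of_mem _ hx)⟩
  · rw [Equiv.trans_apply, h0, h1]
  · rw [Equiv.trans_apply, Equiv.swap_apply_left, h2]

/-- The subgraph formed by the edges with an endpoint in `A`. -/
def touching (G : SimpleGraph V) (A : Set V) : SimpleGraph V where
  Adj x y := G.Adj x y ∧ (x ∈ A ∨ y ∈ A)
  symm := ⟨fun _ _ h => ⟨h.1.symm, h.2.symm⟩⟩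
  loopless := ⟨fun _ h => h.1.ne rfl⟩

omit [Fintype V] in
lemma near_touching {A : Set V} {u v : V}
    (hcut : ∀ x y, G.Adj x y → x ∈ A → y ∉ A → x = u ∧ y = v) {e f : Sym2 V}
    (he : e ∈ (touching G A).edgeSet) (hf : f ∈ (touching G A).edgeSet) (hne : e ≠ f)
    (hn : Near G e f) : Near (touching G A) e f := by
  obtain ⟨x, hx, p, hp, hxp⟩ := hn
  refine ⟨x, hx, p, hp, hxp.imp id fun hxp => ⟨hxp, ?_⟩⟩
  by_contra! h
  obtain ⟨y, rfl⟩ := Sym2.mem_iff_exists.1 hx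
  obtain ⟨q, rfl⟩ := Sym2.mem_iff_exists.1 hp
  have h1 : y = u ∧ x = v := hcut y x he.1.symm (he.2.resolve_left h.1) h.1
  have h2 : q = u ∧ p = v := hcut q p hf.1.symm (hf.2.resolve_left h.2) h.2
  exact hne (by rw [h1.1, h1.2, h2.1, h2.2])

lemma touching_degree_ne {A : Set V} {u v : V}
    (hcut : ∀ x y, G.Adj x y → x ∈ A → y ∉ A → x = u ∧ y = v) (hv : v ∉ A) :
    (touching G A).degree v ≠ 3 := by
  have : (touching G A).neighborFinset v ⊆ {u} := fun w hw => by
    rw [SimpleGraph.mem_neighborFinset] at hw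
    exact Finset.mem_singleton.2 (hcut w v hw.1.symm (hw.2.resolve_left hv) hv).1
  have := Finset.card_le_card this
  rw [SimpleGraph.card_neighborFinset_eq_degree, Finset.card_singleton] at this
  omega

lemma touching_zero {A : Set V} {u v : V}
    (hcut : ∀ x y, G.Adj x y → x ∈ A → y ∉ A → x = u ∧ y = v) {c : Sym2 V → Fin 8}
    (hc : GoodColoring (touching G A) c) {x y : V} (hxy : (touching G A).Adj x y)
    (h0 : c s(x, y) = 0) : x ∈ A := by
  by_contra hx
  obtain ⟨-, rfl⟩ := hcut y x hxy.1.symm (hxy.2.resolve_left hx) hx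
  exact touching_degree_ne hcut hx (hc.degree_eq hxy h0)

omit [Fintype V] in
lemma touching_le (A : Set V) : touching G A ≤ G := fun _ _ h => h.1

omit [Fintype V] in
lemma touching_lt {A : Set V} {x y : V} (hxy : G.Adj x y) (hx : x ∉ A) (hy : y ∉ A) :
    touching G A < G :=
  lt_of_le_of_ne (touching_le A) fun h => by
    have : (touching G A).Adj x y := h.ge hxy
    exact this.2.elim hx hy

lemma card_colours_le_two (hG : Subcubic G) (c : Sym2 V → Fin 8) {u v : V} (huv : G.Adj u v) :
    ((((G.neighborFinset u).erase v).image fun w => c s(u, w)).erase 0).card ≤ 2 := by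
  refine (Finset.card_erase_le.trans Finset.card_image_le).trans ?_
  rw [Finset.card_erase_of_mem (by simpa using huv), G.card_neighborFinset_eq_degree]
  have := hG.degree_le u
  omega

/-- Colour the two sides of an edge cut of size at most one separately. -/
lemma exists_goodColoring_of_cut (hG : Subcubic G) (hmin : ∀ v, 2 ≤ G.degree v)
    (ih : ∀ H < G, ∃ c, GoodColoring H c) {A : Set V} {u v : V} (hu : u ∈ A) (hv : v ∉ A)
    (hcut : ∀ x y, G.Adj x y → x ∈ A → y ∉ A → x = u ∧ y = v) :
    ∃ c, GoodColoring G c := by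
  have hcut' : ∀ x y, G.Adj x y → x ∈ Aᶜ → y ∉ Aᶜ → x = v ∧ y = u := fun x y h hx hy =>
    (hcut y x h.symm (by simpa using hy) hx).symm
  have hother : ∀ x y, ∃ w, G.Adj x w ∧ w ≠ y := fun x y => by
    have : 1 < (G.neighborFinset x).card := by
      rw [G.card_neighborFinset_eq_degree]; exact hmin x
    obtain ⟨w, hw, hwy⟩ := Finset.exists_mem_ne this y
    exact ⟨w, by simpa using hw, hwy⟩
  obtain ⟨w, hvw, hwu⟩ := hother v u
  obtain ⟨w', huw', hwv'⟩ := hother u v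
  obtain ⟨c₁, h₁⟩ := ih _ (touching_lt (A := A) hvw hv fun h => hwu (hcut w v hvw.symm h hv).1)
  obtain ⟨c₂, h₂⟩ := ih _ (touching_lt (A := Aᶜ) huw' (fun h => h hu)
    fun h => hwv' (hcut u w' huw' hu h).2)
  obtain ⟨π, hπ0, hπ, hπd⟩ : ∃ π : Equiv.Perm (Fin 8), π 0 = 0 ∧
      (G.Adj u v → π (c₂ s(u, v)) = c₁ s(u, v)) ∧
      (G.Adj u v → ∀ x y, G.Adj u x → x ≠ v → G.Adj v y → y ≠ u → c₁ s(u, x) ≠ 0 →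
        π (c₂ s(v, y)) ≠ c₁ s(u, x)) := by
    by_cases huv : G.Adj u v
    · have huv₁ : (touching G A).Adj u v := ⟨huv, Or.inl hu⟩
      have huv₂ : (touching G Aᶜ).Adj u v := ⟨huv, Or.inr hv⟩
      have ha : c₁ s(u, v) ≠ 0 := fun h =>
        hv (touching_zero hcut h₁ huv₁.symm (by rwa [Sym2.eq_swap]))
      have hb : c₂ s(u, v) ≠ 0 := fun h => touching_zero hcut' h₂ huv₂ h hu
      obtain ⟨π, h0, h1, h2⟩ := exists_perm (c₁ s(u, v)) (c₂ s(u, v))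
        ((((G.neighborFinset u).erase v).image fun w => c₁ s(u, w)).erase 0)
        ((((G.neighborFinset v).erase u).image fun w => c₂ s(v, w)).erase 0)
        (card_colours_le_two hG _ huv) (card_colours_le_two hG _ huv.symm) ha hb (by simp) (by simp)
        (by
          simp only [Finset.mem_erase, Finset.mem_image, SimpleGraph.mem_neighborFinset]
          rintro ⟨-, x, ⟨hxv, hx⟩, h⟩
          exact h₁.ne_of_near (e := s(u, v)) (f := s(u, x)) huv₁ ⟨hx, Or.inl hu⟩
            (fun h => hxv (Sym2.congr_right.1 h).symm) ha
            ⟨u, by simp, u, by simp, Or.inl rfl⟩ h.symm)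
        (by
          simp only [Finset.mem_erase, Finset.mem_image, SimpleGraph.mem_neighborFinset]
          rintro ⟨-, x, ⟨hxu, hx⟩, h⟩
          refine h₂.ne_of_near (e := s(u, v)) (f := s(v, x)) huv₂ ⟨hx, Or.inl hv⟩
            (fun h => hxu ?_) hb ⟨v, by simp, v, by simp, Or.inl rfl⟩ h.symm
          rw [Sym2.eq_swap] at h
          exact (Sym2.congr_right.1 h).symm)
      refine ⟨π, h0, fun _ => h1, fun _ x y hux hxv hvy hyu hne h => ?_⟩
      by_cases hz : c₂ s(v, y) = 0
      · rw [hz, h0] at h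
        exact hne h.symm
      · refine h2 (c₂ s(v, y)) ?_ ?_
        · simp only [Finset.mem_erase, Finset.mem_image, SimpleGraph.mem_neighborFinset]
          exact ⟨hz, y, ⟨hyu, hvy⟩, rfl⟩
        · rw [h]
          simp only [Finset.mem_erase, Finset.mem_image, SimpleGraph.mem_neighborFinset]
          exact ⟨hne, x, ⟨hxv, hux⟩, rfl⟩
    · exact ⟨1, rfl, fun h => absurd h huv, fun h => absurd h huv⟩
  set c : Sym2 V → Fin 8 := fun e => if e ∈ (touching G A).edgeSet then c₁ e else π (c₂ e) with hcd
  have hcA : ∀ e ∈ (touching G A).edgeSet, c e = c₁ e := fun e he => if_pos he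
  have hcB : ∀ e ∈ (touching G Aᶜ).edgeSet, c e = π (c₂ e) := fun e he => by
    by_cases h : e ∈ (touching G A).edgeSet
    · rw [hcA e h]
      induction e with | h x y =>
      obtain ⟨hadj, hx⟩ := h
      rcases hx with hx | hx
      · obtain ⟨rfl, rfl⟩ := hcut x y hadj hx (he.2.resolve_left fun h => h hx)
        exact (hπ hadj).symm
      · obtain ⟨rfl, rfl⟩ := hcut y x hadj.symm hx (he.2.resolve_right fun h => h hx)
        rw [Sym2.eq_swap]
        exact (hπ hadj.symm).symm
    · exact if_neg h
  have hcases : ∀ e ∈ G.edgeSet, e ∈ (touching G A).edgeSet ∨ e ∈ (touching G Aᶜ).edgeSet := by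
    intro e he
    induction e with | h x y =>
    by_cases hx : x ∈ A
    · exact Or.inl ⟨he, Or.inl hx⟩
    · exact Or.inr ⟨he, Or.inl hx⟩
  have hπz : ∀ x, π x = 0 ↔ x = 0 := fun x => by
    rw [← hπ0, π.injective.eq_iff, hπ0]
  have hmixed : ∀ e f, e ∈ (touching G A).edgeSet → f ∈ (touching G Aᶜ).edgeSet → e ≠ f →
      c e ≠ 0 → Near G e f → c e ≠ c f := by
    intro e f he hf hne h0 hn
    by_cases he' : e ∈ (touching G Aᶜ).edgeSet
    · rw [hcB e he'] at h0 ⊢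
      rw [hcB f hf, Ne, π.injective.eq_iff]
      exact h₂.ne_of_near he' hf hne (by rwa [Ne, ← hπz]) (near_touching hcut' he' hf hne hn)
    by_cases hf' : f ∈ (touching G A).edgeSet
    · rw [hcA e he] at h0 ⊢
      rw [hcA f hf']
      exact h₁.ne_of_near he hf' hne h0 (near_touching hcut he hf' hne hn)
    obtain ⟨x, hx, p, hp, hxp⟩ := hn
    obtain ⟨y, rfl⟩ := Sym2.mem_iff_exists.1 hx
    obtain ⟨q, rfl⟩ := Sym2.mem_iff_exists.1 hp
    have hxA : x ∈ A ∧ y ∈ A := by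
      by_contra h
      exact he' ⟨he.1, by simp only [Set.mem_compl_iff]; tauto⟩
    have hpA : p ∉ A ∧ q ∉ A := by
      by_contra h
      exact hf' ⟨hf.1, by tauto⟩
    rcases hxp with rfl | hxp
    · exact absurd hxA.1 hpA.1
    obtain ⟨rfl, rfl⟩ := hcut x p hxp hxA.1 hpA.1
    rw [hcA _ he] at h0 ⊢
    rw [hcB _ hf]
    exact (hπd hxp y q he.1 (by rintro rfl; exact hv hxA.2) hf.1 (by rintro rfl; exact hpA.2 hu)
      h0).symm
  have hP : ProperOn G (nonzero G c) c := by
    intro e he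
    obtain ⟨heE, he0⟩ := mem_nonzero.1 he
    refine ⟨he0, fun f hf hne hn => ?_⟩
    obtain ⟨hfE, hf0⟩ := mem_nonzero.1 hf
    rcases hcases e heE with h | h <;> rcases hcases f hfE with h' | h'
    · rw [hcA e h] at he0 ⊢
      rw [hcA f h']
      exact h₁.ne_of_near h h' hne he0 (near_touching hcut h h' hne hn)
    · exact hmixed e f h h' hne he0 hn
    · exact (hmixed f e h' h hne.symm hf0 hn.symm).symm
    · rw [hcB e h] at he0 ⊢
      rw [hcB f h', Ne, π.injective.eq_iff]
      exact h₂.ne_of_near h h' hne (by rwa [Ne, ← hπz]) (near_touching hcut' h h' hne hn)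
  have key : ∀ x y, G.Adj x y → s(x, y) ∉ nonzero G c →
      (x ∈ A ∧ (touching G A).Adj x y ∧ c₁ s(x, y) = 0) ∨
        (x ∉ A ∧ (touching G Aᶜ).Adj x y ∧ c₂ s(x, y) = 0) := by
    intro x y hxy h
    have h0 : c s(x, y) = 0 := by
      by_contra h0
      exact h (mem_nonzero.2 ⟨hxy, h0⟩)
    by_cases hx : x ∈ A
    · have hh : (touching G A).Adj x y := ⟨hxy, Or.inl hx⟩
      exact Or.inl ⟨hx, hh, by rwa [← hcA _ hh]⟩
    · have hh : (touching G Aᶜ).Adj x y := ⟨hxy, Or.inl hx⟩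
      exact Or.inr ⟨hx, hh, by rwa [← hπz, ← hcB _ hh]⟩
  refine goodColoring_of_properOn (fun x y z hxy hxz h1 h2 => ?_) (fun x y hxy h => ?_) hP
  · rcases key x y hxy h1 with ⟨hx, h3, h4⟩ | ⟨hx, h3, h4⟩ <;>
      rcases key x z hxz h2 with ⟨hx', h5, h6⟩ | ⟨hx', h5, h6⟩
    · exact h₁.eq_of_zero h3 h5 h4 h6
    · exact absurd hx hx'
    · exact absurd hx' hx
    · exact h₂.eq_of_zero h3 h5 h4 h6
  · have h3 := hG.degree_le x
    rcases key x y hxy h with ⟨-, h1, h2⟩ | ⟨-, h1, h2⟩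
    · have := h₁.degree_eq h1 h2
      have := degree_le_of_le (touching_le (G := G) A) x
      omega
    · have := h₂.degree_eq h1 h2
      have := degree_le_of_le (touching_le (G := G) Aᶜ) x
      omega

end Reductions

section Tutte

open Classical

/-- A graph of even order without a perfect matching has a set `S` whose removal leaves at least
`|S| + 2` odd parts. -/
lemma exists_odd_parts {W : Type} [Fintype W] (K : SimpleGraph W) (heven : Even (Fintype.card W))
    (h : ¬ ∃ M : K.Subgraph, M.IsPerfectMatching) :
    ∃ (S : Finset W) (𝒞 : Finset (Finset W)), S.card + 2 ≤ 𝒞.card ∧ (∀ C ∈ 𝒞, Odd C.card) ∧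
      (∀ C ∈ 𝒞, Disjoint C S) ∧ (∀ C ∈ 𝒞, ∀ D ∈ 𝒞, C ≠ D → Disjoint C D) ∧
      ∀ C ∈ 𝒞, ∀ x ∈ C, ∀ y, K.Adj x y → y ∈ C ∨ y ∈ S := by
  rw [SimpleGraph.tutte] at h
  push Not at h
  obtain ⟨S, hS⟩ := h
  set K' := ((⊤ : K.Subgraph).deleteVerts S).coe with hK'
  have hcard : Nat.card ((⊤ : K.Subgraph).deleteVerts S).verts + S.ncard = Fintype.card W := by
    have h1 : ((⊤ : K.Subgraph).deleteVerts S).verts = Sᶜ := by simp [Set.compl_eq_univ_sdiff]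
    rw [h1, Nat.card_coe_set_eq, add_comm, Set.ncard_add_ncard_compl, Nat.card_eq_fintype_card]
  have hpar : S.ncard + 2 ≤ K'.oddComponents.ncard := by
    have h1 := K'.odd_ncard_oddComponents
    have h2 : S.ncard < K'.oddComponents.ncard := hS
    rcases Nat.even_or_odd S.ncard with h3 | h3
    · have : ¬ Odd K'.oddComponents.ncard := by
        rw [h1]
        grind
      grind
    · have : Odd K'.oddComponents.ncard := by
        rw [h1]
        grind
      grind
  let φ : K'.ConnectedComponent → Finset W := fun C => (Subtype.val '' C.supp).toFinset
  have hφ : ∀ C x, x ∈ φ C ↔ ∃ h : x ∈ ((⊤ : K.Subgraph).deleteVerts S).verts,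
      K'.connectedComponentMk ⟨x, h⟩ = C := by
    intro C x
    simp [φ]
  have hinj : ∀ C D x, x ∈ φ C → x ∈ φ D → C = D := by
    intro C D x hC hD
    obtain ⟨h1, h2⟩ := (hφ C x).1 hC
    obtain ⟨h3, h4⟩ := (hφ D x).1 hD
    rw [← h2, ← h4]
  have hne : ∀ C, (φ C).Nonempty := by
    intro C
    induction C using SimpleGraph.ConnectedComponent.ind with | _ v =>
    exact ⟨v, (hφ _ _).2 ⟨v.2, rfl⟩⟩
  have hφi : Function.Injective φ := by
    intro C D hCD
    obtain ⟨x, hx⟩ := hne C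
    exact hinj C D x hx (hCD ▸ hx)
  refine ⟨S.toFinset, K'.oddComponents.toFinset.image φ, ?_, ?_, ?_, ?_, ?_⟩
  · rw [Finset.card_image_of_injective _ hφi, ← Set.ncard_eq_toFinset_card',
      ← Set.ncard_eq_toFinset_card']
    exact hpar
  · simp only [Finset.mem_image, Set.mem_toFinset]
    rintro _ ⟨C, hC, rfl⟩
    simp only [φ]
    rw [← Set.ncard_eq_toFinset_card', Set.ncard_image_of_injective _ Subtype.val_injective]
    exact hC
  · simp only [Finset.mem_image, Set.mem_toFinset]
    rintro _ ⟨C, hC, rfl⟩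
    rw [Finset.disjoint_left]
    intro x hx
    obtain ⟨h1, -⟩ := (hφ C x).1 hx
    simpa using h1
  · simp only [Finset.mem_image, Set.mem_toFinset]
    rintro _ ⟨C, hC, rfl⟩ _ ⟨D, hD, rfl⟩ hne
    rw [Finset.disjoint_left]
    intro x hx hx'
    exact hne (by rw [hinj C D x hx hx'])
  · simp only [Finset.mem_image, Set.mem_toFinset]
    rintro _ ⟨C, hC, rfl⟩ x hx y hxy
    by_cases hy : y ∈ S
    · exact Or.inr hy
    · left
      obtain ⟨h1, h2⟩ := (hφ C x).1 hx
      refine (hφ C y).2 ⟨by simpa using hy, ?_⟩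
      rw [← h2, SimpleGraph.ConnectedComponent.eq]
      refine SimpleGraph.Adj.reachable ?_
      have h3 : x ∉ S := by simpa using h1
      simp [hK', hxy.symm, hy, h3]

variable {V : Type} [Fintype V] {G : SimpleGraph V}

/-- Every vertex has degree two or three and every edge cut has at least two edges. -/
structure Reduced (G : SimpleGraph V) : Prop where
  degree : ∀ v, G.degree v = 2 ∨ G.degree v = 3
  cut : ∀ (A : Set V) (u v : V), u ∈ A → v ∉ A →
    ∃ x y, G.Adj x y ∧ x ∈ A ∧ y ∉ A ∧ ¬ (x = u ∧ y = v)

/-- The darts leaving a set of vertices. -/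
noncomputable def leaving (G : SimpleGraph V) (D : Finset V) : Finset (V × V) :=
  Finset.univ.filter fun p => p.1 ∈ D ∧ p.2 ∉ D ∧ G.Adj p.1 p.2

lemma card_leaving_even (D : Finset V) (hD : ∀ v ∈ D, G.degree v = 3) :
    Even ((leaving G D).card + D.card) := by
  have h1 : (Finset.univ.filter fun p : V × V => p.1 ∈ D ∧ G.Adj p.1 p.2).card = 3 * D.card := by
    rw [Finset.card_eq_sum_card_fiberwise (f := Prod.fst) (t := D) (by
      intro p hp
      simp at hp
      simpa using hp.1)]
    rw [Finset.sum_congr rfl (g := fun _ => 3), Finset.sum_const, smul_eq_mul, mul_comm]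
    intro v hv
    rw [← hD v hv, ← G.card_neighborFinset_eq_degree]
    refine Finset.card_bij (fun p _ => p.2) ?_ ?_ ?_
    · rintro ⟨a, b⟩ hp
      simp at hp ⊢
      exact hp.2 ▸ hp.1.2
    · rintro ⟨a, b⟩ hp ⟨a', b'⟩ hp' h
      simp at hp hp' h ⊢
      exact ⟨hp.2.trans hp'.2.symm, h⟩
    · intro b hb
      exact ⟨(v, b), by simpa using ⟨hv, by simpa using hb⟩, rfl⟩
  have h2 : Even (Finset.univ.filter fun p : V × V => p.1 ∈ D ∧ p.2 ∈ D ∧ G.Adj p.1 p.2).card := by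
    rw [← ZMod.natCast_eq_zero_iff_even, Finset.cast_card]
    refine Finset.sum_involution (fun p _ => p.swap) (fun _ _ => by decide) ?_ ?_ ?_
    · rintro ⟨a, b⟩ hp - h
      simp at hp h
      exact hp.2.2.ne h.2
    · rintro ⟨a, b⟩ hp
      simp at hp ⊢
      exact ⟨hp.2.1, hp.1, hp.2.2.symm⟩
    · simp
  have h3 : (Finset.univ.filter fun p : V × V => p.1 ∈ D ∧ G.Adj p.1 p.2).card =
      (Finset.univ.filter fun p : V × V => p.1 ∈ D ∧ p.2 ∈ D ∧ G.Adj p.1 p.2).card +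
        (leaving G D).card := by
    rw [leaving, ← Finset.card_union_of_disjoint]
    · congr 1
      ext p
      simp only [Finset.mem_filter, Finset.mem_union, Finset.mem_univ, true_and]
      tauto
    · rw [Finset.disjoint_left]
      intro p h h'
      simp only [Finset.mem_filter] at h h'
      tauto
  grind

lemma Reduced.three_le_card_leaving (hG : Reduced G) (D : Finset V) (hD : ∀ v ∈ D, G.degree v = 3)
    (hodd : Odd D.card) (hV : ∃ v, v ∉ D) : 3 ≤ (leaving G D).card := by
  have h1 := card_leaving_even D hD
  obtain ⟨u, hu⟩ : D.Nonempty := by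
    rw [← Finset.card_pos]
    exact hodd.pos
  obtain ⟨v, hv⟩ := hV
  obtain ⟨x, y, hxy, hx, hy, -⟩ := hG.cut (D : Set V) u v (by simpa) (by simpa)
  obtain ⟨x', y', hxy', hx', hy', hne⟩ := hG.cut (D : Set V) x y hx hy
  have h2 : 1 < (leaving G D).card := by
    rw [Finset.one_lt_card]
    refine ⟨(x, y), ?_, (x', y'), ?_, fun h => ?_⟩
    · simpa [leaving] using ⟨hx, hy, hxy⟩
    · simpa [leaving] using ⟨hx', hy', hxy'⟩
    · simp only [Prod.mk.injEq] at h
      exact hne ⟨h.1.symm, h.2.symm⟩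
  grind

/-- The graph `G` without the edges in `F`, together with a clique on the vertices of degree two
and new vertices indexed by `ι`. -/
def augment (G : SimpleGraph V) (F : Finset (Sym2 V)) (ι : Type) : SimpleGraph (V ⊕ ι) where
  Adj
    | Sum.inl x, Sum.inl y => (G.Adj x y ∧ s(x, y) ∉ F) ∨
        (x ≠ y ∧ G.degree x ≠ 3 ∧ G.degree y ≠ 3)
    | Sum.inl x, Sum.inr _ => G.degree x ≠ 3
    | Sum.inr _, Sum.inl y => G.degree y ≠ 3
    | Sum.inr i, Sum.inr j => i ≠ j
  symm := ⟨by
    rintro (x | i) (y | j) h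
    · exact h.imp (fun h => ⟨h.1.symm, by rw [Sym2.eq_swap]; exact h.2⟩)
        (fun h => ⟨h.1.symm, h.2.2, h.2.1⟩)
    · exact h
    · exact h
    · exact h.symm⟩
  loopless := ⟨by
    rintro (x | i) h
    · exact h.elim (fun h => h.1.ne rfl) (fun h => h.1 rfl)
    · exact h rfl⟩

lemma Reduced.exists_perfectMatching_augment (hG : Reduced G) (F : Finset (Sym2 V)) (ι : Type)
    [Fintype ι] (heven : Even (Fintype.card V + Fintype.card ι)) (hF : F.card ≤ 2)
    (h : F = ∅ ∨ IsEmpty ι ∧ ∀ v, G.degree v = 3) :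
    ∃ M : (augment G F ι).Subgraph, M.IsPerfectMatching := by
  by_contra hM
  obtain ⟨S, 𝒞, hcard, hodd, hS, hdisj, hadj⟩ := exists_odd_parts _ (by simpa using heven) hM
  let special : V ⊕ ι → Prop := Sum.elim (fun x => G.degree x ≠ 3) fun _ => True
  have hspec : ∀ a b, special a → special b → a ≠ b → (augment G F ι).Adj a b := by
    rintro (x | i) (y | j) h1 h2 h
    · exact Or.inr ⟨by simpa using h, h1, h2⟩
    · exact h1
    · exact h2
    · exact fun hij => h (by rw [hij])
  set 𝒟 := 𝒞.filter fun C => ∀ a ∈ C, ¬ special a with h𝒟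
  have hfew : (𝒞.filter fun C => ¬ ∀ a ∈ C, ¬ special a).card ≤ 1 := by
    rw [Finset.card_le_one]
    intro C hC D hD
    simp only [Finset.mem_filter, not_forall, not_not] at hC hD
    obtain ⟨hC, a, ha, ha'⟩ := hC
    obtain ⟨hD, b, hb, hb'⟩ := hD
    by_contra hne
    have hab : a ≠ b := by
      rintro rfl
      exact Finset.disjoint_left.1 (hdisj C hC D hD hne) ha hb
    rcases hadj C hC a ha b (hspec a b ha' hb' hab) with h | h
    · exact Finset.disjoint_left.1 (hdisj C hC D hD hne) h hb
    · exact Finset.disjoint_left.1 (hS D hD) hb h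
  have hsum : 𝒟.card + (𝒞.filter fun C => ¬ ∀ a ∈ C, ¬ special a).card = 𝒞.card := by
    rw [h𝒟]
    convert Finset.card_filter_add_card_filter_not (s := 𝒞) fun C => ∀ a ∈ C, ¬ special a
  have hlarge : S.card + 1 ≤ 𝒟.card ∧ (S.card + 2 ≤ 𝒟.card ∨ F = ∅) := by
    refine ⟨by omega, ?_⟩
    rcases h with h | ⟨h1, h2⟩
    · exact Or.inr h
    · left
      have : ∀ a, ¬ special a := by
        rintro (x | i)
        · simpa [special] using h2 x
        · exact h1.elim i
      have h3 : (𝒞.filter fun C => ¬ ∀ a ∈ C, ¬ special a) = ∅ := by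
        rw [Finset.filter_eq_empty_iff]
        intro C _ h
        exact h fun a _ => this a
      rw [h3] at hsum
      simp only [Finset.card_empty] at hsum
      omega
  let part : Finset (V ⊕ ι) → Finset V := fun C => Finset.univ.filter fun x => Sum.inl x ∈ C
  have hpart : ∀ C x, x ∈ part C ↔ Sum.inl x ∈ C := by simp [part]
  have hpartcard : ∀ C ∈ 𝒟, (part C).card = C.card := by
    intro C hC
    refine Finset.card_bij (fun x _ => Sum.inl x) (fun x hx => (hpart C x).1 hx) (by simp) ?_
    rintro (x | i) hx
    · exact ⟨x, (hpart C x).2 hx, rfl⟩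
    · exact absurd trivial ((Finset.mem_filter.1 hC).2 _ hx)
  set P : Finset (V × V) := (Finset.univ.filter fun p : V × V => Sum.inl p.2 ∈ S ∧ G.Adj p.1 p.2) ∪
    Finset.univ.filter fun p : V × V => s(p.1, p.2) ∈ F with hP
  have hPcard : P.card ≤ 3 * S.card + 2 * F.card := by
    refine (Finset.card_union_le _ _).trans (add_le_add ?_ ?_)
    · refine (Finset.card_le_mul_card_image_of_maps_to (f := fun p : V × V => (Sum.inl p.2 : V ⊕ ι))
        (t := S) (fun p hp => by simp at hp; exact hp.1) 3 ?_)
      intro a _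
      rcases a with x | i
      · refine le_trans ?_ (show G.degree x ≤ 3 by have := hG.degree x; omega)
        rw [← G.card_neighborFinset_eq_degree]
        refine Finset.card_le_card_of_injOn (fun p => p.1) ?_ ?_
        · rintro ⟨p, q⟩ hp
          simp at hp ⊢
          exact hp.2 ▸ hp.1.2.symm
        · rintro ⟨p, q⟩ hp ⟨p', q'⟩ hp' h
          simp at hp hp' h ⊢
          exact ⟨h, hp.2.trans hp'.2.symm⟩
      · simp
    · refine (Finset.card_le_mul_card_image_of_maps_to (f := fun p : V × V => s(p.1, p.2))
        (t := F) (fun p hp => by simpa using hp) 2 ?_)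
      intro e _
      induction e with | h x y =>
      refine (Finset.card_le_card (t := {(x, y), (y, x)}) ?_).trans Finset.card_le_two
      rintro ⟨p, q⟩ hp
      simp at hp ⊢
      exact hp.2
  have hbound : 𝒟.card * 3 ≤ P.card := by
    have h1 : ∀ C ∈ 𝒟, 3 ≤ (leaving G (part C)).card := by
      intro C hC
      have hC' := (Finset.mem_filter.1 hC).1
      refine hG.three_le_card_leaving _ (fun x hx => ?_) ?_ ?_
      · by_contra h
        exact (Finset.mem_filter.1 hC).2 _ ((hpart C x).1 hx) h
      · rw [hpartcard C hC]
        exact hodd C hC'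
      · have h2 : 1 < 𝒞.card := by omega
        obtain ⟨D, hD, hDC⟩ := Finset.exists_mem_ne h2 C
        obtain ⟨a, ha⟩ : D.Nonempty := by
          rw [← Finset.card_pos]
          exact (hodd D hD).pos
        by_contra hall
        push Not at hall
        rcases a with x | i
        · exact Finset.disjoint_left.1 (hdisj D hD C hC' hDC) ha ((hpart C x).1 (hall x))
        · rcases h with hF0 | ⟨he, -⟩
          · obtain ⟨x, hx⟩ : (part C).Nonempty := by
              rw [← Finset.card_pos, hpartcard C hC]
              exact (hodd C hC').pos
            have h3 : ∀ v, G.degree v = 3 := fun v => by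
              by_contra h
              exact (Finset.mem_filter.1 hC).2 _ ((hpart C v).1 (hall v)) h
            have h4 := card_leaving_even (G := G) (part C) fun v _ => h3 v
            have h5 : leaving G (part C) = ∅ := by
              rw [leaving, Finset.filter_eq_empty_iff]
              rintro p - ⟨-, hp, -⟩
              exact hp (hall _)
            rw [h5, hpartcard C hC] at h4
            have := hodd C hC'
            grind
          · exact he.elim i
    have h2 : ∀ C ∈ 𝒟, ∀ D ∈ 𝒟, C ≠ D →
        Disjoint (leaving G (part C)) (leaving G (part D)) := by
      intro C hC D hD hne
      rw [Finset.disjoint_left]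
      intro p hp hp'
      simp only [leaving, Finset.mem_filter, hpart] at hp hp'
      exact Finset.disjoint_left.1 (hdisj C (Finset.mem_filter.1 hC).1 D
        (Finset.mem_filter.1 hD).1 hne) hp.2.1 hp'.2.1
    rw [← smul_eq_mul]
    refine (Finset.card_nsmul_le_sum _ _ _ h1).trans ?_
    rw [← Finset.card_biUnion h2]
    refine Finset.card_le_card fun p hp => ?_
    obtain ⟨C, hC, hp⟩ := Finset.mem_biUnion.1 hp
    simp only [leaving, Finset.mem_filter, hpart, Finset.mem_univ, true_and] at hp
    simp only [hP, Finset.mem_union, Finset.mem_filter, Finset.mem_univ, true_and]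
    by_cases hpF : s(p.1, p.2) ∈ F
    · exact Or.inr hpF
    · exact Or.inl ⟨(hadj C (Finset.mem_filter.1 hC).1 _ hp.1 (Sum.inl p.2)
        (Or.inl ⟨hp.2.2, hpF⟩)).resolve_left hp.2.1, hp.2.2⟩
  rcases hlarge with ⟨h1, h2 | rfl⟩
  · omega
  · simp only [Finset.card_empty] at hPcard
    omega

/-- A matching covering all vertices of degree three and avoiding the edges in `F`. -/
lemma Reduced.exists_matching (hG : Reduced G) (F : Finset (Sym2 V)) (hF : F.card ≤ 2)
    (h : F = ∅ ∨ ∀ v, G.degree v = 3) :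
    ∃ M ≤ G, (∀ x y z, M.Adj x y → M.Adj x z → y = z) ∧
      (∀ x, G.degree x = 3 → ∃ y, M.Adj x y) ∧ ∀ x y, M.Adj x y → s(x, y) ∉ F := by
  obtain ⟨k, hk, hk'⟩ : ∃ k, Even (Fintype.card V + k) ∧
      (F = ∅ ∨ IsEmpty (Fin k) ∧ ∀ v, G.degree v = 3) := by
    rcases h with h | h
    · exact ⟨Fintype.card V, by simp, Or.inl h⟩
    · refine ⟨0, ?_, Or.inr ⟨inferInstance, h⟩⟩
      have h1 := G.sum_degrees_eq_twice_card_edges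
      rw [Finset.sum_congr rfl fun v _ => h v, Finset.sum_const, Finset.card_univ,
        smul_eq_mul] at h1
      grind
  obtain ⟨M, hM⟩ := hG.exists_perfectMatching_augment F (Fin k) (by simpa using hk) hF hk'
  rw [SimpleGraph.Subgraph.isPerfectMatching_iff] at hM
  refine ⟨⟨fun x y => M.Adj (Sum.inl x) (Sum.inl y) ∧ G.Adj x y ∧ s(x, y) ∉ F, ⟨?_⟩, ⟨?_⟩⟩,
    ?_, ?_, ?_, ?_⟩
  · rintro x y ⟨h1, h2, h3⟩
    exact ⟨h1.symm, h2.symm, by rwa [Sym2.eq_swap]⟩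
  · rintro x ⟨-, h2, -⟩
    exact h2.ne rfl
  · exact fun x y h => h.2.1
  · intro x y z h1 h2
    exact Sum.inl_injective ((hM (Sum.inl x)).unique h1.1 h2.1)
  · intro x hx
    obtain ⟨a, ha, -⟩ := hM (Sum.inl x)
    have h1 := M.adj_sub ha
    rcases a with y | i
    · rcases h1 with h1 | h1
      · exact ⟨y, ha, h1⟩
      · exact absurd hx h1.2.1
    · exact absurd hx h1
  · exact fun x y h => h.2.2

end Tutte

section Induction

open Classical

lemma GoodColoring.of_induce {V : Type} {G : SimpleGraph V} {s : Set V}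
    (hs : ∀ x y, G.Adj x y → x ∈ s) {c : Sym2 s → Fin 8} (hc : GoodColoring (G.induce s) c) :
    ∃ c, GoodColoring G c := by
  have hinj : Function.Injective (Sym2.map (Subtype.val : s → V)) :=
    Sym2.map.injective Subtype.val_injective
  set d : Sym2 V → Fin 8 := Function.extend (Sym2.map (Subtype.val : s → V)) c 0 with hd
  have hdc : ∀ x y : s, d s(x.1, y.1) = c s(x, y) := fun x y =>
    hinj.extend_apply c 0 s(x, y)
  refine ⟨d, ⟨?_, ?_⟩, ?_⟩
  · intro a b x y hab hxy hne h1 h2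
    lift a to s using hs a b hab
    lift b to s using hs b a hab.symm
    lift x to s using hs x y hxy
    lift y to s using hs y x hxy.symm
    rw [hdc] at h1 h2
    have := hc.1.1 a b x y hab hxy (fun h => hne (by simpa using congrArg (Sym2.map Subtype.val) h))
      h1 h2
    simpa only [Ne, Subtype.ext_iff] using this
  · intro a b x y hab hxy hne h1 h2
    lift a to s using hs a b hab
    lift b to s using hs b a hab.symm
    lift x to s using hs x y hxy
    lift y to s using hs y x hxy.symm
    rw [hdc] at h1 h2
    rw [hdc] at h1
    have := hc.1.2 a b x y hab hxy (fun h => hne (by simpa using congrArg (Sym2.map Subtype.val) h))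
      h1 h2
    simpa only [Ne, Subtype.ext_iff, SimpleGraph.comap_adj, Function.Embedding.subtype_apply]
      using this
  · have hn : ∀ x : s, Subtype.val '' (G.induce s).neighborSet x = G.neighborSet x := by
      intro x
      ext y
      constructor
      · rintro ⟨z, hz, rfl⟩
        exact hz
      · intro h
        exact ⟨⟨y, hs y x (G.adj_symm h)⟩, h, rfl⟩
    intro a b hab h
    lift a to s using hs a b hab
    lift b to s using hs b a hab.symm
    rw [hdc] at h
    rw [← hn, ← hn, Set.ncard_image_of_injective _ Subtype.val_injective,
      Set.ncard_image_of_injective _ Subtype.val_injective]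
    exact hc.2 a b hab h

lemma Subcubic.induce {V : Type} [Fintype V] {G : SimpleGraph V} (hG : Subcubic G) (s : Set V) :
    Subcubic (G.induce s) := by
  intro x
  refine le_trans ?_ (hG x)
  rw [← Set.ncard_image_of_injective _ Subtype.val_injective]
  refine Set.ncard_le_ncard ?_ (Set.toFinite _)
  rintro _ ⟨y, hy, rfl⟩
  exact hy

lemma Subcubic.mono {V : Type} [Fintype V] {G H : SimpleGraph V} (hG : Subcubic G) (h : H ≤ G) :
    Subcubic H := fun x =>
  (Set.ncard_le_ncard (fun _ hy => h hy) (Set.toFinite _)).trans (hG x)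

lemma exists_goodColoring_of_reduced
    (key : ∀ (V : Type) [Fintype V] (G : SimpleGraph V), Nonempty V → Reduced G →
      (∀ H < G, ∃ c, GoodColoring H c) → ∃ c, GoodColoring G c) (n : ℕ) :
    ∀ (V : Type) [Fintype V] (G : SimpleGraph V), Subcubic G → G.edgeSet.ncard = n →
      ∃ c, GoodColoring G c := by
  induction n using Nat.strong_induction_on with
  | _ n ih =>
    intro V _ G hG hn
    set s : Set V := {x | ∃ y, G.Adj x y} with hs
    suffices h : ∃ c, GoodColoring (G.induce s) c by
      obtain ⟨c, hc⟩ := h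
      exact GoodColoring.of_induce (s := s) (fun x y hxy => ⟨y, hxy⟩) hc
    have hG' := hG.induce s
    have hpos : ∀ v, 0 < (G.induce s).degree v := by
      rintro ⟨v, w, hvw⟩
      rw [SimpleGraph.degree_pos_iff_exists_adj]
      exact ⟨(⟨w, v, hvw.symm⟩ : s), hvw⟩
    have ih' : ∀ H < G.induce s, ∃ c, GoodColoring H c := by
      intro H hH
      refine ih _ ?_ s H (hG'.mono hH.le) rfl
      have h1 : H.edgeSet.ncard < (G.induce s).edgeSet.ncard :=
        Set.ncard_lt_ncard (SimpleGraph.edgeSet_ssubset_edgeSet.2 hH) (Set.toFinite _)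
      refine h1.trans_le ?_
      rw [← hn, ← Set.ncard_image_of_injective _ (Sym2.map.injective Subtype.val_injective)]
      refine Set.ncard_le_ncard ?_ (Set.toFinite _)
      rintro _ ⟨e, he, rfl⟩
      induction e with | h x y => exact he
    by_cases hleaf : ∃ u, (G.induce s).degree u = 1
    · obtain ⟨u, hu⟩ := hleaf
      exact exists_goodColoring_of_leaf hG' ih' hu
    push Not at hleaf
    have hmin : ∀ v, 2 ≤ (G.induce s).degree v := fun v => by
      have := hpos v
      have := hleaf v
      omega
    rcases isEmpty_or_nonempty s with he | hne
    · refine ⟨fun _ => 0, ⟨fun a => he.elim a, fun a => he.elim a⟩, fun a => he.elim a⟩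
    by_contra hno
    refine hno (key s _ hne ⟨fun v => ?_, fun A u v hu hv => ?_⟩ ih')
    · have h1 := hmin v
      have h2 := hG'.degree_le v
      rw [Nat.le_succ_iff] at h2
      exact h2.imp (fun h => le_antisymm h h1) id
    · by_contra hcon
      push Not at hcon
      exact hno (exists_goodColoring_of_cut hG' hmin ih' hu hv fun x y h hx hy => hcon x y h hx hy)

end Induction

section Greedy

open Classical

variable {V : Type} [Fintype V] {G : SimpleGraph V}

lemma exists_neighbours_of_degree_two {t x : V} (ht : G.degree t = 2) (h : G.Adj t x) :
    ∃ w, w ≠ x ∧ ∀ z, G.Adj t z ↔ z = x ∨ z = w := by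
  have h1 : ((G.neighborFinset t).erase x).card = 1 := by
    rw [Finset.card_erase_of_mem (by simpa using h), G.card_neighborFinset_eq_degree, ht]
  obtain ⟨w, hw⟩ := Finset.card_eq_one.1 h1
  have h2 : ∀ z, z ∈ (G.neighborFinset t).erase x ↔ z = w := by simp [hw]
  simp only [Finset.mem_erase, SimpleGraph.mem_neighborFinset] at h2
  refine ⟨w, ((h2 w).2 rfl).1, fun z => ?_⟩
  by_cases hz : z = x
  · simp [hz, h]
  · rw [← h2 z]
    tauto

lemma exists_neighbours_of_degree_three {t x : V} (ht : G.degree t = 3) (h : G.Adj t x) :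
    ∃ a b, a ≠ x ∧ b ≠ x ∧ a ≠ b ∧ ∀ z, G.Adj t z ↔ z = x ∨ z = a ∨ z = b := by
  have h1 : ((G.neighborFinset t).erase x).card = 2 := by
    rw [Finset.card_erase_of_mem (by simpa using h), G.card_neighborFinset_eq_degree, ht]
  obtain ⟨a, b, hab, hw⟩ := Finset.card_eq_two.1 h1
  have h2 : ∀ z, z ∈ (G.neighborFinset t).erase x ↔ z = a ∨ z = b := by simp [hw]
  simp only [Finset.mem_erase, SimpleGraph.mem_neighborFinset] at h2
  refine ⟨a, b, ((h2 a).2 (Or.inl rfl)).1, ((h2 b).2 (Or.inr rfl)).1, hab, fun z => ?_⟩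
  by_cases hz : z = x
  · simp [hz, h]
  · rw [← h2 z]
    tauto

lemma exists_third_neighbour {x p q : V} (hx : G.degree x = 3) (hp : G.Adj x p) (hq : G.Adj x q)
    (hpq : p ≠ q) : ∃ r, r ≠ p ∧ r ≠ q ∧ ∀ z, G.Adj x z ↔ z = p ∨ z = q ∨ z = r := by
  obtain ⟨a, b, ha, hb, hab, h⟩ := exists_neighbours_of_degree_three hx hp
  rcases ((h q).1 hq).resolve_left hpq.symm with rfl | rfl
  · exact ⟨b, hb, hab.symm, h⟩
  · exact ⟨a, ha, hab, fun z => by rw [h z]; tauto⟩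

lemma card_inc_add_le {A : Finset (Sym2 V)} (hA : ∀ e ∈ A, e ∈ G.edgeSet) {t : V} (D : Finset V)
    (hD : ∀ y ∈ D, G.Adj t y ∧ s(t, y) ∉ A) : (inc A t).card + D.card ≤ G.degree t := by
  have h1 : inc A t ⊆ (G.neighborFinset t \ D).image fun z => s(t, z) := by
    intro e he
    obtain ⟨heA, hte⟩ := mem_inc.1 he
    obtain ⟨z, rfl⟩ := Sym2.mem_iff_exists.1 hte
    refine Finset.mem_image.2 ⟨z, Finset.mem_sdiff.2 ⟨by simpa using hA _ heA, fun hz => ?_⟩, rfl⟩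
    exact (hD z hz).2 heA
  have h2 : D ⊆ G.neighborFinset t := fun y hy => by simpa using (hD y hy).1
  have h3 := (Finset.card_le_card h1).trans Finset.card_image_le
  rw [Finset.card_sdiff_of_subset h2, G.card_neighborFinset_eq_degree] at h3
  have h4 := Finset.card_le_card h2
  rw [G.card_neighborFinset_eq_degree] at h4
  omega

lemma card_conf_le_sum {A : Finset (Sym2 V)} (hA : ∀ e ∈ A, e ∈ G.edgeSet) {x y : V} (l : List V)
    (hl : ∀ t ∈ nbrs G x y, t ∈ l) :
    (conf G A s(x, y)).card ≤ (l.map fun t => (inc A t).card).sum := by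
  refine (Finset.card_le_card (t := l.toFinset.biUnion (inc A)) ((conf_subset hA).trans ?_)).trans ?_
  · exact Finset.biUnion_subset_biUnion_of_subset_left _ fun t ht => by simpa using hl t ht
  · clear hl
    induction l with
    | nil => simp
    | cons a l ih =>
      rw [List.toFinset_cons, Finset.biUnion_insert, List.map_cons, List.sum_cons]
      exact (Finset.card_union_le _ _).trans (by omega)

omit [Fintype V] in
/-- Extend a colouring to a family of edges by the Combinatorial Nullstellensatz. -/
lemma ProperOn.extend {B : Finset (Sym2 V)} {c : Sym2 V → Fin 8} (hc : ProperOn G B c) {α : Type}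
    [Fintype α] [DecidableEq α] {e : α → Sym2 V} (he : Function.Injective e) (es : List (α × α))
    (d : α → ℕ) (hd : edgeCoeff es d ≠ 0)
    (hnear : ∀ a b, a ≠ b → Near G (e a) (e b) → (a, b) ∈ es ∨ (b, a) ∈ es)
    (hlist : ∀ a, (conf G B (e a)).card + d a ≤ 6) :
    ∃ c, ProperOn G (B ∪ Finset.univ.image e) c := by
  obtain ⟨c', h1, h2⟩ := exists_choice_of_edgeCoeff es d hd (fun a => avail G B c (e a)) fun a => by
    have := card_avail (G := G) B c (e a)
    have := hlist a
    omega
  have hext : ∀ a, Function.extend e c' 0 (e a) = c' a := fun a => he.extend_apply _ _ _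
  refine ⟨_, hc.union (c' := Function.extend e c' 0) ?_ ?_⟩
  · intro f hf
    obtain ⟨a, -, rfl⟩ := Finset.mem_image.1 hf
    rw [hext]
    exact h1 a
  · intro f hf g hg hne hn
    obtain ⟨a, -, rfl⟩ := Finset.mem_image.1 hf
    obtain ⟨b, -, rfl⟩ := Finset.mem_image.1 hg
    rw [hext, hext]
    rcases hnear a b (fun h => hne (h ▸ rfl)) hn with h | h
    · exact h2 _ h
    · exact (h2 _ h).symm

omit [Fintype V] in
lemma ProperOn.insert_of_card_le {B : Finset (Sym2 V)} {c : Sym2 V → Fin 8} (hc : ProperOn G B c)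
    {e : Sym2 V} (he : (conf G B e).card ≤ 6) : ∃ c, ProperOn G (insert e B) c := by
  obtain ⟨c', hc'⟩ := hc.extend (α := Unit) (e := fun _ => e) (fun _ _ _ => rfl) [] (fun _ => 0)
    (by decide) (fun a b h => absurd rfl h) (fun _ => he)
  exact ⟨c', hc'.mono (by intro f; simp)⟩

lemma Reduced.degree_le (hG : Reduced G) (v : V) : G.degree v ≤ 3 := by
  have := hG.degree v
  omega

/-- A function decreasing towards a target set, where it vanishes. -/
lemma Reduced.exists_descent (hG : Reduced G) {Z : Set V} (hZ : Z.Nonempty) :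
    ∃ f : V → ℕ, (∀ v, f v = 0 ↔ v ∈ Z) ∧ ∀ v, f v ≠ 0 → ∃ w, G.Adj v w ∧ f w < f v := by
  obtain ⟨z, hz⟩ := hZ
  have hreach : ∀ v, ∃ n, ∃ z ∈ Z, ∃ p : G.Walk v z, p.length = n := by
    intro v
    have : G.Reachable v z := by
      by_contra h
      obtain ⟨x, y, hxy, hx, hy, -⟩ := hG.cut {w | G.Reachable v w} v z (SimpleGraph.Reachable.refl _) h
      exact hy (SimpleGraph.Reachable.trans hx hxy.reachable)
    exact ⟨_, z, hz, this.some, rfl⟩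
  refine ⟨fun v => Nat.find (hreach v), fun v => ?_, fun v hv => ?_⟩
  · rw [Nat.find_eq_zero]
    constructor
    · rintro ⟨z, hz, p, hp⟩
      rwa [SimpleGraph.Walk.eq_of_length_eq_zero hp]
    · intro h
      exact ⟨v, h, SimpleGraph.Walk.nil, rfl⟩
  · obtain ⟨z, hz, p, hp⟩ := Nat.find_spec (hreach v)
    cases p with
    | nil => exact absurd hp.symm hv
    | cons h p =>
      refine ⟨_, h, ?_⟩
      have := Nat.find_min' (hreach _) ⟨z, hz, p, rfl⟩
      rw [SimpleGraph.Walk.length_cons] at hp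
      dsimp only
      omega

/-- The least value of a function on the endpoints of an edge. -/
def low (f : V → ℕ) : Sym2 V → ℕ := Sym2.lift ⟨fun x y => min (f x) (f y), fun _ _ => min_comm _ _⟩

omit [Fintype V] in
lemma low_mk (f : V → ℕ) (x y : V) : low f s(x, y) = min (f x) (f y) := rfl

/-- Colour greedily towards the zeros of a descent function. -/
lemma exists_properOn_of_descent (hG : Reduced G) {A : Finset (Sym2 V)}
    (hA : ∀ e ∈ A, e ∈ G.edgeSet) (h2 : ∀ t, (inc A t).card ≤ 2) {f : V → ℕ}
    (hf : ∀ v, f v ≠ 0 → ∃ w, G.Adj v w ∧ f w < f v)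
    (hbase : ∀ x y, s(x, y) ∈ A → f x = 0 → (nbrs G x y).card ≤ 3) :
    ∃ c, ProperOn G A c := by
  obtain ⟨K, hK⟩ : ∃ K, ∀ v, f v ≤ K := ⟨Finset.univ.sup f, fun v => Finset.le_sup (by simp)⟩
  refine exists_properOn_of_rank A (fun e => K - low f e) fun e he => ?_
  have key : ∀ x y, s(x, y) ∈ A → f x ≤ f y →
      (conf G (A.filter fun g => K - low f g ≤ K - low f s(x, y)) s(x, y)).card ≤ 6 := by
    intro x y hxy hle
    refine card_conf_le_six (fun e he => hA e (Finset.mem_filter.1 he).1) (fun t => ?_) ?_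
    · exact (Finset.card_le_card fun e he => by
        simp only [mem_inc, Finset.mem_filter] at he ⊢
        exact ⟨he.1.1, he.2⟩).trans (h2 t)
    by_cases h0 : f x = 0
    · exact Or.inl (hbase x y hxy h0)
    obtain ⟨w, hxw, hw⟩ := hf x h0
    refine Or.inr ⟨?_, w, mem_nbrs.2 (Or.inl ⟨?_, hxw⟩), ?_⟩
    · have h3 := card_nbrs_le (show G.Adj x y from hA _ hxy)
      have h4 := hG.degree_le x
      have h5 := hG.degree_le y
      omega
    · rintro rfl
      omega
    · rw [Finset.eq_empty_iff_forall_notMem]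
      intro g hg
      simp only [mem_inc, Finset.mem_filter] at hg
      obtain ⟨z, rfl⟩ := Sym2.mem_iff_exists.1 hg.2
      have h6 := hg.1.2
      rw [low_mk, low_mk] at h6
      have := hK x
      have := hK w
      omega
  induction e with | h x y =>
  rcases le_total (f x) (f y) with h | h
  · exact key x y he h
  · rw [Sym2.eq_swap] at he ⊢
    exact key y x he h

end Greedy

section DegreeTwo

open Classical

variable {V : Type} [Fintype V] {G : SimpleGraph V}

lemma mem_of_mem_nbrs {x y : V} {l : List V} (hx : ∀ z, G.Adj x z → z = y ∨ z ∈ l)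
    (hy : ∀ z, G.Adj y z → z = x ∨ z ∈ l) : ∀ t ∈ nbrs G x y, t ∈ l := by
  intro t ht
  rcases mem_nbrs.1 ht with ⟨h, h'⟩ | ⟨h, h'⟩
  · exact (hx t h').resolve_left h
  · exact (hy t h').resolve_left h

/-- The vertices of degree three matched to a vertex of degree two. -/
noncomputable def matchedDown (G M : SimpleGraph V) : Finset V :=
  Finset.univ.filter fun x => G.degree x = 3 ∧ ∃ y, M.Adj x y ∧ G.degree y = 2

lemma Reduced.exists_matching_independent (hG : Reduced G) :
    ∃ M ≤ G, (∀ x y z, M.Adj x y → M.Adj x z → y = z) ∧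
      (∀ x, G.degree x = 3 → ∃ y, M.Adj x y) ∧
      ∀ x ∈ matchedDown G M, ∀ y ∈ matchedDown G M, ¬ G.Adj x y := by
  let P : SimpleGraph V → Prop := fun M => M ≤ G ∧ (∀ x y z, M.Adj x y → M.Adj x z → y = z) ∧
      (∀ x, G.degree x = 3 → ∃ y, M.Adj x y)
  obtain ⟨M, hMP, hmin⟩ : ∃ M, P M ∧ ∀ M', P M' → (matchedDown G M).card ≤ (matchedDown G M').card := by
    obtain ⟨M, h1, h2, h3, -⟩ := hG.exists_matching ∅ (by simp) (Or.inl rfl)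
    obtain ⟨M, hM, h⟩ := Set.exists_min_image {M | P M} (fun M => (matchedDown G M).card)
      (Set.toFinite _) ⟨M, h1, h2, h3⟩
    exact ⟨M, hM, h⟩
  obtain ⟨h1, h2, h3⟩ := hMP
  refine ⟨M, h1, h2, h3, fun x hx y hy hxy => ?_⟩
  simp only [matchedDown, Finset.mem_filter, Finset.mem_univ, true_and] at hx hy
  obtain ⟨hx, t, hxt, ht⟩ := hx
  obtain ⟨hy, t', hyt, ht'⟩ := hy
  have hxt' : x ≠ t' := by rintro rfl; omega
  have hyt' : y ≠ t := by rintro rfl; omega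
  let M' : SimpleGraph V :=
    { Adj := fun a b => (a = x ∧ b = y) ∨ (a = y ∧ b = x) ∨
        (M.Adj a b ∧ a ≠ x ∧ a ≠ y ∧ b ≠ x ∧ b ≠ y)
      symm := ⟨by
        rintro a b (h | h | h)
        · exact Or.inr (Or.inl ⟨h.2, h.1⟩)
        · exact Or.inl ⟨h.2, h.1⟩
        · exact Or.inr (Or.inr ⟨h.1.symm, h.2.2.2.1, h.2.2.2.2, h.2.1, h.2.2.1⟩)⟩
      loopless := ⟨by
        rintro a (h | h | h)
        · exact hxy.ne (h.1.symm.trans h.2)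
        · exact hxy.ne (h.2.symm.trans h.1)
        · exact h.1.ne rfl⟩ }
  have hM' : P M' := by
    refine ⟨?_, ?_, ?_⟩
    · rintro a b (⟨rfl, rfl⟩ | ⟨rfl, rfl⟩ | h)
      · exact hxy
      · exact hxy.symm
      · exact h1 h.1
    · rintro a b c (⟨rfl, rfl⟩ | ⟨rfl, rfl⟩ | h) (⟨h4, rfl⟩ | ⟨h4, rfl⟩ | h')
      · rfl
      · exact absurd h4 hxy.ne
      · exact absurd rfl h'.2.1
      · exact absurd h4.symm hxy.ne
      · rfl
      · exact absurd rfl h'.2.2.1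
      · exact absurd h4 h.2.1
      · exact absurd h4 h.2.2.1
      · exact h2 _ _ _ h.1 h'.1
    · intro a ha
      by_cases hax : a = x
      · exact ⟨y, Or.inl ⟨hax, rfl⟩⟩
      by_cases hay : a = y
      · exact ⟨x, Or.inr (Or.inl ⟨hay, rfl⟩)⟩
      obtain ⟨b, hb⟩ := h3 a ha
      refine ⟨b, Or.inr (Or.inr ⟨hb, hax, hay, ?_, ?_⟩)⟩
      · rintro rfl
        have := h2 _ _ _ hb.symm hxt
        subst this
        omega
      · rintro rfl
        have := h2 _ _ _ hb.symm hyt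
        subst this
        omega
  refine absurd (hmin M' hM') (not_le.2 (Finset.card_lt_card ?_))
  rw [Finset.ssubset_iff_of_subset]
  · refine ⟨x, by simpa [matchedDown] using ⟨hx, t, hxt, ht⟩, ?_⟩
    simp only [matchedDown, Finset.mem_filter, Finset.mem_univ, true_and]
    rintro ⟨-, b, hb | hb | hb, h⟩
    · rw [hb.2] at h; omega
    · rw [hb.2] at h; omega
    · exact hb.2.1 rfl
  · intro a ha
    simp only [matchedDown, Finset.mem_filter, Finset.mem_univ, true_and] at ha ⊢
    obtain ⟨ha, b, hb | hb | hb, h⟩ := ha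
    · rw [hb.2] at h; omega
    · rw [hb.2] at h; omega
    · exact ⟨ha, b, hb.1, h⟩

set_option maxHeartbeats 1600000 in
/-- A reduced graph with a vertex of degree two has a good colouring. -/
lemma Reduced.exists_goodColoring_of_degree_two (hG : Reduced G) (hT : ∃ v, G.degree v = 2) :
    ∃ c, GoodColoring G c := by
  obtain ⟨M, hMG, hM, hcov, hind⟩ := hG.exists_matching_independent
  set U := matchedDown G M with hU
  obtain ⟨φ, hφ⟩ : ∃ φ : V → V, ∀ x ∈ U, M.Adj x (φ x) ∧ G.degree (φ x) = 2 := by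
    have : ∀ x, ∃ y, x ∈ U → M.Adj x y ∧ G.degree y = 2 := by
      intro x
      by_cases hx : x ∈ U
      · obtain ⟨-, -, y, hy⟩ := Finset.mem_filter.1 hx
        exact ⟨y, fun _ => hy⟩
      · exact ⟨x, fun h => absurd h hx⟩
    choose φ hφ using this
    exact ⟨φ, hφ⟩
  have hU3 : ∀ x ∈ U, G.degree x = 3 := fun x hx => (Finset.mem_filter.1 hx).2.1
  have hUiff : ∀ x y, M.Adj x y → G.degree x = 3 → G.degree y = 2 → x ∈ U := fun x y h h1 h2 => by
    simpa [hU, matchedDown] using ⟨h1, y, h, h2⟩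
  have hφinj : ∀ x ∈ U, ∀ y ∈ U, φ x = φ y → x = y := fun x hx y hy h =>
    hM (φ x) x y (hφ x hx).1.symm (h ▸ (hφ y hy).1.symm)
  set m : V → Sym2 V := fun x => s(x, φ x) with hm
  set A₀ : Finset (Sym2 V) := G.edgeFinset.filter
    fun e => ∀ x y, e = s(x, y) → M.Adj x y → G.degree x = 2 with hA₀
  have hmemA₀ : ∀ x y, s(x, y) ∈ A₀ ↔ G.Adj x y ∧ (M.Adj x y → G.degree x = 2 ∧ G.degree y = 2) := by
    intro x y
    simp only [hA₀, Finset.mem_filter, SimpleGraph.mem_edgeFinset, SimpleGraph.mem_edgeSet]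
    refine and_congr_right fun _ => ⟨fun h hxy => ⟨h x y rfl hxy, h y x Sym2.eq_swap hxy.symm⟩, ?_⟩
    intro h a b hab hM'
    rcases Sym2.eq_iff.1 hab with ⟨rfl, rfl⟩ | ⟨rfl, rfl⟩
    · exact (h hM').1
    · exact (h hM'.symm).2
  have hE : ∀ U' ⊆ U, ∀ e ∈ A₀ ∪ U'.image m, e ∈ G.edgeSet := by
    intro U' hU' e he
    rcases Finset.mem_union.1 he with he | he
    · simpa using (Finset.mem_filter.1 he).1
    · obtain ⟨x, hx, rfl⟩ := Finset.mem_image.1 he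
      exact hMG (hφ x (hU' hx)).1
  have hmem : ∀ U' ⊆ U, ∀ x y, M.Adj x y → G.degree x = 3 → x ∉ U' → s(x, y) ∉ A₀ ∪ U'.image m := by
    intro U' hU' x y hxy hx hxU' h
    rcases Finset.mem_union.1 h with h | h
    · have := (((hmemA₀ x y).1 h).2 hxy).1
      omega
    · obtain ⟨z, hz, h⟩ := Finset.mem_image.1 h
      rcases Sym2.eq_iff.1 h with ⟨rfl, -⟩ | ⟨-, rfl⟩
      · exact hxU' hz
      · have := (hφ z (hU' hz)).2
        omega
  have hinc : ∀ U' ⊆ U, ∀ t ∉ U', (inc (A₀ ∪ U'.image m) t).card ≤ 2 := by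
    intro U' hU' t ht
    rcases hG.degree t with h | h
    · exact h ▸ card_inc_le_degree (hE U' hU') t
    · obtain ⟨y, hy⟩ := hcov t h
      have := card_inc_add_le (hE U' hU') {y} (t := t) (by
        simp only [Finset.mem_singleton, forall_eq]
        exact ⟨hMG hy, hmem U' hU' t y hy h ht⟩)
      simp only [Finset.card_singleton] at this
      omega
  have hloc : ∀ x ∈ U, ∃ a b w, a ∉ U ∧ b ∉ U ∧ w ≠ x ∧
      (∀ z, G.Adj x z ↔ z = φ x ∨ z = a ∨ z = b) ∧ (∀ z, G.Adj (φ x) z ↔ z = x ∨ z = w) := by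
    intro x hx
    obtain ⟨a, b, -, -, -, h⟩ := exists_neighbours_of_degree_three (hU3 x hx) (hMG (hφ x hx).1)
    obtain ⟨w, hw, h'⟩ := exists_neighbours_of_degree_two (hφ x hx).2 (hMG (hφ x hx).1).symm
    exact ⟨a, b, w, fun ha => hind x hx a ha ((h a).2 (by simp)),
      fun hb => hind x hx b hb ((h b).2 (by simp)), hw, h, h'⟩
  have hTU : ∀ x ∈ U, φ x ∉ U := fun x hx h => by
    have := (hφ x hx).2
    have := hU3 _ h
    omega
  have key : ∀ U' ⊆ U, ∃ c, ProperOn G (A₀ ∪ U'.image m) c := by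
    intro U'
    induction U' using Finset.induction_on with
    | empty =>
      intro hU'
      obtain ⟨f, hf0, hf⟩ := hG.exists_descent (Z := {v | G.degree v = 2}) hT
      refine exists_properOn_of_descent hG (hE ∅ hU') (fun t => hinc ∅ hU' t (by simp)) hf ?_
      intro x y hxy hx
      have h1 := card_nbrs_le (show G.Adj x y from hE ∅ hU' _ hxy)
      have h2 : G.degree x = 2 := (hf0 x).1 hx
      have h3 := hG.degree_le y
      omega
    | insert x U' hxU' ih =>
      intro hU'
      have hU'' : U' ⊆ U := (Finset.subset_insert _ _).trans hU'
      have hx : x ∈ U := hU' (Finset.mem_insert_self _ _)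
      obtain ⟨c, hc⟩ := ih hU''
      have hins : ∀ (U' : Finset V) (x : V), A₀ ∪ (insert x U').image m = insert (m x) (A₀ ∪ U'.image m) := by
        intro U' x
        rw [Finset.image_insert, Finset.union_insert]
      obtain ⟨a, b, w, ha, hb, hwx, hNx, hNt⟩ := hloc x hx
      have hnx : ∀ t ∈ nbrs G x (φ x), t ∈ [a, b, w] :=
        mem_of_mem_nbrs (fun z hz => by rcases (hNx z).1 hz with h | h | h <;> simp [h])
          (fun z hz => by rcases (hNt z).1 hz with h | h <;> simp [h])
      have hdirect : ∀ U' ⊆ U, w ∉ U' → (conf G (A₀ ∪ U'.image m) (m x)).card ≤ 6 := by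
        intro U' hU' hw
        have h1 := card_conf_le_sum (hE U' hU') _ hnx
        have h2 := hinc U' hU' a fun h => ha (hU' h)
        have h3 := hinc U' hU' b fun h => hb (hU' h)
        have h4 := hinc U' hU' w hw
        change (conf G _ s(x, φ x)).card ≤ 6
        simp only [List.map_cons, List.map_nil, List.sum_cons, List.sum_nil] at h1
        omega
      by_cases hwU' : w ∉ U'
      · rw [hins]
        exact hc.insert_of_card_le (hdirect U' hU'' hwU')
      push Not at hwU'
      have hw := hU'' hwU'
      have hwx' : G.Adj w (φ x) := ((hNt w).2 (Or.inr rfl)).symm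
      have hφne : φ x ≠ φ w := fun h => hwx (hφinj x hx w hw h).symm
      obtain ⟨y, -, -, hNw⟩ := exists_third_neighbour (hU3 w hw) hwx' (hMG (hφ w hw).1) hφne
      have hy : y ∉ U := fun hy => hind w hw y hy ((hNw y).2 (by simp))
      obtain ⟨x₃, hx₃w, hNt₂⟩ := exists_neighbours_of_degree_two (hφ w hw).2 (hMG (hφ w hw).1).symm
      have hnw : ∀ t ∈ nbrs G w (φ w), t ∈ [φ x, y, x₃] :=
        mem_of_mem_nbrs (fun z hz => by rcases (hNw z).1 hz with h | h | h <;> simp [h])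
          (fun z hz => by rcases (hNt₂ z).1 hz with h | h <;> simp [h])
      by_cases hx₃x : x₃ = x
      · subst hx₃x
        rw [hins]
        refine hc.insert_of_card_le ?_
        have hφadj : G.Adj x₃ (φ w) := ((hNt₂ x₃).2 (Or.inr rfl)).symm
        obtain ⟨b', hb'⟩ : ∃ b', b' ∉ U ∧ ∀ z, G.Adj x₃ z ↔ z = φ x₃ ∨ z = φ w ∨ z = b' := by
          rcases ((hNx _).1 hφadj).resolve_left hφne.symm with h | h
          · exact ⟨b, hb, fun z => by rw [hNx, h]⟩
          · exact ⟨a, ha, fun z => by rw [hNx, h]; tauto⟩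
        have hsub : conf G (A₀ ∪ U'.image m) (m x₃) ⊆
            insert s(x₃, φ w) (inc (A₀ ∪ U'.image m) b' ∪ inc (A₀ ∪ U'.image m) w) := by
          intro e he
          obtain ⟨t, ht, het⟩ := Finset.mem_biUnion.1 (conf_subset (hE U' hU'') he)
          rw [mem_nbrs, hb'.2, hNt] at ht
          obtain ⟨heA, hte⟩ := mem_inc.1 het
          simp only [Finset.mem_insert, Finset.mem_union]
          have ht' : t = φ w ∨ t = b' ∨ t = w := by tauto
          rcases ht' with rfl | rfl | rfl
          · obtain ⟨z, rfl⟩ := Sym2.mem_iff_exists.1 hte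
            rcases (hNt₂ z).1 (hE U' hU'' _ heA) with rfl | rfl
            · exact Or.inr (Or.inr (mem_inc.2 ⟨heA, by simp⟩))
            · exact Or.inl Sym2.eq_swap
          · exact Or.inr (Or.inl het)
          · exact Or.inr (Or.inr het)
        have h1 := hinc U' hU'' b' fun h => hb'.1 (hU'' h)
        have h2 := card_inc_le_degree (hE U' hU'') w
        have h3 := hG.degree_le w
        refine (Finset.card_le_card hsub).trans ((Finset.card_insert_le _ _).trans ?_)
        have h4 := Finset.card_union_le (inc (A₀ ∪ U'.image m) b') (inc (A₀ ∪ U'.image m) w)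
        omega
      by_cases hx₃U' : x₃ ∉ U'
      · have hew : U'.erase w ⊆ U := (Finset.erase_subset _ _).trans hU''
        have hexw : insert x (U'.erase w) ⊆ U := Finset.insert_subset hx hew
        obtain ⟨c₁, h₁⟩ := (hc.mono (B := A₀ ∪ (U'.erase w).image m)
          (Finset.union_subset_union_right (Finset.image_subset_image
            (Finset.erase_subset _ _)))).insert_of_card_le (hdirect _ hew (by simp))
        rw [← hins] at h₁
        obtain ⟨c₂, h₂⟩ := h₁.insert_of_card_le (e := m w) (by
          have h1 := card_conf_le_sum (hE _ hexw) _ hnw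
          have h2 := hinc _ hexw (φ x) fun h => hTU x hx (hexw h)
          have h3 := hinc _ hexw y fun h => hy (hexw h)
          have h4 := hinc _ hexw x₃ (by simp [hx₃x, hx₃U'])
          change (conf G _ s(w, φ w)).card ≤ 6
          simp only [List.map_cons, List.map_nil, List.sum_cons, List.sum_nil] at h1
          omega)
        rw [← hins, Finset.insert_comm, Finset.insert_erase hwU'] at h₂
        exact ⟨c₂, h₂⟩
      push Not at hx₃U'
      have hx₃ := hU'' hx₃U'
      have hx₃adj : G.Adj x₃ (φ w) := ((hNt₂ x₃).2 (Or.inr rfl)).symm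
      have hφne₃ : φ w ≠ φ x₃ := fun h => hx₃w (hφinj w hw x₃ hx₃ h).symm
      obtain ⟨z, -, -, hNx₃⟩ := exists_third_neighbour (hU3 x₃ hx₃) hx₃adj (hMG (hφ x₃ hx₃).1) hφne₃
      have hz : z ∉ U := fun hz => hind x₃ hx₃ z hz ((hNx₃ z).2 (by simp))
      set A := A₀ ∪ U'.image m with hA
      set B := A \ {s(φ x, w), s(w, φ w), s(φ w, x₃)} with hB
      have hBA : B ⊆ A := Finset.sdiff_subset
      have hBE : ∀ e ∈ B, e ∈ G.edgeSet := fun e he => hE U' hU'' e (hBA he)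
      have hincB : ∀ t ∉ U, (inc B t).card ≤ 2 := fun t ht =>
        (Finset.card_le_card fun e he => by
          simp only [mem_inc] at he ⊢
          exact ⟨hBA he.1, he.2⟩).trans (hinc U' hU'' t fun h => ht (hU'' h))
      have hneT : ∀ p ∈ U, ∀ q ∈ U, p ≠ φ q := fun p hp q hq h => hTU q hq (h ▸ hp)
      have hB1 : s(w, φ x) ∉ B := by rw [Sym2.eq_swap]; simp [hB]
      have hB2 : s(w, φ w) ∉ B := by simp [hB]
      have hB2' : s(φ w, w) ∉ B := by rw [Sym2.eq_swap]; simp [hB]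
      have hB3 : s(x₃, φ w) ∉ B := by rw [Sym2.eq_swap]; simp [hB]
      have hB4 : s(x, φ x) ∉ B := fun h =>
        hmem U' hU'' x (φ x) (hφ x hx).1 (hU3 x hx) hxU' (hBA h)
      have iw : (inc B w).card ≤ 1 := by
        have := card_inc_add_le hBE {φ x, φ w} (t := w) (by
          simp only [Finset.mem_insert, Finset.mem_singleton, forall_eq_or_imp, forall_eq]
          exact ⟨⟨hwx', hB1⟩, hMG (hφ w hw).1, hB2⟩)
        rw [Finset.card_pair hφne, hU3 w hw] at this
        omega
      have it₂ : (inc B (φ w)).card = 0 := by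
        have := card_inc_add_le hBE {w, x₃} (t := φ w) (by
          simp only [Finset.mem_insert, Finset.mem_singleton, forall_eq_or_imp, forall_eq]
          exact ⟨⟨(hMG (hφ w hw).1).symm, hB2'⟩, hx₃adj.symm, by rwa [Sym2.eq_swap]⟩)
        rw [Finset.card_pair hx₃w.symm, (hφ w hw).2] at this
        omega
      have it₁ : (inc B (φ x)).card = 0 := by
        have := card_inc_add_le hBE {x, w} (t := φ x) (by
          simp only [Finset.mem_insert, Finset.mem_singleton, forall_eq_or_imp, forall_eq]
          exact ⟨⟨(hMG (hφ x hx).1).symm, by rwa [Sym2.eq_swap]⟩, hwx'.symm, by rwa [Sym2.eq_swap]⟩)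
        rw [Finset.card_pair hwx.symm, (hφ x hx).2] at this
        omega
      have ix₃ : (inc B x₃).card ≤ 2 := by
        have := card_inc_add_le hBE {φ w} (t := x₃) (by
          simp only [Finset.mem_singleton, forall_eq]
          exact ⟨hx₃adj, hB3⟩)
        rw [Finset.card_singleton, hU3 x₃ hx₃] at this
        omega
      have ix : (inc B x).card ≤ 2 := by
        have := card_inc_add_le hBE {φ x} (t := x) (by
          simp only [Finset.mem_singleton, forall_eq]
          exact ⟨hMG (hφ x hx).1, hB4⟩)
        rw [Finset.card_singleton, hU3 x hx] at this
        omega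
      have ia := hincB a ha
      have ib := hincB b hb
      have iy := hincB y hy
      have iz := hincB z hz
      have it₃ := hincB (φ x₃) (hTU x₃ hx₃)
      have c1 := card_conf_le_sum hBE _ hnx
      have c2 := card_conf_le_sum hBE (x := φ x) (y := w) [x, φ w, y]
        (mem_of_mem_nbrs (fun z hz => by rcases (hNt z).1 hz with h | h <;> simp [h])
          (fun z hz => by rcases (hNw z).1 hz with h | h | h <;> simp [h]))
      have c3 := card_conf_le_sum hBE _ hnw
      have c4 := card_conf_le_sum hBE (x := φ w) (y := x₃) [w, φ x₃, z]
        (mem_of_mem_nbrs (fun z hz => by rcases (hNt₂ z).1 hz with h | h <;> simp [h])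
          (fun z hz => by rcases (hNx₃ z).1 hz with h | h | h <;> simp [h]))
      simp only [List.map_cons, List.map_nil, List.sum_cons, List.sum_nil] at c1 c2 c3 c4
      have h14 : ¬ Near G s(x, φ x) s(φ w, x₃) := by
        rintro ⟨p, hp, q, hq, hpq⟩
        have n1 := hneT x hx w hw
        have n2 := hneT x₃ hx₃ x hx
        have n3 := hind x hx x₃ hx₃
        have n4 : ¬ G.Adj x (φ w) := fun h => by
          rcases (hNt₂ x).1 h.symm with h | h
          · exact hwx h.symm
          · exact hx₃x h.symm
        have n5 : ¬ G.Adj (φ x) x₃ := fun h => by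
          rcases (hNt x₃).1 h with h | h
          · exact hx₃x h
          · exact hx₃w h
        have n6 : ¬ G.Adj (φ x) (φ w) := fun h => by
          rcases (hNt _).1 h with h | h
          · exact hneT x hx w hw h.symm
          · exact hneT w hw w hw h.symm
        rcases Sym2.mem_iff.1 hp with rfl | rfl <;> rcases Sym2.mem_iff.1 hq with rfl | rfl
        · exact hpq.elim n1 n4
        · exact hpq.elim (fun h => hx₃x h.symm) n3
        · exact hpq.elim hφne n6
        · exact hpq.elim (fun h => n2 h.symm) n5
      obtain ⟨c', hc'⟩ := (hc.mono hBA).extend (α := Fin 4)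
        (e := ![s(x, φ x), s(φ x, w), s(w, φ w), s(φ w, x₃)]) (by
          have n1 := hneT x hx w hw
          have n2 := hneT x₃ hx₃ x hx
          have n3 := hneT w hw x hx
          have n4 := hneT w hw w hw
          have n5 := hneT x hx x hx
          have n6 := hneT x₃ hx₃ w hw
          intro i j
          fin_cases i <;> fin_cases j <;>
            simp [n1, n2, n3, n4, n5, n6, n1.symm, n2.symm, n3.symm, n4.symm, n5.symm, n6.symm,
              hwx, hwx.symm, hx₃w, hx₃w.symm, hx₃x, Ne.symm hx₃x, hφne, hφne.symm])
        [(0, 1), (0, 2), (1, 2), (1, 3), (2, 3)] ![1, 2, 1, 1] (by decide)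
        (by
          intro i j hij hn
          fin_cases i <;> fin_cases j <;> first
            | exact absurd rfl hij
            | exact absurd hn h14
            | exact absurd hn.symm h14
            | decide)
        (by
          intro i
          fin_cases i <;> simp <;> omega)
      refine ⟨c', hc'.mono fun e he => ?_⟩
      rw [hins, Finset.mem_insert] at he
      simp only [Finset.mem_union, Finset.mem_image, Finset.mem_univ, true_and]
      rcases he with rfl | he
      · exact Or.inr ⟨0, rfl⟩
      · by_cases heB : e ∈ B
        · exact Or.inl heB
        · right
          simp only [hB, Finset.mem_sdiff, not_and, not_not, Finset.mem_insert,
            Finset.mem_singleton] at heB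
          rcases heB he with rfl | rfl | rfl
          · exact ⟨1, rfl⟩
          · exact ⟨2, rfl⟩
          · exact ⟨3, rfl⟩
  obtain ⟨c, hc⟩ := key U subset_rfl
  have hmissing : ∀ x y, G.Adj x y → s(x, y) ∉ A₀ ∪ U.image m → M.Adj x y ∧ G.degree x = 3 := by
    intro x y hxy h
    rw [Finset.mem_union, not_or, hmemA₀] at h
    have hMxy : M.Adj x y := by tauto
    refine ⟨hMxy, (hG.degree x).resolve_left fun hx => ?_⟩
    have hy : G.degree y = 3 := (hG.degree y).resolve_left fun hy => by tauto
    have hyU := hUiff y x hMxy.symm hy hx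
    refine h.2 (Finset.mem_image.2 ⟨y, hyU, ?_⟩)
    rw [hM y x (φ y) hMxy.symm (hφ y hyU).1, hm]
    exact Sym2.eq_swap
  refine goodColoring_of_properOn (fun x y z hxy hxz h1 h2 => ?_) (fun x y hxy h => ?_) hc
  · exact hM x y z (hmissing x y hxy h1).1 (hmissing x z hxz h2).1
  · exact (hmissing x y hxy h).2

end DegreeTwo

section Cycles

open Classical

variable {V : Type} {G : SimpleGraph V}

/-- A cycle of length `n`, as a periodic sequence of vertices. -/
structure IsCyc (G : SimpleGraph V) (n : ℕ) (v : ℕ → V) : Prop where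
  three_le : 3 ≤ n
  periodic : ∀ i, v (i + n) = v i
  ne : ∀ i j, i < j → j < i + n → v i ≠ v j
  adj : ∀ i, G.Adj (v i) (v (i + 1))

lemma exists_isCyc_of_closed {m : ℕ} (hm : 3 ≤ m) (w : ℕ → V)
    (hne : ∀ i j, i < j → j < m → w i ≠ w j) (hadj : ∀ i, i + 1 < m → G.Adj (w i) (w (i + 1)))
    (hclose : G.Adj (w (m - 1)) (w 0)) : ∃ v, IsCyc G m v := by
  have hmod : ∀ i, i % m < m := fun i => Nat.mod_lt _ (by omega)
  refine ⟨fun i => w (i % m), hm, fun i => by simp, fun i j hij hj h => ?_, fun i => ?_⟩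
  · have h1 : i % m = j % m := by
      rcases lt_trichotomy (i % m) (j % m) with h' | h' | h'
      · exact absurd h (hne _ _ h' (hmod j))
      · exact h'
      · exact absurd h.symm (hne _ _ h' (hmod i))
    have h2 : m ∣ j - i := (Nat.modEq_iff_dvd' hij.le).1 h1
    exact absurd (Nat.le_of_dvd (by omega) h2) (by omega)
  · have h1 := hmod i
    rw [Nat.add_mod, Nat.mod_eq_of_lt (show 1 < m by omega)]
    by_cases h : i % m + 1 = m
    · rw [h, Nat.mod_self, show i % m = m - 1 by omega]
      exact hclose
    · rw [Nat.mod_eq_of_lt (show i % m + 1 < m by omega)]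
      exact hadj _ (by omega)

lemma Reduced.exists_isCyc [Fintype V] [Nonempty V] (hG : Reduced G) : ∃ n v, IsCyc G n v := by
  obtain ⟨x⟩ := ‹Nonempty V›
  have hx : 0 < G.degree x := by have := hG.degree x; omega
  obtain ⟨y, hxy⟩ := (G.degree_pos_iff_exists_adj x).1 hx
  have hb : ¬ G.IsBridge s(x, y) := by
    rw [SimpleGraph.isBridge_iff]
    intro hr
    obtain ⟨a, b, hab, ha, hb, hne⟩ := hG.cut
      {w | (G.deleteEdges {s(x, y)}).Reachable x w} x y (SimpleGraph.Reachable.refl _) hr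
    have hne' : s(a, b) ≠ s(x, y) := by
      intro h
      rcases Sym2.eq_iff.1 h with h | ⟨-, rfl⟩
      · exact hne h
      · exact hb (SimpleGraph.Reachable.refl _)
    refine hb (SimpleGraph.Reachable.trans ha (SimpleGraph.Adj.reachable ?_))
    rw [SimpleGraph.deleteEdges_adj]
    exact ⟨hab, by simpa using hne'⟩
  rw [SimpleGraph.isBridge_iff_forall_cycle_notMem hxy] at hb
  push Not at hb
  obtain ⟨z, p, hp, -⟩ := hb
  have h3 := hp.three_le_length
  refine ⟨p.length, exists_isCyc_of_closed h3 p.getVert ?_ ?_ ?_⟩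
  · intro i j hij hj h
    have := hp.getVert_injOn' (show i ≤ p.length - 1 by omega) (show j ≤ p.length - 1 by omega) h
    omega
  · intro i hi
    exact p.adj_getVert_succ (by omega)
  · have := p.adj_getVert_succ (show p.length - 1 < p.length by omega)
    rw [Nat.sub_add_cancel (by omega), p.getVert_length] at this
    rwa [p.getVert_zero]

/-- A shortest cycle `v` in a cubic graph, with `u i` the neighbour of `v i` off the cycle. -/
structure Frame (G : SimpleGraph V) (n : ℕ) (v u : ℕ → V) : Prop where
  cyc : IsCyc G n v
  min : ∀ m w, IsCyc G m w → n ≤ m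
  periodic : ∀ i, u (i + n) = u i
  ne_prev : ∀ i, u (i + 1) ≠ v i
  ne_next : ∀ i, u i ≠ v (i + 1)
  adj_iff : ∀ i z, G.Adj (v (i + 1)) z ↔ z = v i ∨ z = v (i + 2) ∨ z = u (i + 1)

lemma IsCyc.shift {n : ℕ} {v : ℕ → V} (h : IsCyc G n v) (k : ℕ) : IsCyc G n fun i => v (i + k) :=
  ⟨h.three_le, fun i => by rw [← h.periodic (i + k)]; congr 1; omega,
    fun i j hij hj => h.ne _ _ (by omega) (by omega),
    fun i => by have := h.adj (i + k); rwa [add_right_comm] at this⟩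

lemma Frame.shift {n : ℕ} {v u : ℕ → V} (h : Frame G n v u) (k : ℕ) :
    Frame G n (fun i => v (i + k)) fun i => u (i + k) where
  cyc := h.cyc.shift k
  min := h.min
  periodic i := by rw [← h.periodic (i + k)]; congr 1; omega
  ne_prev i := by have := h.ne_prev (i + k); rwa [add_right_comm] at this
  ne_next i := by have := h.ne_next (i + k); rwa [add_right_comm] at this
  adj_iff i z := by
    have := h.adj_iff (i + k) z
    rw [add_right_comm i k 1, add_right_comm i k 2] at this
    exact this

lemma exists_frame [Fintype V] [Nonempty V] (hG : Reduced G) (h3 : ∀ x, G.degree x = 3) :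
    ∃ n v u, Frame G n v u := by
  have hex := hG.exists_isCyc
  obtain ⟨v, hv⟩ := Nat.find_spec hex
  set n := Nat.find hex
  have hn := hv.three_le
  have hpred : ∀ i, v (i + 1 + (n - 1)) = v i := fun i => by
    rw [← hv.periodic i]; congr 1; omega
  have hadj : ∀ i, G.Adj (v (i + 1)) (v i) := fun i => (hv.adj i).symm
  have hthird : ∀ i, ∃ r, r ≠ v (i + (n - 1)) ∧ r ≠ v (i + 1) ∧
      ∀ z, G.Adj (v i) z ↔ z = v (i + (n - 1)) ∨ z = v (i + 1) ∨ z = r := fun i => by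
    refine exists_third_neighbour (h3 _) ?_ (hv.adj i) (hv.ne _ _ ?_ ?_).symm
    · have := hadj (i + (n - 1))
      rwa [show i + (n - 1) + 1 = i + n by omega, hv.periodic] at this
    · omega
    · omega
  choose u hu1 hu2 hu using hthird
  refine ⟨n, v, u, hv, fun m w hw => Nat.find_min' hex ⟨w, hw⟩, fun i => ?_, fun i => ?_, hu2,
    fun i z => ?_⟩
  · have h1 : G.Adj (v i) (u (i + n)) := by
      rw [← hv.periodic i]
      exact (hu _ _).2 (by simp)
    have h2 := hu1 (i + n)
    have h3 := hu2 (i + n)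
    rw [show i + n + (n - 1) = i + (n - 1) + n by omega, hv.periodic] at h2
    rw [show i + n + 1 = i + 1 + n by omega, hv.periodic] at h3
    have := (hu i _).1 h1
    tauto
  · have := hu1 (i + 1)
    rwa [hpred] at this
  · rw [hu, hpred]

variable {n : ℕ} {v u : ℕ → V}

lemma Frame.adj_spoke (h : Frame G n v u) (i : ℕ) : G.Adj (v i) (u i) := by
  have h1 := h.cyc.three_le
  rw [← h.cyc.periodic, ← h.periodic, show i + n = i + n - 1 + 1 by omega, h.adj_iff]
  simp

lemma Frame.adj_iff_of_pos (h : Frame G n v u) {i : ℕ} (hi : 0 < i) (z : V) :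
    G.Adj (v i) z ↔ z = v (i - 1) ∨ z = v (i + 1) ∨ z = u i := by
  have := h.adj_iff (i - 1) z
  rwa [show i - 1 + 1 = i by omega, show i - 1 + 2 = i + 1 by omega] at this

/-- A path through at most two vertices off a shortest cycle does not shortcut it. -/
lemma Frame.ear (h : Frame G n v u) {a k s : ℕ} (hkn : k < n) (hs : 2 ≤ k + s)
    (w : ℕ → V) (hw0 : s = 0 → G.Adj (v (a + k)) (v a))
    (hw1 : 0 < s → G.Adj (v (a + k)) (w 0) ∧ G.Adj (w (s - 1)) (v a))
    (hww : ∀ i, i + 1 < s → G.Adj (w i) (w (i + 1)))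
    (hne : ∀ i j, i < j → j < s → w i ≠ w j) (hoff : ∀ i j, i < s → w i ≠ v j) :
    n ≤ k + 1 + s := by
  have hcyc := exists_isCyc_of_closed (G := G) (m := k + 1 + s) (by omega)
    (fun i => if i ≤ k then v (a + i) else w (i - (k + 1))) ?_ ?_ ?_
  · obtain ⟨w', hw'⟩ := hcyc
    exact h.min _ _ hw'
  · intro i j hij hj
    split_ifs with h1 h2
    · exact h.cyc.ne _ _ (by omega) (by omega)
    · exact (hoff _ _ (by omega)).symm
    · omega
    · exact hne _ _ (by omega) (by omega)
  · intro i hi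
    split_ifs with h1 h2
    · exact h.cyc.adj _
    · rw [show i = k by omega, show k + 1 - (k + 1) = 0 by omega]
      exact (hw1 (by omega)).1
    · omega
    · have := hww (i - (k + 1)) (by omega)
      rwa [show i - (k + 1) + 1 = i + 1 - (k + 1) by omega] at this
  · rw [if_pos (Nat.zero_le k)]
    split_ifs with h1
    · rw [show k + 1 + s - 1 = k by omega]
      exact hw0 (by omega)
    · rw [show k + 1 + s - 1 - (k + 1) = s - 1 by omega]
      exact (hw1 (by omega)).2

lemma IsCyc.exists_lt (h : IsCyc G n v) (i j : ℕ) : ∃ k < n, v (i + k) = v j := by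
  have hn := h.three_le
  have hper : ∀ c x, v (x + c * n) = v x := by
    intro c
    induction c with
    | zero => simp
    | succ c ih =>
      intro x
      rw [show x + (c + 1) * n = x + c * n + n by ring, h.periodic, ih]
  have hmod : ∀ x, v (x % n) = v x := fun x => by
    conv_rhs => rw [← Nat.mod_add_div' x n]
    rw [hper]
  refine ⟨(j + (n - i % n)) % n, Nat.mod_lt _ (by omega), ?_⟩
  rw [← hmod, ← hmod j]
  congr 1
  have h1 := Nat.mod_lt i (show 0 < n by omega)
  rw [Nat.add_mod_mod, Nat.add_mod, show j + (n - i % n) = j + (n - i % n) from rfl]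
  conv_rhs => rw [← Nat.add_mod_right j n]
  rw [← Nat.add_mod, ← Nat.mod_add_mod]
  congr 1
  omega

lemma Frame.u_ne_v (h : Frame G n v u) (hn : 4 ≤ n) (i j : ℕ) : u i ≠ v j := by
  intro he
  obtain ⟨k, hk, hkj⟩ := h.cyc.exists_lt i j
  rw [← hkj] at he
  have hadj := h.adj_spoke i
  have hk0 : k ≠ 0 := by
    rintro rfl
    rw [he] at hadj
    exact hadj.ne rfl
  have hk1 : k ≠ 1 := by
    rintro rfl
    exact h.ne_next i he
  have hkn : k ≠ n - 1 := by
    rintro rfl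
    have := h.ne_prev (i + n - 1)
    rw [show i + n - 1 + 1 = i + n by omega, h.periodic, he] at this
    exact this (by congr 1; omega)
  have := h.ear (a := i) (k := k) (s := 0) hk (by omega) (fun _ => v 0)
    (fun _ => by rw [← he]; exact hadj.symm) (by omega) (by omega) (by omega) (by omega)
  omega

/-- Two vertices of the cycle with a common neighbour off it cut off an arc. -/
lemma Frame.le_of_u_eq (h : Frame G n v u) (hn : 4 ≤ n) {i k : ℕ} (hk : 0 < k) (hkn : k < n)
    (he : u i = u (i + k)) : n ≤ k + 2 := by
  refine h.ear (a := i) (k := k) (s := 1) hkn (by omega) (fun _ => u i) (by omega) (fun _ => ?_)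
    (by omega) (by omega) (fun _ j _ => h.u_ne_v hn i j)
  exact ⟨he ▸ h.adj_spoke _, (h.adj_spoke i).symm⟩

lemma Frame.le_of_u_adj (h : Frame G n v u) (hn : 4 ≤ n) {i k : ℕ} (hk : 0 < k) (hkn : k < n)
    (he : G.Adj (u i) (u (i + k))) : n ≤ k + 3 := by
  refine h.ear (a := i) (k := k) (s := 2) hkn (by omega)
    (fun j => if j = 0 then u (i + k) else u i) (by omega) (fun _ => ?_) ?_ ?_ ?_
  · simpa using ⟨h.adj_spoke _, (h.adj_spoke i).symm⟩
  · intro j hj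
    rw [show j = 0 by omega]
    simpa using he.symm
  · intro a b hab hb
    rw [show a = 0 by omega, show b = 1 by omega]
    simpa using he.ne.symm
  · intro a b _
    split_ifs
    · exact h.u_ne_v hn _ _
    · exact h.u_ne_v hn _ _

lemma Frame.u_eq_bounds (h : Frame G n v u) (hn : 4 ≤ n) {i j : ℕ} (hij : i < j) (hj : j < i + n)
    (he : u i = u j) : n ≤ j - i + 2 ∧ j ≤ i + 2 := by
  have h1 := h.le_of_u_eq hn (i := i) (k := j - i) (by omega) (by omega)
    (by rw [show i + (j - i) = j by omega, he])
  have h2 := h.le_of_u_eq hn (i := j) (k := i + n - j) (by omega) (by omega)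
    (by rw [show j + (i + n - j) = i + n by omega, h.periodic, he])
  omega

lemma Frame.u_adj_bounds (h : Frame G n v u) (hn : 4 ≤ n) {i j : ℕ} (hij : i < j) (hj : j < i + n)
    (he : G.Adj (u i) (u j)) : n ≤ j - i + 3 ∧ j ≤ i + 3 := by
  have h1 := h.le_of_u_adj hn (i := i) (k := j - i) (by omega) (by omega)
    (by rwa [show i + (j - i) = j by omega])
  have h2 := h.le_of_u_adj hn (i := j) (k := i + n - j) (by omega) (by omega)
    (by rw [show j + (i + n - j) = i + n by omega, h.periodic]; exact he.symm)
  omega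

lemma Frame.u_ne (h : Frame G n v u) (hn : 5 ≤ n) {i j : ℕ} (hij : i < j) (hj : j < i + n) :
    u i ≠ u j := fun he => by
  have := h.u_eq_bounds (by omega) hij hj he
  omega

lemma Frame.not_adj_u (h : Frame G n v u) (hn : 7 ≤ n) {i j : ℕ} (hij : i < j) (hj : j < i + n) :
    ¬ G.Adj (u i) (u j) := fun he => by
  have := h.u_adj_bounds (by omega) hij hj he
  omega

lemma Frame.dist_le_of_v_adj (h : Frame G n v u) (hn : 4 ≤ n) {x y : ℕ} (hy : y ≤ n)
    (he : v x = v y ∨ G.Adj (v x) (v y)) : y ≤ x + 1 ∨ n ≤ y - x + 1 := by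
  by_contra hc
  have h1 : v y ≠ v x := (h.cyc.ne x y (by omega) (by omega)).symm
  have h2 := ((h.adj_iff_of_pos (i := y) (by omega) _).1 (he.resolve_left h1.symm).symm)
  rcases h2 with h2 | h2 | h2
  · exact h.cyc.ne x (y - 1) (by omega) (by omega) h2
  · by_cases hx : x = 0 ∧ y = n
    · omega
    · exact h.cyc.ne x (y + 1) (by omega) (by omega) h2
  · exact h.u_ne_v hn _ _ h2.symm

/-- The edges at a cycle: spokes and cycle edges. -/
def seg (v u : ℕ → V) (l i : ℕ) : Sym2 V := if l = 0 then s(v i, u i) else s(v i, v (i + 1))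

lemma seg_zero (i : ℕ) : seg v u 0 i = s(v i, u i) := rfl

lemma seg_one (i : ℕ) : seg v u 1 i = s(v i, v (i + 1)) := rfl

lemma mem_seg {l i : ℕ} (hl : l ≤ 1) {x : V} (hx : x ∈ seg v u l i) :
    x = v i ∨ (l = 0 ∧ x = u i) ∨ (l = 1 ∧ x = v (i + l)) := by
  obtain rfl | rfl : l = 0 ∨ l = 1 := by omega
  · simpa [seg_zero] using hx
  · simpa [seg_one] using hx

/-- Near edges at a shortest cycle touch it at nearly the same place. -/
lemma Frame.near_seg (h : Frame G n v u) (hn : 4 ≤ n)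
    (hinj : ∀ i j, i < j → j < i + n → u i ≠ u j) {l i l' j : ℕ} (hl : l ≤ 1) (hl' : l' ≤ 1)
    (hi : i + l ≤ n) (hj : j + l' ≤ n) (hnear : Near G (seg v u l i) (seg v u l' j)) :
    (∃ x y, (x = i ∨ x = i + l) ∧ (y = j ∨ y = j + l') ∧
      (x ≤ y + 1 ∧ y ≤ x + 1 ∨ n ≤ y - x + 1 ∨ n ≤ x - y + 1)) ∨
    (l = 0 ∧ l' = 0 ∧ G.Adj (u i) (u j)) := by
  have key : ∀ x y, x ≤ n → y ≤ n → (v x = v y ∨ G.Adj (v x) (v y)) →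
      (x ≤ y + 1 ∧ y ≤ x + 1 ∨ n ≤ y - x + 1 ∨ n ≤ x - y + 1) := by
    intro x y hx hy he
    rcases le_total x y with hxy | hxy
    · have := h.dist_le_of_v_adj hn hy he
      omega
    · have := h.dist_le_of_v_adj hn hx (he.imp Eq.symm SimpleGraph.Adj.symm)
      omega
  have hu : ∀ x y, x ≤ n → y ≤ n → u x = u y →
      (x ≤ y + 1 ∧ y ≤ x + 1 ∨ n ≤ y - x + 1 ∨ n ≤ x - y + 1) := by
    intro x y hx hy he
    by_contra hc
    rcases le_total x y with hxy | hxy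
    · exact hinj x y (by omega) (by omega) he
    · exact hinj y x (by omega) (by omega) he.symm
  have hspoke : ∀ x y, x ≤ n → y ≤ n → (v x = u y ∨ G.Adj (v x) (u y)) →
      (x ≤ y + 1 ∧ y ≤ x + 1 ∨ n ≤ y - x + 1 ∨ n ≤ x - y + 1) := by
    intro x y hx hy he
    have h1 := he.resolve_left (h.u_ne_v hn y x).symm
    have h2 : G.Adj (v (x + n)) (u y) := by rwa [h.cyc.periodic]
    rcases (h.adj_iff_of_pos (by omega) _).1 h2 with h3 | h3 | h3
    · exact absurd h3 (h.u_ne_v hn _ _)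
    · exact absurd h3 (h.u_ne_v hn _ _)
    · rw [h.periodic] at h3
      exact hu x y hx hy h3.symm
  obtain ⟨p, hp, q, hq, hpq⟩ := hnear
  have hp' : (∃ x, (x = i ∨ x = i + l) ∧ p = v x) ∨ l = 0 ∧ p = u i := by
    rcases mem_seg hl hp with h | h | h
    · exact Or.inl ⟨i, by simp, h⟩
    · exact Or.inr h
    · exact Or.inl ⟨i + l, by simp, h.2⟩
  have hq' : (∃ y, (y = j ∨ y = j + l') ∧ q = v y) ∨ l' = 0 ∧ q = u j := by
    rcases mem_seg hl' hq with h | h | h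
    · exact Or.inl ⟨j, by simp, h⟩
    · exact Or.inr h
    · exact Or.inl ⟨j + l', by simp, h.2⟩
  rcases hp' with ⟨x, hx, rfl⟩ | ⟨rfl, rfl⟩ <;> rcases hq' with ⟨y, hy, rfl⟩ | ⟨rfl, rfl⟩
  · exact Or.inl ⟨x, y, hx, hy, key x y (by omega) (by omega) hpq⟩
  · exact Or.inl ⟨x, j, hx, by simp, hspoke x j (by omega) (by omega) hpq⟩
  · have := hspoke y i (by omega) (by omega) (hpq.imp Eq.symm SimpleGraph.Adj.symm)
    exact Or.inl ⟨i, y, by simp, hy, by omega⟩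
  · rcases hpq with he | he
    · exact Or.inl ⟨i, j, by simp, by simp, hu i j (by omega) (by omega) he⟩
    · exact Or.inr ⟨rfl, rfl, he⟩

end Cycles

section Matchings

open Classical

variable {V : Type} [Fintype V] {G M : SimpleGraph V} {n : ℕ} {v u : ℕ → V}

/-- `M` is a perfect matching of `G`. -/
structure PerfectIn (G M : SimpleGraph V) : Prop where
  le : M ≤ G
  unique : ∀ x y z, M.Adj x y → M.Adj x z → y = z
  cover : ∀ x, ∃ y, M.Adj x y

/-- The edges of `G` outside `M`. -/
noncomputable def rest (G M : SimpleGraph V) : Finset (Sym2 V) :=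
  G.edgeFinset.filter (· ∉ M.edgeSet)

lemma mem_rest {x y : V} : s(x, y) ∈ rest G M ↔ G.Adj x y ∧ ¬ M.Adj x y := by simp [rest]

lemma edge_of_mem_rest {e : Sym2 V} (he : e ∈ rest G M) : e ∈ G.edgeSet := by
  simpa using (Finset.mem_filter.1 he).1

lemma PerfectIn.card_inc_le (hM : PerfectIn G M) (h3 : ∀ x, G.degree x = 3) {A : Finset (Sym2 V)}
    (hA : A ⊆ rest G M) (t : V) : (inc A t).card ≤ 2 := by
  obtain ⟨y, hy⟩ := hM.cover t
  have := card_inc_add_le (fun e he => edge_of_mem_rest (hA he)) {y} (t := t) (by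
    simpa using ⟨hM.le hy, fun h => (mem_rest.1 (hA h)).2 hy⟩)
  rw [Finset.card_singleton, h3] at this
  omega

lemma PerfectIn.exists_goodColoring (hM : PerfectIn G M) (h3 : ∀ x, G.degree x = 3)
    {c : Sym2 V → Fin 8} (hc : ProperOn G (rest G M) c) : ∃ c, GoodColoring G c := by
  refine goodColoring_of_properOn (fun x y z hxy hxz h1 h2 => ?_) (fun x _ _ _ => h3 x) hc
  rw [mem_rest] at h1 h2
  exact hM.unique x y z (by tauto) (by tauto)

/-- The edges outside `M` that do not meet the cycle. -/
noncomputable def base (G M : SimpleGraph V) (v : ℕ → V) : Finset (Sym2 V) :=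
  (rest G M).filter fun e => ∀ i, v i ∉ e

lemma base_subset : base G M v ⊆ rest G M := Finset.filter_subset _ _

lemma inc_base_v (i : ℕ) : inc (base G M v) (v i) = ∅ := by
  rw [Finset.eq_empty_iff_forall_notMem]
  intro e he
  obtain ⟨h1, h2⟩ := mem_inc.1 he
  exact (Finset.mem_filter.1 h1).2 i h2

lemma PerfectIn.exists_properOn_base (hM : PerfectIn G M) (h3 : ∀ x, G.degree x = 3)
    (hG : Reduced G) (v : ℕ → V) : ∃ c, ProperOn G (base G M v) c := by
  obtain ⟨f, hf0, hf⟩ := hG.exists_descent (Z := Set.range v) ⟨v 0, 0, rfl⟩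
  refine exists_properOn_of_descent hG (fun e he => edge_of_mem_rest (base_subset he))
    (hM.card_inc_le h3 base_subset) hf fun x y hxy hx => ?_
  obtain ⟨i, rfl⟩ := (hf0 x).1 hx
  exact absurd (Sym2.mem_mk_left _ _) ((Finset.mem_filter.1 hxy).2 i)

lemma PerfectIn.card_inc_base_u (hM : PerfectIn G M) (h3 : ∀ x, G.degree x = 3)
    (h : Frame G n v u) {i : ℕ} (hi : ¬ M.Adj (v i) (u i)) :
    (inc (base G M v) (u i)).card ≤ 1 := by
  obtain ⟨y, hy⟩ := hM.cover (u i)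
  have hyv : y ≠ v i := by
    rintro rfl
    exact hi hy.symm
  have := card_inc_add_le (A := base G M v) (fun e he => edge_of_mem_rest (base_subset he)) {y, v i}
    (t := u i) (by
      simp only [Finset.mem_insert, Finset.mem_singleton, forall_eq_or_imp, forall_eq]
      refine ⟨⟨hM.le hy, fun h => (mem_rest.1 (base_subset h)).2 hy⟩, (h.adj_spoke i).symm,
        fun h => (Finset.mem_filter.1 h).2 i (by simp)⟩)
  rw [Finset.card_pair hyv, h3] at this
  omega

omit [Fintype V] in
lemma Frame.exists_pred (h : Frame G n v u) (i : ℕ) :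
    ∃ p, ∀ z, G.Adj (v i) z ↔ z = v p ∨ z = v (i + 1) ∨ z = u i := by
  have hn := h.cyc.three_le
  refine ⟨i + n - 1, fun z => ?_⟩
  rw [← h.cyc.periodic i, h.adj_iff_of_pos (by omega), h.periodic,
    show i + n + 1 = i + 1 + n by omega, h.cyc.periodic]

lemma Frame.card_conf_cycle_edge_le (h : Frame G n v u) {A : Finset (Sym2 V)}
    (hA : ∀ e ∈ A, e ∈ G.edgeSet) (hv : ∀ i, inc A (v i) = ∅) (i : ℕ) :
    (conf G A (seg v u 1 i)).card ≤ (inc A (u i)).card + (inc A (u (i + 1))).card := by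
  obtain ⟨p, hp⟩ := h.exists_pred i
  have := card_conf_le_sum hA (x := v i) (y := v (i + 1)) [v p, u i, v (i + 2), u (i + 1)]
    (mem_of_mem_nbrs (fun z hz => by rcases (hp z).1 hz with h | h | h <;> simp [h])
      (fun z hz => by rcases (h.adj_iff i z).1 hz with h | h | h <;> simp [h]))
  simpa [hv, seg_one] using this

lemma Frame.card_conf_cycle_edge (h : Frame G n v u) (i : ℕ) :
    (conf G (base G M v) (seg v u 1 i)).card ≤
      (inc (base G M v) (u i)).card + (inc (base G M v) (u (i + 1))).card :=
  h.card_conf_cycle_edge_le (fun _ he => edge_of_mem_rest (base_subset he)) inc_base_v i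

lemma Frame.card_conf_spoke (h : Frame G n v u) {i : ℕ} {a b : V}
    (hu : ∀ z, G.Adj (u i) z ↔ z = v i ∨ z = a ∨ z = b) :
    (conf G (base G M v) (seg v u 0 i)).card ≤
      (inc (base G M v) a).card + (inc (base G M v) b).card := by
  obtain ⟨p, hp⟩ := h.exists_pred i
  have := card_conf_le_sum (A := base G M v) (fun e he => edge_of_mem_rest (base_subset he))
    (x := v i) (y := u i) [v p, v (i + 1), a, b]
    (mem_of_mem_nbrs (fun z hz => by rcases (hp z).1 hz with h | h | h <;> simp [h])
      (fun z hz => by rcases (hu z).1 hz with h | h | h <;> simp [h]))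
  simpa [inc_base_v, seg_zero] using this

lemma PerfectIn.card_conf_spoke_le (hM : PerfectIn G M) (h3 : ∀ x, G.degree x = 3)
    (h : Frame G n v u) (i : ℕ) : (conf G (base G M v) (seg v u 0 i)).card ≤ 4 := by
  obtain ⟨a, b, -, -, -, hu⟩ := exists_neighbours_of_degree_three (h3 _) (h.adj_spoke i).symm
  have h1 := hM.card_inc_le h3 (base_subset (v := v)) a
  have h2 := hM.card_inc_le h3 (base_subset (v := v)) b
  have := h.card_conf_spoke (M := M) hu
  omega

lemma PerfectIn.card_conf_spoke_le_three (hM : PerfectIn G M) (h3 : ∀ x, G.degree x = 3)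
    (h : Frame G n v u) {i j : ℕ} (hij : G.Adj (u i) (u j)) (huv : u j ≠ v i)
    (hj : ¬ M.Adj (v j) (u j)) :
    (conf G (base G M v) (seg v u 0 i)).card ≤ 3 := by
  obtain ⟨b, -, -, hu⟩ := exists_third_neighbour (h3 _) (h.adj_spoke i).symm hij huv.symm
  have h1 := hM.card_inc_base_u h3 h hj
  have h2 := hM.card_inc_le h3 (base_subset (v := v)) b
  have := h.card_conf_spoke (M := M) hu
  omega

lemma PerfectIn.card_conf_spoke_le_two (hM : PerfectIn G M) (h3 : ∀ x, G.degree x = 3)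
    (h : Frame G n v u) {i j k : ℕ} (hij : G.Adj (u i) (u j)) (huv : u j ≠ v i)
    (hj : ¬ M.Adj (v j) (u j)) (hik : G.Adj (u i) (u k)) (hkv : u k ≠ v i) (hjk : u j ≠ u k)
    (hk : ¬ M.Adj (v k) (u k)) :
    (conf G (base G M v) (seg v u 0 i)).card ≤ 2 := by
  obtain ⟨b, -, -, hu⟩ := exists_third_neighbour (h3 _) (h.adj_spoke i).symm hij huv.symm
  obtain rfl : u k = b := (((hu _).1 hik).resolve_left hkv).resolve_left hjk.symm
  have h1 := hM.card_inc_base_u h3 h hj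
  have h2 := hM.card_inc_base_u h3 h hk
  have := h.card_conf_spoke (M := M) hu
  omega

omit [Fintype V] in
lemma Frame.exists_seg (h : Frame G n v u) {e : Sym2 V} (he : e ∈ G.edgeSet) {i : ℕ}
    (hi : v i ∈ e) : ∃ l j, l ≤ 1 ∧ j < n ∧ e = seg v u l j := by
  have hn := h.cyc.three_le
  obtain ⟨k, hk, hki⟩ := h.cyc.exists_lt 0 i
  rw [zero_add] at hki
  obtain ⟨z, rfl⟩ := Sym2.mem_iff_exists.1 hi
  rw [← hki] at he ⊢
  have he' : G.Adj (v (k + n)) z := by rw [h.cyc.periodic]; exact he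
  rw [h.adj_iff_of_pos (by omega), h.periodic, show k + n + 1 = k + 1 + n by omega,
    h.cyc.periodic] at he'
  rcases he' with rfl | rfl | rfl
  · by_cases hk0 : k = 0
    · subst hk0
      refine ⟨1, n - 1, le_rfl, by omega, ?_⟩
      rw [seg_one, Sym2.eq_swap, show 0 + n - 1 = n - 1 by omega, show n - 1 + 1 = 0 + n by omega,
        h.cyc.periodic]
    · refine ⟨1, k - 1, le_rfl, by omega, ?_⟩
      rw [seg_one, Sym2.eq_swap, show k + n - 1 = k - 1 + n by omega, h.cyc.periodic,
        show k - 1 + 1 = k by omega]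
  · exact ⟨1, k, le_rfl, hk, rfl⟩
  · exact ⟨0, k, by omega, hk, rfl⟩

/-- Colouring the edges at the cycle finishes the colouring. -/
lemma PerfectIn.exists_goodColoring_of_seg (hM : PerfectIn G M) (h3 : ∀ x, G.degree x = 3)
    (h : Frame G n v u) {S : Finset (Sym2 V)} {c : Sym2 V → Fin 8}
    (hc : ProperOn G (base G M v ∪ S) c)
    (hS : ∀ l j, l ≤ 1 → j < n → seg v u l j ∈ rest G M → seg v u l j ∈ S) :
    ∃ c, GoodColoring G c := by
  refine hM.exists_goodColoring h3 (hc.mono fun e he => ?_)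
  by_cases hv : ∃ i, v i ∈ e
  · obtain ⟨i, hi⟩ := hv
    obtain ⟨l, j, hl, hj, rfl⟩ := h.exists_seg (edge_of_mem_rest he) hi
    exact Finset.mem_union_right _ (hS l j hl hj he)
  · push Not at hv
    exact Finset.mem_union_left _ (Finset.mem_filter.2 ⟨he, hv⟩)

omit [Fintype V] in
lemma Frame.seg_inj (h : Frame G n v u) (hn : 4 ≤ n) {l i l' j : ℕ} (hl : l ≤ 1) (hl' : l' ≤ 1)
    (hi : i < n) (hj : j < n) (he : seg v u l i = seg v u l' j) : l = l' ∧ i = j := by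
  have hv : ∀ i j, i < n → j < n → v i = v j → i = j := by
    intro i j hi hj he
    rcases lt_trichotomy i j with hij | hij | hij
    · exact absurd he (h.cyc.ne _ _ hij (by omega))
    · exact hij
    · exact absurd he.symm (h.cyc.ne _ _ hij (by omega))
  obtain rfl | rfl : l = 0 ∨ l = 1 := by omega
  · obtain rfl | rfl : l' = 0 ∨ l' = 1 := by omega
    · rw [seg_zero, seg_zero] at he
      rcases Sym2.eq_iff.1 he with he | he
      · exact ⟨rfl, hv i j hi hj he.1⟩
      · exact absurd he.2 (h.u_ne_v hn _ _)
    · rw [seg_zero, seg_one] at he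
      rcases Sym2.eq_iff.1 he with he | he
      · exact absurd he.2 (h.u_ne_v hn _ _)
      · exact absurd he.2 (h.u_ne_v hn _ _)
  · obtain rfl | rfl : l' = 0 ∨ l' = 1 := by omega
    · rw [seg_zero, seg_one] at he
      rcases Sym2.eq_iff.1 he with he | he
      · exact absurd he.2.symm (h.u_ne_v hn _ _)
      · exact absurd he.1.symm (h.u_ne_v hn _ _)
    · rw [seg_one, seg_one] at he
      rcases Sym2.eq_iff.1 he with he | he
      · exact ⟨rfl, hv i j hi hj he.1⟩
      · exfalso
        rcases lt_trichotomy i j with hij | rfl | hij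
        · by_cases hw : j + 1 < i + n
          · exact h.cyc.ne i (j + 1) (by omega) hw he.1
          · exact h.cyc.ne (i + 1) j (by omega) (by omega) he.2
        · exact h.cyc.ne i (i + 1) (by omega) (by omega) he.1
        · by_cases hw : i + 1 < j + n
          · exact h.cyc.ne j (i + 1) (by omega) hw he.2.symm
          · exact h.cyc.ne (j + 1) i (by omega) (by omega) he.1.symm

/-- Edges at a cycle of length `n`, given by kind and position, that may be near each other. -/
def Close (n : ℕ) (p q : ℕ × ℕ) : Prop := ∃ x ∈ [p.2, p.2 + p.1], ∃ y ∈ [q.2, q.2 + q.1],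
  (x ≤ y + 1 ∧ y ≤ x + 1 ∨ n ≤ y - x + 1 ∨ n ≤ x - y + 1)

instance (n : ℕ) (p q : ℕ × ℕ) : Decidable (Close n p q) := by unfold Close; infer_instance

omit [Fintype V] in
lemma Frame.close_of_near (h : Frame G n v u) (hn : 4 ≤ n)
    (hinj : ∀ i j, i < j → j < i + n → u i ≠ u j) {p q : ℕ × ℕ} (hp : p.1 ≤ 1) (hq : q.1 ≤ 1)
    (hp' : p.2 + p.1 ≤ n) (hq' : q.2 + q.1 ≤ n)
    (hnear : Near G (seg v u p.1 p.2) (seg v u q.1 q.2)) :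
    Close n p q ∨ (p.1 = 0 ∧ q.1 = 0 ∧ G.Adj (u p.2) (u q.2)) := by
  refine (h.near_seg hn hinj hp hq hp' hq' hnear).imp ?_ id
  rintro ⟨x, y, hx, hy, hxy⟩
  exact ⟨x, by simpa using hx, y, by simpa using hy, hxy⟩

/-- Finish the colouring by the Combinatorial Nullstellensatz on the edges at the cycle. -/
lemma PerfectIn.exists_goodColoring_of_edgeCoeff (hM : PerfectIn G M) (h3 : ∀ x, G.degree x = 3)
    (hG : Reduced G) (h : Frame G n v u) (hn : 4 ≤ n)
    (hinj : ∀ i j, i < j → j < i + n → u i ≠ u j) {m : ℕ} (p : Fin m → ℕ × ℕ)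
    (hp : ∀ a, (p a).1 ≤ 1 ∧ (p a).2 < n) (hpinj : Function.Injective p)
    (hS : ∀ l j, l ≤ 1 → j < n → seg v u l j ∈ rest G M → ∃ a, p a = (l, j))
    (es : List (Fin m × Fin m)) (d : Fin m → ℕ) (hd : edgeCoeff es d ≠ 0)
    (hclose : ∀ a b, a ≠ b → Close n (p a) (p b) → (a, b) ∈ es ∨ (b, a) ∈ es)
    (hext : ∀ a b, a ≠ b → (p a).1 = 0 → (p b).1 = 0 → G.Adj (u (p a).2) (u (p b).2) →
      (a, b) ∈ es ∨ (b, a) ∈ es)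
    (hlist : ∀ a, (conf G (base G M v) (seg v u (p a).1 (p a).2)).card + d a ≤ 6) :
    ∃ c, GoodColoring G c := by
  obtain ⟨c, hc⟩ := hM.exists_properOn_base h3 hG v
  obtain ⟨c', hc'⟩ := hc.extend (e := fun a => seg v u (p a).1 (p a).2) (fun a b hab =>
    hpinj (Prod.ext_iff.2 (h.seg_inj hn (hp a).1 (hp b).1 (hp a).2 (hp b).2 hab))) es d hd
    (fun a b hab hnear => by
      rcases h.close_of_near hn hinj (hp a).1 (hp b).1 (by have := hp a; omega)
        (by have := hp b; omega) hnear with h' | h'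
      · exact hclose a b hab h'
      · exact hext a b hab h'.1 h'.2.1 h'.2.2) hlist
  refine hM.exists_goodColoring_of_seg h3 h hc' fun l j hl hj hlj => ?_
  obtain ⟨a, ha⟩ := hS l j hl hj hlj
  exact Finset.mem_image.2 ⟨a, Finset.mem_univ _, by rw [ha]⟩

/-- A perfect matching with two cycle edges at distance one or two on a shortest cycle. -/
lemma Frame.exists_perfectIn (h : Frame G n v u) (hn : 4 ≤ n) (h3 : ∀ x, G.degree x = 3)
    (hG : Reduced G) : ∃ M v u, PerfectIn G M ∧ Frame G n v u ∧ M.Adj (v 1) (v 2) ∧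
      (M.Adj (v 3) (v 4) ∨ M.Adj (v 4) (v 5) ∧ M.Adj (v 3) (u 3)) := by
  obtain ⟨M, hle, hu, hc, hF⟩ := hG.exists_matching {seg v u 0 2, seg v u 0 4}
    ((Finset.card_insert_le _ _).trans (by simp)) (Or.inr h3)
  have hM : PerfectIn G M := ⟨hle, hu, fun x => hc x (h3 x)⟩
  have hsp : ∀ i, seg v u 0 i ∈ ({seg v u 0 2, seg v u 0 4} : Finset (Sym2 V)) →
      0 < i → M.Adj (v i) (v (i - 1)) ∨ M.Adj (v i) (v (i + 1)) := by
    intro i hi hpos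
    obtain ⟨y, hy⟩ := hM.cover (v i)
    rcases (h.adj_iff_of_pos hpos y).1 (hle hy) with rfl | rfl | rfl
    · exact Or.inl hy
    · exact Or.inr hy
    · exact absurd hi (hF _ _ hy)
  rcases hsp 2 (by simp) (by omega) with h1 | h1 <;> rcases hsp 4 (by simp) (by omega) with h2 | h2
  · exact ⟨M, v, u, hM, h, h1.symm, Or.inl h2.symm⟩
  · refine ⟨M, v, u, hM, h, h1.symm, Or.inr ⟨h2, ?_⟩⟩
    obtain ⟨y, hy⟩ := hM.cover (v 3)
    rcases (h.adj_iff 2 y).1 (hle hy) with rfl | rfl | rfl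
    · exact absurd (hu _ _ _ h1 hy.symm) (h.cyc.ne 1 3 (by omega) (by omega))
    · exact absurd (hu _ _ _ h2 hy.symm) (h.cyc.ne 3 5 (by omega) (by omega)).symm
    · exact hy
  · exact absurd (hu _ _ _ h1.symm h2.symm) (h.cyc.ne 2 4 (by omega) (by omega))
  · exact ⟨M, _, _, hM, h.shift 1, h1, Or.inl h2⟩

end Matchings

section ShortCycles

open Classical

variable {V : Type} [Fintype V] {G M : SimpleGraph V} {n : ℕ} {v u : ℕ → V}

lemma Frame.exists_goodColoring_of_triangle (h : Frame G 3 v u) (h3 : ∀ x, G.degree x = 3)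
    (hG : Reduced G) : ∃ c, GoodColoring G c := by
  obtain ⟨M, hle, hu, hc, hF⟩ := hG.exists_matching {s(v 2, v 1), s(v 2, v 3)}
    ((Finset.card_insert_le _ _).trans (by simp)) (Or.inr h3)
  have hM : PerfectIn G M := ⟨hle, hu, fun x => hc x (h3 x)⟩
  have h1 : M.Adj (v 2) (u 2) := by
    obtain ⟨y, hy⟩ := hM.cover (v 2)
    rcases (h.adj_iff 1 y).1 (hle hy) with rfl | rfl | rfl
    · exact absurd (by simp) (hF _ _ hy)
    · exact absurd (by simp) (hF _ _ hy)
    · exact hy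
  have e0 : v 0 = v 3 := (h.cyc.periodic 0).symm
  have e4 : v 4 = v 1 := h.cyc.periodic 1
  have a1 : ∀ z, G.Adj (v 1) z → z = v 2 ∨ z ∈ [v 3, u 2, u 1] := by
    intro z hz
    rcases (h.adj_iff 0 z).1 hz with rfl | rfl | rfl <;> simp [e0]
  have a2 : ∀ z, G.Adj (v 2) z ↔ z = v 1 ∨ z = v 3 ∨ z = u 2 := h.adj_iff 1
  have a3 : ∀ z, G.Adj (v 3) z → z = v 2 ∨ z ∈ [v 1, u 2, u 3] := by
    intro z hz
    rcases (h.adj_iff 2 z).1 hz with rfl | rfl | rfl <;> simp [e4]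
  obtain ⟨f, hf0, hf⟩ := hG.exists_descent (Z := {v 2}) ⟨v 2, rfl⟩
  have hl : ∀ {x y : V} {l : List V}, (∀ t ∈ nbrs G x y, t ∈ l) → (nbrs G x y).card ≤ l.length :=
    fun {x y l} hl => (Finset.card_le_card fun t ht => List.mem_toFinset.2 (hl t ht)).trans
      l.toFinset_card_le
  obtain ⟨c, hc⟩ := exists_properOn_of_descent hG (A := rest G M) (fun e he => edge_of_mem_rest he)
    (hM.card_inc_le h3 subset_rfl) hf fun x y hxy hx => by
      obtain rfl : x = v 2 := (hf0 x).1 hx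
      obtain ⟨ha, hm⟩ := mem_rest.1 hxy
      rcases (a2 y).1 ha with rfl | rfl | rfl
      · exact hl (mem_of_mem_nbrs (l := [v 3, u 2, u 1])
          (fun z hz => by rcases (a2 z).1 hz with h | h | h <;> simp [h]) a1)
      · exact hl (mem_of_mem_nbrs (l := [v 1, u 2, u 3])
          (fun z hz => by rcases (a2 z).1 hz with h | h | h <;> simp [h]) a3)
      · exact absurd h1 hm
  exact hM.exists_goodColoring h3 hc

omit [Fintype V] in
lemma PerfectIn.not_spoke (hM : PerfectIn G M) (h : Frame G n v u) (hn : 4 ≤ n) {i j : ℕ}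
    (hij : M.Adj (v i) (v j)) : ¬ M.Adj (v i) (u i) := fun h' =>
  h.u_ne_v hn i j (hM.unique _ _ _ h' hij)

omit [Fintype V] in
lemma PerfectIn.spoke_of_not (hM : PerfectIn G M) (h : Frame G n v u) {i : ℕ}
    (h1 : ¬ M.Adj (v i) (v (i + 1))) (h2 : ¬ M.Adj (v (i + 1)) (v (i + 2))) :
    M.Adj (v (i + 1)) (u (i + 1)) := by
  obtain ⟨y, hy⟩ := hM.cover (v (i + 1))
  rcases (h.adj_iff i y).1 (hM.le hy) with rfl | rfl | rfl
  · exact absurd hy.symm h1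
  · exact absurd hy h2
  · exact hy

omit [Fintype V] in
lemma PerfectIn.not_adj_of_ne (hM : PerfectIn G M) {x y z : V} (h : M.Adj x y) (hz : y ≠ z) :
    ¬ M.Adj x z := fun h' => hz (hM.unique _ _ _ h h')

/-- Pairs of uncoloured edges at a five-cycle that may be near each other unless the cycle has
additional adjacencies between its outer neighbours. -/
def pentagonPairs : List (Fin 7 × Fin 7) :=
  [(0, 1), (0, 2), (0, 3), (0, 4), (0, 5), (0, 6), (1, 2), (1, 3), (1, 5), (1, 6), (2, 3), (2, 4),
    (2, 6), (3, 4), (4, 5), (5, 6)]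

/-- Kinds and positions of the uncoloured edges at a five-cycle. -/
def pentagonSeg : Fin 7 → ℕ × ℕ := ![(1, 2), (1, 4), (1, 0), (0, 1), (0, 2), (0, 3), (0, 4)]

lemma pentagonPairs_of_close : ∀ a b : Fin 7, a ≠ b → Close 5 (pentagonSeg a) (pentagonSeg b) →
    (a, b) ∈ pentagonPairs ∨ (b, a) ∈ pentagonPairs := by decide

lemma pentagonPairs_of_spokes : ∀ a b : Fin 7, a ≠ b → (pentagonSeg a).1 = 0 →
    (pentagonSeg b).1 = 0 → (a, b) ∈ pentagonPairs ∨ (b, a) ∈ pentagonPairs ∨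
      (a, b) ∈ [(3, 5), (4, 6), (3, 6)] ∨ (b, a) ∈ [(3, 5), (4, 6), (3, 6)] := by decide

lemma PerfectIn.exists_goodColoring_of_pentagon (hM : PerfectIn G M) (h : Frame G 5 v u)
    (h3 : ∀ x, G.degree x = 3) (hG : Reduced G) (h12 : M.Adj (v 1) (v 2))
    (h34 : M.Adj (v 3) (v 4)) : ∃ c, GoodColoring G c := by
  have hne : ∀ {i j}, i < j → j < i + 5 → v i ≠ v j := fun hij hj => h.cyc.ne _ _ hij hj
  have h0 : M.Adj (v 0) (u 0) := by
    have h5 : M.Adj (v 5) (u 5) := hM.spoke_of_not h (i := 4)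
      (hM.not_adj_of_ne h34.symm (hne (by omega) (by omega))) fun h' => by
        rw [show v (4 + 1) = v 0 from h.cyc.periodic 0, show v (4 + 2) = v 1 from h.cyc.periodic 1]
          at h'
        exact hne (i := 0) (j := 2) (by omega) (by omega) (hM.unique _ _ _ h'.symm h12)
    rwa [show v 5 = v 0 from h.cyc.periodic 0, show u 5 = u 0 from h.periodic 0] at h5
  have s1 := hM.not_spoke h (by omega) h12
  have s2 := hM.not_spoke h (by omega) h12.symm
  have s3 := hM.not_spoke h (by omega) h34
  have s4 := hM.not_spoke h (by omega) h34.symm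
  have i0 := hM.card_inc_le h3 (base_subset (v := v)) (u 0)
  have i1 := hM.card_inc_base_u h3 h s1
  have i2 := hM.card_inc_base_u h3 h s2
  have i3 := hM.card_inc_base_u h3 h s3
  have i4 := hM.card_inc_base_u h3 h s4
  have z2 := h.card_conf_cycle_edge (M := M) 2
  have z4 := h.card_conf_cycle_edge (M := M) 4
  rw [show u (4 + 1) = u 0 from h.periodic 0] at z4
  have z0 := h.card_conf_cycle_edge (M := M) 0
  have q1 := hM.card_conf_spoke_le h3 h 1
  have q2 := hM.card_conf_spoke_le h3 h 2
  have q3 := hM.card_conf_spoke_le h3 h 3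
  have q4 := hM.card_conf_spoke_le h3 h 4
  have huv : ∀ i j, u i ≠ v j := h.u_ne_v (by omega)
  simp only [Nat.reduceAdd] at z2 z0
  have key : ∀ (x : List (Fin 7 × Fin 7)) (d₁ d₂ d₃ d₄ : ℕ),
      edgeCoeff (pentagonPairs ++ x) ![4, 3, 3, d₁, d₂, d₃, d₄] ≠ 0 →
      (G.Adj (u 1) (u 3) → (3, 5) ∈ x) → (G.Adj (u 2) (u 4) → (4, 6) ∈ x) →
      (G.Adj (u 1) (u 4) → (3, 6) ∈ x) →
      (conf G (base G M v) (seg v u 0 1)).card + d₁ ≤ 6 →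
      (conf G (base G M v) (seg v u 0 2)).card + d₂ ≤ 6 →
      (conf G (base G M v) (seg v u 0 3)).card + d₃ ≤ 6 →
      (conf G (base G M v) (seg v u 0 4)).card + d₄ ≤ 6 → ∃ c, GoodColoring G c := by
    intro x d₁ d₂ d₃ d₄ hd x13 x24 x14 h₁ h₂ h₃ h₄
    refine hM.exists_goodColoring_of_edgeCoeff h3 hG h (by omega)
      (fun i j hij hj => h.u_ne le_rfl hij hj) pentagonSeg (by decide) (by decide) ?_ _ _ hd
      (fun a b hab hc => ?_) ?_ ?_
    · intro l j hl hj hlj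
      interval_cases l <;> interval_cases j
      · exact absurd h0 (mem_rest.1 hlj).2
      · exact ⟨3, rfl⟩
      · exact ⟨4, rfl⟩
      · exact ⟨5, rfl⟩
      · exact ⟨6, rfl⟩
      · exact ⟨2, rfl⟩
      · exact absurd h12 (mem_rest.1 hlj).2
      · exact ⟨0, rfl⟩
      · exact absurd h34 (mem_rest.1 hlj).2
      · exact ⟨1, rfl⟩
    · exact (pentagonPairs_of_close a b hab hc).imp (List.mem_append_left _)
        (List.mem_append_left _)
    · intro a b hab ha hb hadj
      have hx : ∀ a b, (a, b) ∈ [((3 : Fin 7), (5 : Fin 7)), (4, 6), (3, 6)] →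
          G.Adj (u (pentagonSeg a).2) (u (pentagonSeg b).2) → (a, b) ∈ x := by
        intro a b hm
        simp only [List.mem_cons, Prod.mk.injEq, List.not_mem_nil, or_false] at hm
        rcases hm with ⟨rfl, rfl⟩ | ⟨rfl, rfl⟩ | ⟨rfl, rfl⟩
        · exact x13
        · exact x24
        · exact x14
      rcases pentagonPairs_of_spokes a b hab ha hb with hm | hm | hm | hm
      · exact Or.inl (List.mem_append_left _ hm)
      · exact Or.inr (List.mem_append_left _ hm)
      · exact Or.inl (List.mem_append_right _ (hx _ _ hm hadj))
      · exact Or.inr (List.mem_append_right _ (hx _ _ hm hadj.symm))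
    · intro a
      fin_cases a
      · change (conf G (base G M v) (seg v u 1 2)).card + 4 ≤ 6
        omega
      · change (conf G (base G M v) (seg v u 1 4)).card + 3 ≤ 6
        omega
      · change (conf G (base G M v) (seg v u 1 0)).card + 3 ≤ 6
        omega
      · exact h₁
      · exact h₂
      · exact h₃
      · exact h₄
  have r13 := fun a => hM.card_conf_spoke_le_three h3 h (i := 1) (j := 3) a (huv _ _) s3
  have r14 := fun a => hM.card_conf_spoke_le_three h3 h (i := 1) (j := 4) a (huv _ _) s4
  have r1 := fun a b => hM.card_conf_spoke_le_two h3 h (i := 1) (j := 3) (k := 4) a (huv _ _) s3 b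
    (huv _ _) (h.u_ne le_rfl (by omega) (by omega)) s4
  have r24 := fun a => hM.card_conf_spoke_le_three h3 h (i := 2) (j := 4) a (huv _ _) s4
  have r31 := fun a => hM.card_conf_spoke_le_three h3 h (i := 3) (j := 1) a (huv _ _) s1
  by_cases a13 : G.Adj (u 1) (u 3) <;> by_cases a24 : G.Adj (u 2) (u 4) <;>
    by_cases a14 : G.Adj (u 1) (u 4)
  · have := r13 a13
    have := r24 a24
    have := r31 a13.symm
    exact key [(3, 5), (4, 6), (3, 6)] 3 3 3 0 (by decide +kernel)
      (by simp) (by simp) (by simp)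
      (by omega) (by omega) (by omega) (by omega)
  · have := r24 a24
    have := r31 a13.symm
    exact key [(3, 5), (4, 6)] 2 3 3 0 (by decide +kernel)
      (by simp) (by simp) (absurd · a14)
      (by omega) (by omega) (by omega) (by omega)
  · have := r13 a13
    have := r31 a13.symm
    exact key [(3, 5), (3, 6)] 3 2 3 0 (by decide +kernel)
      (by simp) (absurd · a24) (by simp)
      (by omega) (by omega) (by omega) (by omega)
  · have := r31 a13.symm
    exact key [(3, 5)] 2 2 3 0 (by decide +kernel)
      (by simp) (absurd · a24) (absurd · a14)
      (by omega) (by omega) (by omega) (by omega)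
  · have := r24 a24
    exact key [(4, 6), (3, 6)] 2 3 2 1 (by decide +kernel)
      (absurd · a13) (by simp) (by simp)
      (by omega) (by omega) (by omega) (by omega)
  · have := r24 a24
    exact key [(4, 6)] 1 3 2 1 (by decide +kernel)
      (absurd · a13) (by simp) (absurd · a14)
      (by omega) (by omega) (by omega) (by omega)
  · exact key [(3, 6)] 2 2 2 1 (by decide +kernel)
      (absurd · a13) (absurd · a24) (by simp)
      (by omega) (by omega) (by omega) (by omega)
  · exact key [] 1 2 2 1 (by decide +kernel)
      (absurd · a13) (absurd · a24) (absurd · a14)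
      (by omega) (by omega) (by omega) (by omega)

lemma Frame.exists_goodColoring_of_five (h : Frame G 5 v u) (h3 : ∀ x, G.degree x = 3)
    (hG : Reduced G) : ∃ c, GoodColoring G c := by
  obtain ⟨M, v, u, hM, h, h12, h34 | ⟨h45, -⟩⟩ := h.exists_perfectIn (by omega) h3 hG
  · exact hM.exists_goodColoring_of_pentagon h h3 hG h12 h34
  · refine hM.exists_goodColoring_of_pentagon (h.shift 3) h3 hG h45 ?_
    change M.Adj (v 6) (v 7)
    rwa [show v 6 = v 1 from h.cyc.periodic 1, show v 7 = v 2 from h.cyc.periodic 2]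

/-- Kinds and positions of the uncoloured edges at a seven-cycle. -/
def heptagonSeg : Fin 9 → ℕ × ℕ :=
  ![(1, 2), (1, 3), (1, 5), (1, 6), (1, 0), (0, 1), (0, 2), (0, 4), (0, 5)]

/-- Pairs of uncoloured edges at a seven-cycle that may be near each other. -/
def heptagonPairs : List (Fin 9 × Fin 9) :=
  [(0, 1), (0, 4), (0, 5), (0, 6), (0, 7), (1, 2), (1, 6), (1, 7), (1, 8), (2, 3), (2, 4), (2, 7),
    (2, 8), (3, 4), (3, 5), (3, 8), (4, 5), (4, 6), (5, 6), (7, 8)]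

lemma heptagonPairs_of_close : ∀ a b : Fin 9, a ≠ b → Close 7 (heptagonSeg a) (heptagonSeg b) →
    (a, b) ∈ heptagonPairs ∨ (b, a) ∈ heptagonPairs := by decide

lemma edgeCoeff_heptagonPairs : edgeCoeff heptagonPairs ![3, 3, 3, 2, 2, 2, 2, 2, 1] ≠ 0 := by
  decide +kernel

lemma PerfectIn.exists_goodColoring_of_heptagon (hM : PerfectIn G M) (h : Frame G 7 v u)
    (h3 : ∀ x, G.degree x = 3) (hG : Reduced G) (h12 : M.Adj (v 1) (v 2))
    (h45 : M.Adj (v 4) (v 5)) (hs3 : M.Adj (v 3) (u 3)) (h67 : ¬ M.Adj (v 6) (v 7)) :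
    ∃ c, GoodColoring G c := by
  have hne : ∀ {i j}, i < j → j < i + 7 → v i ≠ v j := fun hij hj => h.cyc.ne _ _ hij hj
  have e7 : v 7 = v 0 := h.cyc.periodic 0
  have e8 : v 8 = v 1 := h.cyc.periodic 1
  have hs6 : M.Adj (v 6) (u 6) := hM.spoke_of_not h (i := 5)
    (hM.not_adj_of_ne h45.symm (hne (by omega) (by omega))) h67
  have hs0 : M.Adj (v 0) (u 0) := by
    have h7 : M.Adj (v 7) (u 7) := hM.spoke_of_not h (i := 6) h67 fun h' => by
      change M.Adj (v 7) (v 8) at h'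
      rw [e8] at h'
      exact hne (i := 2) (j := 7) (by omega) (by omega) (hM.unique _ _ _ h12 h'.symm)
    rwa [e7, show u 7 = u 0 from h.periodic 0] at h7
  have s1 := hM.card_inc_base_u h3 h (hM.not_spoke h (by omega) h12)
  have s2 := hM.card_inc_base_u h3 h (hM.not_spoke h (by omega) h12.symm)
  have s4 := hM.card_inc_base_u h3 h (hM.not_spoke h (by omega) h45)
  have s5 := hM.card_inc_base_u h3 h (hM.not_spoke h (by omega) h45.symm)
  have hi := hM.card_inc_le h3 (base_subset (v := v))
  have s0 := hi (u 0)
  have s3 := hi (u 3)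
  have s6 := hi (u 6)
  have hq := hM.card_conf_spoke_le h3 h
  have z0 := h.card_conf_cycle_edge (M := M) 0
  have z2 := h.card_conf_cycle_edge (M := M) 2
  have z3 := h.card_conf_cycle_edge (M := M) 3
  have z5 := h.card_conf_cycle_edge (M := M) 5
  have z6 := h.card_conf_cycle_edge (M := M) 6
  simp only [Nat.reduceAdd] at z0 z2 z3 z5 z6
  rw [show u 7 = u 0 from h.periodic 0] at z6
  refine hM.exists_goodColoring_of_edgeCoeff h3 hG h (by omega)
    (fun i j hij hj => h.u_ne (by omega) hij hj) heptagonSeg (by decide) (by decide) ?_ _ _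
    edgeCoeff_heptagonPairs heptagonPairs_of_close ?_ ?_
  · intro l j hl hj hlj
    interval_cases l <;> interval_cases j
    · exact absurd hs0 (mem_rest.1 hlj).2
    · exact ⟨5, rfl⟩
    · exact ⟨6, rfl⟩
    · exact absurd hs3 (mem_rest.1 hlj).2
    · exact ⟨7, rfl⟩
    · exact ⟨8, rfl⟩
    · exact absurd hs6 (mem_rest.1 hlj).2
    · exact ⟨4, rfl⟩
    · exact absurd h12 (mem_rest.1 hlj).2
    · exact ⟨0, rfl⟩
    · exact ⟨1, rfl⟩
    · exact absurd h45 (mem_rest.1 hlj).2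
    · exact ⟨2, rfl⟩
    · exact ⟨3, rfl⟩
  · intro a b hab ha hb hadj
    exfalso
    have hlt : ∀ a, (heptagonSeg a).2 < 7 := by decide
    rcases lt_trichotomy (heptagonSeg a).2 (heptagonSeg b).2 with hlt' | heq | hlt'
    · exact h.not_adj_u le_rfl hlt' ((hlt b).trans_le (by omega)) hadj
    · exact hadj.ne (congrArg u heq)
    · exact h.not_adj_u le_rfl hlt' ((hlt a).trans_le (by omega)) hadj.symm
  · intro a
    fin_cases a
    · change (conf G (base G M v) (seg v u 1 2)).card + 3 ≤ 6
      omega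
    · change (conf G (base G M v) (seg v u 1 3)).card + 3 ≤ 6
      omega
    · change (conf G (base G M v) (seg v u 1 5)).card + 3 ≤ 6
      omega
    · change (conf G (base G M v) (seg v u 1 6)).card + 2 ≤ 6
      omega
    · change (conf G (base G M v) (seg v u 1 0)).card + 2 ≤ 6
      omega
    · exact Nat.add_le_add_right (hq 1) 2
    · exact Nat.add_le_add_right (hq 2) 2
    · exact Nat.add_le_add_right (hq 4) 2
    · exact (Nat.add_le_add_right (hq 5) 1).trans (by omega)

end ShortCycles

section Deletion

open Classical

variable {V : Type} {G : SimpleGraph V} {n : ℕ} {v u : ℕ → V} {c : Sym2 V → Fin 8}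

/-- The edges of `G` that do not meet the cycle. -/
def offCycle (G : SimpleGraph V) (v : ℕ → V) : SimpleGraph V where
  Adj x y := G.Adj x y ∧ ∀ i, v i ≠ x ∧ v i ≠ y
  symm := ⟨fun _ _ h => ⟨h.1.symm, fun i => (h.2 i).symm⟩⟩
  loopless := ⟨fun x h => G.loopless.irrefl x h.1⟩

lemma offCycle_le : offCycle G v ≤ G := fun _ _ h => h.1

lemma Frame.offCycle_lt (h : Frame G n v u) : offCycle G v < G :=
  lt_of_le_of_ne offCycle_le fun he => by
    have h1 := h.adj_spoke 0
    rw [← he] at h1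
    exact (h1.2 0).1 rfl

lemma Frame.u_congr (h : Frame G n v u) (hn : 4 ≤ n) {i j : ℕ} (hij : v i = v j) : u i = u j := by
  have hi := h.adj_spoke i
  obtain ⟨p, hp⟩ := h.exists_pred j
  rw [hij] at hi
  rcases (hp _).1 hi with h' | h' | h'
  · exact absurd h' (h.u_ne_v hn _ _)
  · exact absurd h' (h.u_ne_v hn _ _)
  · exact h'

lemma Frame.v_congr (h : Frame G n v u) (hn : 4 ≤ n)
    (hinj : ∀ i j, i < j → j < i + n → u i ≠ u j) {i j : ℕ} (hij : u i = u j) : v i = v j := by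
  obtain ⟨k, hk, hkj⟩ := h.cyc.exists_lt i j
  rcases Nat.eq_zero_or_pos k with rfl | h0
  · exact hkj
  · exact absurd (hij.trans (h.u_congr hn hkj).symm) (hinj i (i + k) (by omega) (by omega))

variable [Fintype V]

lemma offCycle_properOn (hc : GoodColoring (offCycle G v) c) :
    ProperOn G (nonzero (offCycle G v) c) c :=
  hc.properOn fun _ _ _ _ h1 h2 h3 => ⟨h3, fun i => ⟨(h1.2 i).1, (h2.2 i).1⟩⟩

lemma edge_of_mem_nonzero {e : Sym2 V} (he : e ∈ nonzero (offCycle G v) c) : e ∈ G.edgeSet :=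
  SimpleGraph.edgeSet_mono offCycle_le (mem_nonzero.1 he).1

lemma inc_nonzero_v (i : ℕ) : inc (nonzero (offCycle G v) c) (v i) = ∅ := by
  rw [Finset.eq_empty_iff_forall_notMem]
  intro e he
  obtain ⟨h1, h2⟩ := mem_inc.1 he
  obtain ⟨z, rfl⟩ := Sym2.mem_iff_exists.1 h2
  exact ((mem_nonzero.1 h1).1.2 i).1 rfl

lemma Frame.card_inc_nonzero_u (h : Frame G n v u) (h3 : ∀ x, G.degree x = 3) (i : ℕ) :
    (inc (nonzero (offCycle G v) c) (u i)).card ≤ 2 := by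
  have := card_inc_add_le (A := nonzero (offCycle G v) c) (fun e he => edge_of_mem_nonzero he) {v i}
    (t := u i) (by
      simp only [Finset.mem_singleton, forall_eq]
      exact ⟨(h.adj_spoke i).symm, fun h => ((mem_nonzero.1 h).1.2 i).2 rfl⟩)
  rw [Finset.card_singleton, h3] at this
  omega

lemma Frame.offCycle_ne_zero (h : Frame G n v u) (h3 : ∀ x, G.degree x = 3)
    (hc : GoodColoring (offCycle G v) c) {i : ℕ} {x : V} (hx : (offCycle G v).Adj (u i) x) :
    c s(u i, x) ≠ 0 := by
  intro h0
  have h1 := hc.degree_eq hx h0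
  have h2 : (offCycle G v).neighborFinset (u i) ⊆ (G.neighborFinset (u i)).erase (v i) := by
    intro z hz
    rw [SimpleGraph.mem_neighborFinset] at hz
    exact Finset.mem_erase.2 ⟨fun he => (hz.2 i).2 he.symm, by simpa using hz.1⟩
  have h3' := Finset.card_le_card h2
  rw [Finset.card_erase_of_mem (by simpa using (h.adj_spoke i).symm),
    SimpleGraph.card_neighborFinset_eq_degree, SimpleGraph.card_neighborFinset_eq_degree, h3, h1]
    at h3'
  omega

/-- Give the spokes of a cycle colour zero. -/
lemma Frame.exists_goodColoring_of_offCycle (h : Frame G n v u) (hn : 4 ≤ n)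
    (h3 : ∀ x, G.degree x = 3) (hinj : ∀ i j, i < j → j < i + n → u i ≠ u j)
    (hc : GoodColoring (offCycle G v) c) {S : Finset (Sym2 V)} {c' : Sym2 V → Fin 8}
    (hc' : ProperOn G (nonzero (offCycle G v) c ∪ S) c') (hS : ∀ i < n, seg v u 1 i ∈ S) :
    ∃ c, GoodColoring G c := by
  have key : ∀ x y, G.Adj x y → s(x, y) ∉ nonzero (offCycle G v) c ∪ S →
      (∃ i, x = v i ∧ y = u i) ∨ (∃ i, y = v i ∧ x = u i) ∨
        (offCycle G v).Adj x y ∧ c s(x, y) = 0 := by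
    intro x y hxy hS'
    rw [Finset.mem_union, not_or, mem_nonzero, not_and, not_not] at hS'
    by_cases ho : (offCycle G v).Adj x y
    · exact Or.inr (Or.inr ⟨ho, hS'.1 ho⟩)
    · have : ∃ i, v i ∈ s(x, y) := by
        by_contra hcon
        push Not at hcon
        refine ho ⟨hxy, fun i => ?_⟩
        have := hcon i
        rwa [Sym2.mem_iff, not_or] at this
      obtain ⟨i, hi⟩ := this
      obtain ⟨l, j, hl, hj, he⟩ := h.exists_seg hxy hi
      obtain rfl | rfl : l = 0 ∨ l = 1 := by omega
      · rw [seg_zero] at he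
        rcases Sym2.eq_iff.1 he with he | he
        · exact Or.inl ⟨j, he⟩
        · exact Or.inr (Or.inl ⟨j, he.2, he.1⟩)
      · exact absurd (hS j hj) (he ▸ hS'.2)
  refine goodColoring_of_properOn (fun x y z hxy hxz h1 h2 => ?_) (fun x _ _ _ => h3 x) hc'
  rcases key x y hxy h1 with ⟨i, rfl, rfl⟩ | ⟨i, rfl, rfl⟩ | ⟨ha, h0⟩ <;>
    rcases key _ z hxz h2 with ⟨j, hj, rfl⟩ | ⟨j, rfl, hj⟩ | ⟨hb, h0'⟩
  · exact h.u_congr hn hj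
  · exact absurd hj.symm (h.u_ne_v hn _ _)
  · exact absurd rfl (hb.2 i).1
  · exact absurd hj (h.u_ne_v hn _ _)
  · exact h.v_congr hn hinj hj
  · exact absurd h0' (h.offCycle_ne_zero h3 hc hb)
  · exact absurd hj.symm (ha.2 j).1
  · subst hj
    exact absurd h0 (h.offCycle_ne_zero h3 hc ha)
  · exact hc.eq_of_zero ha hb h0 h0'

lemma Frame.exists_goodColoring_of_hexagon (h : Frame G 6 v u) (h3 : ∀ x, G.degree x = 3)
    (ih : ∀ H < G, ∃ c, GoodColoring H c) : ∃ c, GoodColoring G c := by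
  obtain ⟨c, hc⟩ := ih _ h.offCycle_lt
  obtain ⟨c', hc'⟩ := (offCycle_properOn hc).extend (e := fun a : Fin 6 => seg v u 1 a)
    (fun a b hab => Fin.ext (h.seg_inj (by omega) le_rfl le_rfl a.2 b.2 hab).2)
    [(0, 1), (1, 2), (2, 3), (3, 4), (4, 5), (5, 0), (0, 2), (1, 3), (2, 4), (3, 5), (4, 0), (5, 1)]
    (fun _ => 2) (by decide +kernel) (fun a b hab hnear => by
      rcases h.close_of_near (by omega) (fun i j hij hj => h.u_ne (by omega) hij hj)
        (p := (1, (a : ℕ))) (q := (1, (b : ℕ))) le_rfl le_rfl (by simp)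
        (by simp) hnear with hcl | hcl
      · clear hnear
        revert a b
        decide
      · exact absurd hcl.1 (by simp)) (fun a => by
      have h1 := h.card_conf_cycle_edge_le (A := nonzero (offCycle G v) c)
        (fun e he => edge_of_mem_nonzero he) inc_nonzero_v a
      have h2 := h.card_inc_nonzero_u (c := c) h3 a
      have h3 := h.card_inc_nonzero_u (c := c) h3 (a + 1)
      omega)
  exact h.exists_goodColoring_of_offCycle (by omega) h3 (fun i j hij hj => h.u_ne (by omega) hij hj)
    hc hc' fun i hi => Finset.mem_image.2 ⟨⟨i, hi⟩, Finset.mem_univ _, rfl⟩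

end Deletion

section Square

open Classical

variable {V : Type} [Fintype V] {G M : SimpleGraph V} {v u : ℕ → V}

omit [Fintype V] in
lemma Frame.u_ne_of_square (h : Frame G 4 v u) (h02 : u 0 ≠ u 2) (h13 : u 1 ≠ u 3) (i j : ℕ)
    (hij : i < j) (hj : j < i + 4) : u i ≠ u j := by
  intro he
  obtain ⟨h1, h2⟩ := h.u_eq_bounds le_rfl hij hj he
  obtain rfl : j = i + 2 := by omega
  have hp : ∀ k i, u (i + 4 * k) = u i := by
    intro k
    induction k with
    | zero => simp
    | succ k ih => exact fun i => (h.periodic _).trans (ih i)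
  have hm : ∀ i, u i = u (i % 4) := fun i => by
    rw [← hp (i / 4) (i % 4), Nat.mod_add_div]
  rw [hm i, hm (i + 2)] at he
  obtain hi | hi | hi | hi : i % 4 = 0 ∨ i % 4 = 1 ∨ i % 4 = 2 ∨ i % 4 = 3 := by omega
  · rw [hi, show (i + 2) % 4 = 2 by omega] at he
    exact h02 he
  · rw [hi, show (i + 2) % 4 = 3 by omega] at he
    exact h13 he
  · rw [hi, show (i + 2) % 4 = 0 by omega] at he
    exact h02 he.symm
  · rw [hi, show (i + 2) % 4 = 1 by omega] at he
    exact h13 he.symm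

/-- Kinds and positions of the uncoloured edges at a four-cycle. -/
def squareSeg : Fin 6 → ℕ × ℕ := ![(1, 2), (1, 0), (0, 0), (0, 1), (0, 2), (0, 3)]

/-- Pairs of uncoloured edges at a four-cycle that may be near each other. -/
def squarePairs : List (Fin 6 × Fin 6) :=
  [(0, 1), (0, 2), (0, 3), (0, 4), (0, 5), (1, 2), (1, 3), (1, 4), (1, 5), (2, 3), (3, 4), (4, 5),
    (2, 5)]

lemma squarePairs_of_close : ∀ a b : Fin 6, a ≠ b → Close 4 (squareSeg a) (squareSeg b) →
    (a, b) ∈ squarePairs ∨ (b, a) ∈ squarePairs := by decide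

lemma squarePairs_of_spokes : ∀ a b : Fin 6, a ≠ b → (squareSeg a).1 = 0 → (squareSeg b).1 = 0 →
    (a, b) ∈ squarePairs ∨ (b, a) ∈ squarePairs ∨
      (a, b) ∈ [(2, 4), (3, 5)] ∨ (b, a) ∈ [(2, 4), (3, 5)] := by decide

lemma PerfectIn.exists_goodColoring_of_square (hM : PerfectIn G M) (h : Frame G 4 v u)
    (h3 : ∀ x, G.degree x = 3) (hG : Reduced G) (h12 : M.Adj (v 1) (v 2))
    (h34 : M.Adj (v 3) (v 4)) (h02 : u 0 ≠ u 2) (h13 : u 1 ≠ u 3) (a02 : ¬ G.Adj (u 0) (u 2))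
    (a13 : ¬ G.Adj (u 1) (u 3)) : ∃ c, GoodColoring G c := by
  rw [show v 4 = v 0 from h.cyc.periodic 0] at h34
  have i0 := hM.card_inc_base_u h3 h (hM.not_spoke h le_rfl h34.symm)
  have i1 := hM.card_inc_base_u h3 h (hM.not_spoke h le_rfl h12)
  have i2 := hM.card_inc_base_u h3 h (hM.not_spoke h le_rfl h12.symm)
  have i3 := hM.card_inc_base_u h3 h (hM.not_spoke h le_rfl h34)
  have hq := hM.card_conf_spoke_le h3 h
  have z0 := h.card_conf_cycle_edge (M := M) 0
  have z2 := h.card_conf_cycle_edge (M := M) 2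
  simp only [Nat.reduceAdd] at z0 z2
  refine hM.exists_goodColoring_of_edgeCoeff h3 hG h le_rfl (h.u_ne_of_square h02 h13) squareSeg
    (by decide) (by decide) ?_ squarePairs ![4, 3, 2, 1, 2, 1] (by decide +kernel)
    squarePairs_of_close ?_ ?_
  · intro l j hl hj hlj
    interval_cases l <;> interval_cases j
    · exact ⟨2, rfl⟩
    · exact ⟨3, rfl⟩
    · exact ⟨4, rfl⟩
    · exact ⟨5, rfl⟩
    · exact ⟨1, rfl⟩
    · exact absurd h12 (mem_rest.1 hlj).2
    · exact ⟨0, rfl⟩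
    · rw [seg_one, show v (3 + 1) = v 0 from h.cyc.periodic 0] at hlj
      exact absurd h34 (mem_rest.1 hlj).2
  · intro a b hab ha hb hadj
    have hx : ∀ a b, (a, b) ∈ [((2 : Fin 6), (4 : Fin 6)), (3, 5)] →
        ¬ G.Adj (u (squareSeg a).2) (u (squareSeg b).2) := by
      intro a b hm
      simp only [List.mem_cons, Prod.mk.injEq, List.not_mem_nil, or_false] at hm
      rcases hm with ⟨rfl, rfl⟩ | ⟨rfl, rfl⟩
      · exact a02
      · exact a13
    rcases squarePairs_of_spokes a b hab ha hb with hm | hm | hm | hm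
    · exact Or.inl hm
    · exact Or.inr hm
    · exact absurd hadj (hx _ _ hm)
    · exact absurd hadj.symm (hx _ _ hm)
  · intro a
    fin_cases a
    · change (conf G (base G M v) (seg v u 1 2)).card + 4 ≤ 6
      omega
    · change (conf G (base G M v) (seg v u 1 0)).card + 3 ≤ 6
      omega
    · exact Nat.add_le_add_right (hq 0) 2
    · exact (Nat.add_le_add_right (hq 1) 1).trans (by omega)
    · exact Nat.add_le_add_right (hq 2) 2
    · exact (Nat.add_le_add_right (hq 3) 1).trans (by omega)

/-- A system of distinct representatives of four sets. -/
lemma exists_four_distinct {L : Fin 4 → Finset (Fin 8)} (hL : ∀ a, 3 ≤ (L a).card)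
    (h : 4 ≤ (L 0).card ∨ ∃ k ∈ L 1, k ∉ L 0) :
    ∃ c : Fin 4 → Fin 8, (∀ a, c a ∈ L a) ∧ Function.Injective c := by
  have pick : ∀ (S T : Finset (Fin 8)), T.card < S.card → ∃ x ∈ S, x ∉ T := fun S T h =>
    Finset.exists_mem_notMem_of_card_lt_card h
  have h1 : ∃ x ∈ L 1, 4 ≤ (L 0).card ∨ x ∉ L 0 := by
    rcases h with h | ⟨k, hk, hk'⟩
    · obtain ⟨x, hx⟩ := Finset.card_pos.1 (lt_of_lt_of_le (by omega) (hL 1))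
      exact ⟨x, hx, Or.inl h⟩
    · exact ⟨k, hk, Or.inr hk'⟩
  obtain ⟨x1, m1, h1⟩ := h1
  obtain ⟨x2, m2, n2⟩ := pick (L 2) {x1} (by
    have := hL 2
    rw [Finset.card_singleton]
    omega)
  obtain ⟨x3, m3, n3⟩ := pick (L 3) {x1, x2} (by
    have := hL 3
    have := Finset.card_insert_le x1 {x2}
    rw [Finset.card_singleton] at this
    omega)
  have h0 : ∃ x0 ∈ L 0, x0 ≠ x1 ∧ x0 ≠ x2 ∧ x0 ≠ x3 := by
    rcases h1 with h1 | h1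
    · obtain ⟨x0, m0, n0⟩ := pick (L 0) {x1, x2, x3} (lt_of_le_of_lt Finset.card_le_three h1)
      exact ⟨x0, m0, by simpa using n0⟩
    · obtain ⟨x0, m0, n0⟩ := pick (L 0) {x2, x3} (lt_of_le_of_lt Finset.card_le_two (hL 0))
      exact ⟨x0, m0, fun he => h1 (he ▸ m0), by simpa using n0⟩
  obtain ⟨x0, m0, n01, n02, n03⟩ := h0
  refine ⟨![x0, x1, x2, x3], ?_, ?_⟩
  · intro a
    fin_cases a
    exacts [m0, m1, m2, m3]
  · simp only [Finset.mem_insert, Finset.mem_singleton, not_or] at n2 n3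
    intro a b hab
    fin_cases a <;> fin_cases b <;> simp_all

lemma Frame.exists_goodColoring_of_square_adj (h : Frame G 4 v u) (h3 : ∀ x, G.degree x = 3)
    (ih : ∀ H < G, ∃ c, GoodColoring H c) (hinj : ∀ i j, i < j → j < i + 4 → u i ≠ u j)
    (a02 : G.Adj (u 0) (u 2)) : ∃ c, GoodColoring G c := by
  obtain ⟨c, hc⟩ := ih _ h.offCycle_lt
  have hP := offCycle_properOn hc
  set A := nonzero (offCycle G v) c with hA
  have hAe : ∀ e ∈ A, e ∈ G.edgeSet := fun e he => edge_of_mem_nonzero he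
  have huv := h.u_ne_v le_rfl
  obtain ⟨w, hw0, hw2, hw⟩ := exists_third_neighbour (h3 (u 0)) (h.adj_spoke 0).symm a02
    (huv 2 0).symm
  have hLcard : ∀ a, 3 ≤ (avail G A c (seg v u 1 a)).card := fun a => by
    have h1 := h.card_conf_cycle_edge_le hAe inc_nonzero_v a
    have h2 := h.card_inc_nonzero_u (c := c) h3 a
    have h3 := h.card_inc_nonzero_u (c := c) h3 (a + 1)
    have := card_avail (G := G) A c (seg v u 1 a)
    rw [← hA] at h2 h3
    omega
  have hmem : ∀ i x, G.Adj (u i) x → (∀ j, v j ≠ x) → s(u i, x) ∈ A := fun i x hx hj => by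
    have ho : (offCycle G v).Adj (u i) x := ⟨hx, fun j => ⟨(huv i j).symm, hj j⟩⟩
    exact mem_nonzero.2 ⟨ho, h.offCycle_ne_zero h3 hc ho⟩
  have hwv : ∀ j, v j ≠ w := by
    rintro j rfl
    obtain ⟨p, hp⟩ := h.exists_pred j
    rcases (hp _).1 ((hw _).2 (Or.inr (Or.inr rfl))).symm with h' | h' | h'
    · exact huv _ _ h'
    · exact huv _ _ h'
    · exact hw0 (h.v_congr le_rfl hinj h').symm
  have hwA : s(u 0, w) ∈ A := hmem 0 w ((hw _).2 (Or.inr (Or.inr rfl))) hwv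
  have hL : 4 ≤ (avail G A c (seg v u 1 0)).card ∨
      ∃ k ∈ avail G A c (seg v u 1 1), k ∉ avail G A c (seg v u 1 0) := by
    by_cases hk : c s(u 0, w) ∈ avail G A c (seg v u 1 1)
    · refine Or.inr ⟨_, hk, fun hk' => (mem_avail.1 hk').2 _ hwA (fun he => ?_) ?_ rfl⟩
      · rcases Sym2.eq_iff.1 he with he | he
        · exact huv _ _ he.1
        · exact huv _ _ he.1
      · exact ⟨v 0, by simp [seg_one], u 0, by simp, Or.inr (h.adj_spoke 0)⟩
    · left
      rw [mem_avail] at hk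
      push Not at hk
      obtain ⟨e, heA, hne, hnear, he⟩ := hk (hP _ hwA).1
      obtain ⟨t, ht, het⟩ := Finset.mem_biUnion.1
        (conf_subset hAe (mem_conf.2 ⟨heA, hne, hnear⟩))
      obtain ⟨p, hp⟩ := h.exists_pred 1
      have ht' := mem_of_mem_nbrs (x := v 1) (y := v 2) (l := [v p, u 1, v 3, u 2])
        (fun z hz => by rcases (hp z).1 hz with h | h | h <;> simp [h])
        (fun z hz => by rcases (h.adj_iff 1 z).1 hz with h | h | h <;> simp [h]) t ht
      have ht1 : t = u 1 := by
        simp only [List.mem_cons, List.not_mem_nil, or_false] at ht'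
        rcases ht' with rfl | rfl | rfl | rfl
        · rw [inc_nonzero_v] at het
          simp at het
        · rfl
        · rw [inc_nonzero_v] at het
          simp at het
        · exfalso
          refine (hP _ heA).2 _ hwA ?_ ⟨u 2, (mem_inc.1 het).2, u 0, by simp, Or.inr a02.symm⟩ he
          rintro rfl
          rcases Sym2.mem_iff.1 (mem_inc.1 het).2 with h' | h'
          · exact a02.ne h'.symm
          · exact hw2 h'.symm
      subst ht1
      have hsub : (conf G A (seg v u 1 0)).image c ⊆
          (inc A (u 0) ∪ (inc A (u 1)).erase e).image c := by
        obtain ⟨q, hq⟩ := h.exists_pred 0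
        intro k hk
        obtain ⟨f, hf, rfl⟩ := Finset.mem_image.1 hk
        obtain ⟨t, ht, hft⟩ := Finset.mem_biUnion.1 (conf_subset hAe hf)
        have ht' := mem_of_mem_nbrs (x := v 0) (y := v 1) (l := [v q, u 0, v 2, u 1])
          (fun z hz => by rcases (hq z).1 hz with h | h | h <;> simp [h])
          (fun z hz => by rcases (h.adj_iff 0 z).1 hz with h | h | h <;> simp [h]) t ht
        simp only [List.mem_cons, List.not_mem_nil, or_false] at ht'
        rcases ht' with rfl | rfl | rfl | rfl
        · rw [inc_nonzero_v] at hft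
          simp at hft
        · exact Finset.mem_image_of_mem _ (Finset.mem_union_left _ hft)
        · rw [inc_nonzero_v] at hft
          simp at hft
        · by_cases hfe : f = e
          · rw [hfe, he]
            exact Finset.mem_image_of_mem _ (Finset.mem_union_left _ (mem_inc.2 ⟨hwA, by simp⟩))
          · exact Finset.mem_image_of_mem _
              (Finset.mem_union_right _ (Finset.mem_erase.2 ⟨hfe, hft⟩))
      have hcard := (Finset.card_le_card hsub).trans
        (Finset.card_image_le.trans (Finset.card_union_le _ _))
      rw [Finset.card_erase_of_mem het] at hcard
      have h1 := h.card_inc_nonzero_u (c := c) h3 0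
      have h2 := h.card_inc_nonzero_u (c := c) h3 1
      have h4 := Finset.le_card_sdiff ((conf G A (seg v u 1 0)).image c)
        (Finset.univ.erase (0 : Fin 8))
      have h5 : (Finset.univ.erase (0 : Fin 8)).card = 7 := by decide
      rw [h5] at h4
      rw [← hA] at h1 h2
      rw [avail]
      omega
  obtain ⟨d, hd, hdi⟩ := exists_four_distinct (L := fun a => avail G A c (seg v u 1 a))
    (fun a => hLcard a) hL
  have hsi : ∀ a b : Fin 4, seg v u 1 a = seg v u 1 b → a = b := fun a b hab =>
    Fin.ext (h.seg_inj le_rfl le_rfl le_rfl a.2 b.2 hab).2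
  have hinv : ∀ a : Fin 4,
      d (Function.invFun (fun a : Fin 4 => seg v u 1 a) (seg v u 1 a)) = d a := fun a =>
    congrArg d (Function.leftInverse_invFun (f := fun a : Fin 4 => seg v u 1 a)
      (fun a b => hsi a b) a)
  refine h.exists_goodColoring_of_offCycle le_rfl h3 hinj hc
    (hP.union (B := Finset.univ.image fun a : Fin 4 => seg v u 1 a)
      (c' := fun e => d (Function.invFun (fun a : Fin 4 => seg v u 1 a) e)) ?_ ?_)
    fun i hi => Finset.mem_image.2 ⟨⟨i, hi⟩, Finset.mem_univ _, rfl⟩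
  · intro e he
    obtain ⟨a, -, rfl⟩ := Finset.mem_image.1 he
    rw [hinv]
    exact hd a
  · intro e he f hf hef _
    obtain ⟨a, -, rfl⟩ := Finset.mem_image.1 he
    obtain ⟨b, -, rfl⟩ := Finset.mem_image.1 hf
    rw [hinv, hinv]
    exact fun hab => hef (by rw [hdi hab])

lemma inc_rest_subset {t x y z : V}
    (ht : ∀ w, G.Adj t w ↔ w = x ∨ w = y ∨ w = z) (hz : M.Adj t z) :
    inc (rest G M) t ⊆ {s(t, x), s(t, y)} := by
  intro e he
  obtain ⟨h1, h2⟩ := mem_inc.1 he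
  obtain ⟨w, rfl⟩ := Sym2.mem_iff_exists.1 h2
  obtain ⟨ha, hm⟩ := mem_rest.1 h1
  rcases (ht w).1 ha with rfl | rfl | rfl
  · simp
  · simp
  · exact absurd hz hm

lemma PerfectIn.inc_rest_u_subset (hM : PerfectIn G M) {n : ℕ} (h : Frame G n v u)
    (h3 : ∀ x, G.degree x = 3) {i j : ℕ} (hv : v i ≠ v j) (hu : u i = u j)
    (hi : ¬ M.Adj (v i) (u i)) (hj : ¬ M.Adj (v j) (u j)) :
    inc (rest G M) (u i) ⊆ {seg v u 0 i, seg v u 0 j} := by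
  have hj' : G.Adj (u i) (v j) := hu ▸ (h.adj_spoke j).symm
  obtain ⟨r, -, -, hr⟩ := exists_third_neighbour (h3 (u i)) (h.adj_spoke i).symm hj' hv
  have hm : M.Adj (u i) r := by
    obtain ⟨y, hy⟩ := hM.cover (u i)
    rcases (hr y).1 (hM.le hy) with rfl | rfl | rfl
    · exact absurd hy.symm hi
    · exact absurd (hu ▸ hy.symm) hj
    · exact hy
  have := inc_rest_subset hr hm
  rw [hu]
  rwa [Sym2.eq_swap, Sym2.eq_swap (a := u i) (b := v j), ← seg_zero, hu, ← seg_zero] at this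

lemma PerfectIn.card_conf_le_six_of_eq (hM : PerfectIn G M) (h : Frame G 4 v u)
    (h3 : ∀ x, G.degree x = 3) (h12 : M.Adj (v 1) (v 2)) (h34 : M.Adj (v 3) (v 4))
    (hu : u 1 = u 3 ∨ u 2 = u 4) : (conf G (rest G M) (seg v u 1 2)).card ≤ 6 := by
  have e5 : v 5 = v 1 := h.cyc.periodic 1
  have hv1 : inc (rest G M) (v 1) ⊆ {seg v u 1 4, seg v u 0 1} := by
    have := inc_rest_subset (t := v 1) (x := v 4) (y := u 1) (z := v 2) (fun w => by
      rw [h.adj_iff 0, show v 0 = v 4 from (h.cyc.periodic 0).symm, or_comm (a := w = v 2)]) h12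
    rwa [Sym2.eq_swap, ← e5, ← seg_one, e5, ← seg_zero] at this
  have hv4 : inc (rest G M) (v 4) ⊆ {seg v u 1 4, seg v u 0 4} :=
    inc_rest_subset (t := v 4) (x := v 5) (y := u 4) (z := v 3)
      (fun w => by rw [h.adj_iff 3, or_comm, or_assoc]) h34.symm
  have hsub : conf G (rest G M) (seg v u 1 2) ⊆ inc (rest G M) (v 1) ∪ inc (rest G M) (v 4) ∪
      inc (rest G M) (u 2) ∪ inc (rest G M) (u 3) := by
    intro f hf
    obtain ⟨t, ht, hft⟩ := Finset.mem_biUnion.1 (conf_subset (fun e he => edge_of_mem_rest he) hf)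
    have ht' := mem_of_mem_nbrs (x := v 2) (y := v 3) (l := [v 1, u 2, v 4, u 3])
      (fun z hz => by rcases (h.adj_iff 1 z).1 hz with h | h | h <;> simp [h])
      (fun z hz => by rcases (h.adj_iff 2 z).1 hz with h | h | h <;> simp [h]) t ht
    simp only [List.mem_cons, List.not_mem_nil, or_false] at ht'
    simp only [Finset.mem_union]
    rcases ht' with rfl | rfl | rfl | rfl <;> tauto
  have s1 := hM.not_spoke h le_rfl h12
  have s2 := hM.not_spoke h le_rfl h12.symm
  have s3 := hM.not_spoke h le_rfl h34
  have s4 := hM.not_spoke h le_rfl h34.symm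
  have hfour : ∀ (a b c d : Sym2 V) (t : V), conf G (rest G M) (seg v u 1 2) ⊆
      {a, b, c, d} ∪ inc (rest G M) t → (conf G (rest G M) (seg v u 1 2)).card ≤ 6 := by
    intro a b c d t hs
    have h1 := (Finset.card_le_card hs).trans (Finset.card_union_le _ _)
    have h2 := Finset.card_le_four (a := a) (b := b) (c := c) (d := d)
    have h3 := hM.card_inc_le h3 subset_rfl t
    omega
  rcases hu with hu | hu
  · have hv3 := hM.inc_rest_u_subset h h3 (h.cyc.ne 1 3 (by omega) (by omega)) hu s1 s3
    rw [hu] at hv3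
    refine hfour (seg v u 1 4) (seg v u 0 1) (seg v u 0 4) (seg v u 0 3) (u 2)
      (hsub.trans fun f hf => ?_)
    simp only [Finset.mem_union] at hf
    rcases hf with ((hf | hf) | hf) | hf
    · have := hv1 hf
      simp only [Finset.mem_insert, Finset.mem_singleton] at this
      rcases this with rfl | rfl <;> simp
    · have := hv4 hf
      simp only [Finset.mem_insert, Finset.mem_singleton] at this
      rcases this with rfl | rfl <;> simp
    · exact Finset.mem_union_right _ hf
    · have := hv3 hf
      simp only [Finset.mem_insert, Finset.mem_singleton] at this
      rcases this with rfl | rfl <;> simp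
  · have hv2 := hM.inc_rest_u_subset h h3 (h.cyc.ne 2 4 (by omega) (by omega)) hu s2 s4
    refine hfour (seg v u 1 4) (seg v u 0 1) (seg v u 0 4) (seg v u 0 2) (u 3)
      (hsub.trans fun f hf => ?_)
    simp only [Finset.mem_union] at hf
    rcases hf with ((hf | hf) | hf) | hf
    · have := hv1 hf
      simp only [Finset.mem_insert, Finset.mem_singleton] at this
      rcases this with rfl | rfl <;> simp
    · have := hv4 hf
      simp only [Finset.mem_insert, Finset.mem_singleton] at this
      rcases this with rfl | rfl <;> simp
    · have := hv2 hf
      simp only [Finset.mem_insert, Finset.mem_singleton] at this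
      rcases this with rfl | rfl <;> simp
    · exact Finset.mem_union_right _ hf

lemma PerfectIn.card_conf_spoke_square (hM : PerfectIn G M) (h : Frame G 4 v u)
    (h3 : ∀ x, G.degree x = 3) (h12 : M.Adj (v 1) (v 2)) (h34 : M.Adj (v 3) (v 4)) (i : ℕ) :
    (conf G ((rest G M \ {seg v u 1 2, seg v u 1 4})) (seg v u 0 i)).card ≤ 6 := by
  set A := rest G M \ {seg v u 1 2, seg v u 1 4} with hA
  have hAe : ∀ e ∈ A, e ∈ G.edgeSet := fun e he => edge_of_mem_rest (Finset.mem_sdiff.1 he).1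
  have two : ∀ {t x y}, x ≠ y → G.Adj t x → G.Adj t y → s(t, x) ∉ A → s(t, y) ∉ A →
      (inc A t).card ≤ 1 := by
    intro t x y hxy hx hy hx' hy'
    have := card_inc_add_le hAe {x, y} (t := t) (by
      simp only [Finset.mem_insert, Finset.mem_singleton, forall_eq_or_imp, forall_eq]
      exact ⟨⟨hx, hx'⟩, hy, hy'⟩)
    rw [Finset.card_pair hxy, h3] at this
    omega
  have hMA : ∀ {x y}, M.Adj x y → s(x, y) ∉ A := fun hxy hm =>
    (mem_rest.1 (Finset.mem_sdiff.1 hm).1).2 hxy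
  have h2A : s(v 2, v 3) ∉ A := by simp [hA, seg_one]
  have h4A : s(v 4, v 5) ∉ A := by simp [hA, seg_one]
  have e5 : v 5 = v 1 := h.cyc.periodic 1
  have hadj := h.cyc.adj
  have hne := h.cyc.ne
  have hone : ∀ j, (inc A (v j)).card ≤ 1 := by
    intro j
    obtain ⟨k, hk, hkj⟩ := h.cyc.exists_lt 1 j
    rw [← hkj]
    interval_cases k
    · exact two (x := v 2) (y := v 4) (hne 2 4 (by omega) (by omega)) (hadj 1)
        (e5 ▸ (hadj 4).symm) (hMA h12) (by rw [Sym2.eq_swap]; rwa [e5] at h4A)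
    · exact two (hne 1 3 (by omega) (by omega)) (hadj 1).symm (hadj 2) (hMA h12.symm) h2A
    · exact two (hne 2 4 (by omega) (by omega)) (hadj 2).symm (hadj 3) (by rwa [Sym2.eq_swap])
        (hMA h34)
    · exact two (hne 3 5 (by omega) (by omega)) (hadj 3).symm (hadj 4) (hMA h34.symm) h4A
  obtain ⟨a, b, -, -, -, hu⟩ := exists_neighbours_of_degree_three (h3 _) (h.adj_spoke i).symm
  obtain ⟨p, hp⟩ := h.exists_pred i
  have := card_conf_le_sum hAe (x := v i) (y := u i) [v p, v (i + 1), a, b]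
    (mem_of_mem_nbrs (fun z hz => by rcases (hp z).1 hz with h | h | h <;> simp [h])
      (fun z hz => by rcases (hu z).1 hz with h | h | h <;> simp [h]))
  have ha := hM.card_inc_le h3 (A := A) Finset.sdiff_subset a
  have hb := hM.card_inc_le h3 (A := A) Finset.sdiff_subset b
  have hp1 := hone p
  have hi1 := hone (i + 1)
  simp only [List.map_cons, List.map_nil, List.sum_cons, List.sum_nil] at this
  rw [seg_zero]
  omega

lemma PerfectIn.exists_goodColoring_of_eq (hM : PerfectIn G M) (h : Frame G 4 v u)
    (h3 : ∀ x, G.degree x = 3) (hG : Reduced G) (h12 : M.Adj (v 1) (v 2))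
    (h34 : M.Adj (v 3) (v 4)) (hu : u 1 = u 3 ∨ u 2 = u 4) : ∃ c, GoodColoring G c := by
  have e5 : v 5 = v 1 := h.cyc.periodic 1
  have e6 : v 6 = v 2 := h.cyc.periodic 2
  have mono : ∀ {B C : Finset (Sym2 V)} {e}, B ⊆ C → (conf G C e).card ≤ 6 →
      (conf G B e).card ≤ 6 := fun hBC hC =>
    (Finset.card_le_card (Finset.filter_subset_filter _ hBC)).trans hC
  have c2 := hM.card_conf_le_six_of_eq h h3 h12 h34 hu
  have c4 := hM.card_conf_le_six_of_eq (h.shift 2) h3 h34 (by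
    change M.Adj (v 5) (v 6)
    rwa [e5, e6]) (by
    change u 3 = u 5 ∨ u 4 = u 6
    rw [show u 5 = u 1 from h.periodic 1, show u 6 = u 2 from h.periodic 2]
    exact hu.imp Eq.symm Eq.symm)
  have hsp : ∀ i, i < 4 → seg v u 0 i ∈ rest G M \ {seg v u 1 2, seg v u 1 4} := by
    have hx : ∀ i j, seg v u 0 i ≠ seg v u 1 j := by
      intro i j he
      rw [seg_zero, seg_one] at he
      rcases Sym2.eq_iff.1 he with he | he
      · exact h.u_ne_v le_rfl _ _ he.2
      · exact h.u_ne_v le_rfl _ _ he.2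
    intro i hi
    refine Finset.mem_sdiff.2 ⟨mem_rest.2 ⟨h.adj_spoke i, ?_⟩, by simp [hx]⟩
    interval_cases i
    · rw [← show v 4 = v 0 from h.cyc.periodic 0, ← show u 4 = u 0 from h.periodic 0]
      exact hM.not_spoke h le_rfl h34.symm
    · exact hM.not_spoke h le_rfl h12
    · exact hM.not_spoke h le_rfl h12.symm
    · exact hM.not_spoke h le_rfl h34
  have hbase : base G M v ⊆ rest G M \ {seg v u 1 2, seg v u 1 4} := by
    intro e he
    refine Finset.mem_sdiff.2 ⟨base_subset he, fun hm => ?_⟩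
    simp only [Finset.mem_insert, Finset.mem_singleton] at hm
    rcases hm with rfl | rfl
    · exact (Finset.mem_filter.1 he).2 2 (by simp [seg_one])
    · exact (Finset.mem_filter.1 he).2 4 (by simp [seg_one])
  have hsub : ∀ k ≤ 4, base G M v ∪ (Finset.range k).image (seg v u 0) ⊆
      rest G M \ {seg v u 1 2, seg v u 1 4} := by
    intro k hk
    refine Finset.union_subset hbase fun e he => ?_
    obtain ⟨i, hi, rfl⟩ := Finset.mem_image.1 he
    exact hsp i (by have := Finset.mem_range.1 hi; omega)
  have hind : ∀ k ≤ 4, ∃ c, ProperOn G (base G M v ∪ (Finset.range k).image (seg v u 0)) c := by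
    intro k
    induction k with
    | zero => simpa using hM.exists_properOn_base h3 hG v
    | succ k ih =>
      intro hk
      obtain ⟨c, hc⟩ := ih (by omega)
      rw [Finset.range_add_one, Finset.image_insert, Finset.union_insert]
      exact hc.insert_of_card_le
        (mono (hsub k (by omega)) (hM.card_conf_spoke_square h h3 h12 h34 k))
  obtain ⟨c, hc⟩ := hind 4 le_rfl
  have hs4 := (hsub 4 le_rfl).trans Finset.sdiff_subset
  have n23 : ¬ M.Adj (v 2) (v 3) :=
    hM.not_adj_of_ne h12.symm (h.cyc.ne 1 3 (by omega) (by omega))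
  obtain ⟨c', hc'⟩ := hc.insert_of_card_le (mono hs4 c2)
  obtain ⟨c'', hc''⟩ := hc'.insert_of_card_le (mono (Finset.insert_subset
    (mem_rest.2 ⟨h.cyc.adj 2, n23⟩) hs4) c4)
  refine hM.exists_goodColoring_of_seg h3 h (S := (Finset.range 4).image (seg v u 0) ∪
    {seg v u 1 2, seg v u 1 4}) (hc''.mono ?_) fun l j hl hj hlj => ?_
  · rw [show seg (fun i => v (i + 2)) (fun i => u (i + 2)) 1 2 = seg v u 1 4 from rfl]
    intro e he
    simp only [Finset.mem_union, Finset.mem_insert, Finset.mem_singleton] at he ⊢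
    tauto
  · interval_cases l
    · exact Finset.mem_union_left _ (Finset.mem_image_of_mem _ (Finset.mem_range.2 hj))
    · refine Finset.mem_union_right _ ?_
      interval_cases j
      · rw [show seg v u 1 0 = seg v u 1 4 by
          change s(v 0, v 1) = s(v 4, v 5)
          rw [e5, show v 4 = v 0 from h.cyc.periodic 0]]
        simp
      · exact absurd h12 (mem_rest.1 hlj).2
      · simp
      · exact absurd h34 (mem_rest.1 hlj).2

lemma Frame.exists_goodColoring_of_four (h : Frame G 4 v u) (h3 : ∀ x, G.degree x = 3)
    (hG : Reduced G) (ih : ∀ H < G, ∃ c, GoodColoring H c) : ∃ c, GoodColoring G c := by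
  obtain ⟨M, v, u, hM, h, h12, h34⟩ := h.exists_perfectIn le_rfl h3 hG
  replace h34 : M.Adj (v 3) (v 4) := by
    rcases h34 with h34 | ⟨h45, -⟩
    · exact h34
    · rw [show v 5 = v 1 from h.cyc.periodic 1] at h45
      exact absurd (hM.unique _ _ _ h12 h45.symm) (h.cyc.ne 2 4 (by omega) (by omega))
  have e4 : u 4 = u 0 := h.periodic 0
  by_cases h02 : u 0 = u 2
  · exact hM.exists_goodColoring_of_eq h h3 hG h12 h34 (Or.inr (by rw [e4, h02]))
  by_cases h13 : u 1 = u 3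
  · exact hM.exists_goodColoring_of_eq h h3 hG h12 h34 (Or.inl h13)
  have hinj := h.u_ne_of_square h02 h13
  by_cases a02 : G.Adj (u 0) (u 2)
  · exact h.exists_goodColoring_of_square_adj h3 ih hinj a02
  by_cases a13 : G.Adj (u 1) (u 3)
  · exact (h.shift 1).exists_goodColoring_of_square_adj h3 ih
      (fun i j hij hj => hinj (i + 1) (j + 1) (by omega) (by omega)) a13
  exact hM.exists_goodColoring_of_square h h3 hG h12 h34 h02 h13 a02 a13

end Square

section ForcedExtension

open Classical

variable {V : Type} [Fintype V] {G : SimpleGraph V}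

lemma Finset.countP_toList {α : Type*} (s : Finset α) (p : α → Prop) [DecidablePred p] :
    s.toList.countP p = (s.filter p).card := by
  rw [← Multiset.coe_countP, Finset.coe_toList, Multiset.countP_eq_card_filter]
  rfl

lemma Finset.exists_list_of_card_le {α : Type*} [Nonempty α] {s : Finset α} {k : ℕ}
    (hs : s.card ≤ k) : ∃ l : List α, l.length = k ∧ ∀ x ∈ s, x ∈ l :=
  ⟨s.toList ++ List.replicate (k - s.card) (Classical.arbitrary α), by simp [hs],
    fun x hx => by simp [hx]⟩

omit [Fintype V] in
/-- Extend a colouring by a gadget with a forced orientation of its half-edges together with a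
family of edges that can be coloured one after another. -/
lemma ProperOn.extend_of_forcedOn {B : Finset (Sym2 V)} {c : Sym2 V → Fin 8}
    (hc : ProperOn G B c) {m : ℕ} {ρ : Type} [Fintype ρ] [Nonempty ρ] (eg : Fin m → Sym2 V)
    (er : ρ → Sym2 V) (hinj : Function.Injective (Sum.elim eg er)) (rk : ρ → ℕ)
    (hrk : Function.Injective rk) (es : List (Fin m × Fin m)) (d : Fin m → ℕ)
    {y p q z : Fin m} (hqz : q ≠ z)
    (hforced : ∀ tr : Fin 4, ∀ tq : Fin 2, ForcedOn es (List.replicate 3 (true, y) ++ [(true, p)] ++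
      List.replicate tq (false, q) ++ List.replicate tr (false, z)) d)
    (hes : ∀ g g', g ≠ g' → Near G (eg g) (eg g') → (g, g') ∈ es ∨ (g', g) ∈ es)
    (hnear : ∀ g r, Near G (eg g) (er r) → g = y ∨ g = p ∨ g = q ∨ g = z)
    (hy : (Finset.univ.filter fun r => Near G (eg y) (er r)).card ≤ 3)
    (hp : (Finset.univ.filter fun r => Near G (eg p) (er r)).card ≤ 1)
    (hq : (Finset.univ.filter fun r => Near G (eg q) (er r)).card ≤ 1)
    (hz : (Finset.univ.filter fun r => Near G (eg z) (er r)).card ≤ 3)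
    (hB : ∀ x, Sum.elim eg er x ∉ B)
    (hL : ∀ g, (conf G B (eg g)).card + d g ≤ 6)
    (hL' : ∀ r, (conf G (B ∪ ((Finset.univ.filter fun r' => rk r' < rk r).image er ∪
      {eg q, eg z})) (er r)).card ≤ 6) :
    ∃ c, ProperOn G (B ∪ Finset.univ.image (Sum.elim eg er)) c := by
  obtain ⟨ly, hly, hly'⟩ := Finset.exists_list_of_card_le hy
  obtain ⟨lp, hlp, hlp'⟩ := Finset.exists_list_of_card_le hp
  set Q := Finset.univ.filter fun r => Near G (eg q) (er r) with hQ
  set Z := Finset.univ.filter fun r => Near G (eg z) (er r) with hZ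
  set bd : List (Bool × Fin m × ρ) := ly.map (fun r => (true, y, r)) ++
    lp.map (fun r => (true, p, r)) ++ Q.toList.map (fun r => (false, q, r)) ++
    Z.toList.map (fun r => (false, z, r)) with hbd
  set P : Finset (ρ × ρ) := Finset.univ.filter fun x => rk x.1 < rk x.2 ∧ Near G (er x.1) (er x.2)
    with hP
  have hforced' : ForcedOn es (bd.map fun x => (x.1, x.2.1)) d := by
    have := hforced ⟨Z.card, by omega⟩ ⟨Q.card, by omega⟩
    simp only [hbd, List.map_append, List.map_map, Function.comp_def, List.map_const', hly, hlp,
      Finset.length_toList]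
    exact this
  have hcount : ∀ r, (P.toList.countP fun x => x.2 = r) +
      (bd.countP fun x => x.1 = false ∧ x.2.2 = r) < (avail G B c (er r)).card := by
    intro r
    set E := Finset.univ.filter fun r' => rk r' < rk r ∧ Near G (er r') (er r) with hE
    set S := ({q, z} : Finset (Fin m)).filter fun g => Near G (eg g) (er r) with hS
    have h1 : P.toList.countP (fun x => x.2 = r) = E.card := by
      rw [Finset.countP_toList]
      refine Finset.card_nbij' Prod.fst (fun r' => (r', r)) ?_ ?_ ?_ ?_
      · rintro ⟨a, b⟩ h
        simp only [hP, hE, Finset.coe_filter, Finset.mem_filter, Finset.mem_univ, true_and,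
          Set.mem_ofPred_eq] at h ⊢
        obtain ⟨h, rfl⟩ := h
        exact h
      · intro a h
        simpa [hP, hE] using h
      · rintro ⟨a, b⟩ h
        simp only [Finset.coe_filter, Set.mem_ofPred_eq] at h
        simp [h.2]
      · intro a _
        rfl
    have hf : ∀ (T : Finset ρ), T.toList.countP (fun r' => decide (r' = r)) =
        if r ∈ T then 1 else 0 := by
      intro T
      rw [Finset.countP_toList, Finset.card_filter]
      simp
    have h2 : bd.countP (fun x => x.1 = false ∧ x.2.2 = r) = S.card := by
      have hS' : S.card = (if r ∈ Q then 1 else 0) + if r ∈ Z then 1 else 0 := by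
        simp only [hS, hQ, hZ, Finset.mem_filter, Finset.mem_univ, true_and,
          Finset.card_filter, Finset.sum_pair hqz]
      rw [hS', ← hf, ← hf]
      simp only [hbd, List.countP_append, List.countP_map]
      simp [Function.comp_def]
    have hsub : conf G B (er r) ∪ (S.disjSum E).image (Sum.elim eg er) ⊆
        conf G (B ∪ ((Finset.univ.filter fun r' => rk r' < rk r).image er ∪
          {eg q, eg z})) (er r) := by
      intro f hf
      rw [Finset.mem_union, mem_conf, Finset.mem_image] at hf
      rw [mem_conf]
      rcases hf with ⟨h1, h2⟩ | ⟨x, hx, rfl⟩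
      · exact ⟨Finset.mem_union_left _ h1, h2⟩
      · rcases x with g | r'
        · obtain ⟨hg, hn⟩ := Finset.mem_filter.1 (Finset.inl_mem_disjSum.1 hx)
          refine ⟨Finset.mem_union_right _ (Finset.mem_union_right _ ?_),
            hinj.ne (a₁ := Sum.inl g) (a₂ := Sum.inr r) (by simp), hn.symm⟩
          rcases Finset.mem_insert.1 hg with rfl | hg
          · simp
          · simp [Finset.mem_singleton.1 hg]
        · obtain ⟨-, hr, hn⟩ := Finset.mem_filter.1 (Finset.inr_mem_disjSum.1 hx)
          refine ⟨Finset.mem_union_right _ (Finset.mem_union_left _ (Finset.mem_image.2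
            ⟨r', by simp [hr], rfl⟩)), hinj.ne (a₁ := Sum.inr r') (a₂ := Sum.inr r) ?_, hn.symm⟩
          rintro h
          rw [Sum.inr.injEq] at h
          subst h
          omega
    have hdisj : Disjoint (conf G B (er r)) ((S.disjSum E).image (Sum.elim eg er)) := by
      rw [Finset.disjoint_left]
      intro f hf hf'
      obtain ⟨x, -, rfl⟩ := Finset.mem_image.1 hf'
      exact hB x (mem_conf.1 hf).1
    have h3 := (Finset.card_le_card hsub).trans (hL' r)
    rw [Finset.card_union_of_disjoint hdisj, Finset.card_image_of_injective _ hinj,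
      Finset.card_disjSum] at h3
    have := card_avail (G := G) B c (er r)
    omega
  obtain ⟨k, k', hk, hk', h1, h2, h3⟩ := exists_choice_of_forcedOn es P.toList bd d hforced' rk
    (fun x hx => ((Finset.mem_filter.1 (Finset.mem_toList.1 hx)).2).1)
    (fun g => avail G B c (eg g)) (fun r => avail G B c (er r)) (fun g => by
      have := card_avail (G := G) B c (eg g)
      have := hL g
      omega) (fun r => by convert hcount r)
  have hgr : ∀ g r, Near G (eg g) (er r) → k g ≠ k' r := by
    intro g r hn
    rcases hnear g r hn with rfl | rfl | rfl | rfl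
    · refine h3 (true, g, r) ?_
      simp [hbd, hly' r (by simpa using hn)]
    · refine h3 (true, g, r) ?_
      simp [hbd, hlp' r (by simpa using hn)]
    · refine h3 (false, g, r) ?_
      simp [hbd, hQ, hn]
    · refine h3 (false, g, r) ?_
      simp [hbd, hZ, hn]
  have hrr : ∀ r r', r ≠ r' → Near G (er r) (er r') → k' r ≠ k' r' := by
    intro r r' hne hn
    rcases lt_or_gt_of_ne (hrk.ne hne) with hlt | hlt
    · exact h2 (r, r') (by simp [hP, hlt, hn])
    · exact (h2 (r', r) (by simp [hP, hlt, hn.symm])).symm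
  have hext : ∀ a, Function.extend (Sum.elim eg er) (Sum.elim k k') 0 (Sum.elim eg er a) =
    Sum.elim k k' a := fun a => hinj.extend_apply _ _ _
  refine ⟨_, hc.union (c' := Function.extend (Sum.elim eg er) (Sum.elim k k') 0) ?_ ?_⟩
  · intro f hf
    obtain ⟨a, -, rfl⟩ := Finset.mem_image.1 hf
    rw [hext]
    rcases a with g | r
    · exact hk g
    · exact hk' r
  · intro f hf f' hf' hne hn
    obtain ⟨a, -, rfl⟩ := Finset.mem_image.1 hf
    obtain ⟨b, -, rfl⟩ := Finset.mem_image.1 hf'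
    rw [hext, hext]
    have hab : a ≠ b := fun h => hne (h ▸ rfl)
    rcases a with g | r <;> rcases b with g' | r'
    · rcases hes g g' (fun h => hab (h ▸ rfl)) hn with h | h
      · exact h1 _ h
      · exact (h1 _ h).symm
    · exact hgr g r' hn
    · exact (hgr g' r hn.symm).symm
    · exact hrr r r' (fun h => hab (h ▸ rfl)) hn

end ForcedExtension

section LongCycles

open Classical

variable {V : Type} [Fintype V] {G M : SimpleGraph V} {n : ℕ} {v u : ℕ → V}

omit [Fintype V] in
lemma Frame.seg_add (h : Frame G n v u) (l i : ℕ) : seg v u l (i + n) = seg v u l i := by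
  rw [seg, seg, h.cyc.periodic, h.periodic, add_right_comm, h.cyc.periodic]

omit [Fintype V] in
lemma Frame.eq_or_of_seg_eq (h : Frame G n v u) (hn : 4 ≤ n) {l i l' j : ℕ} (hl : l ≤ 1)
    (hl' : l' ≤ 1) (hi : i ≤ n) (hj : j ≤ n) (he : seg v u l i = seg v u l' j) :
    l = l' ∧ (i = j ∨ i = 0 ∧ j = n ∨ i = n ∧ j = 0) := by
  have key : ∀ l i, i ≤ n → ∃ i' < n, seg v u l i = seg v u l i' ∧ (i = i' ∨ i = n ∧ i' = 0) := by
    intro l i hi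
    rcases hi.lt_or_eq with hi | rfl
    · exact ⟨i, hi, rfl, Or.inl rfl⟩
    · refine ⟨0, by omega, ?_, Or.inr ⟨rfl, rfl⟩⟩
      simpa using h.seg_add l 0
  obtain ⟨i', hi', hie, h1⟩ := key l i hi
  obtain ⟨j', hj', hje, h2⟩ := key l' j hj
  obtain ⟨h3, h4⟩ := h.seg_inj hn hl hl' hi' hj' (hie ▸ hje ▸ he)
  omega

/-- The edges outside `M` at the cycle vertices with positions from `k` to `n`, given by kind and
position. -/
noncomputable def arc (G M : SimpleGraph V) (v u : ℕ → V) (n k : ℕ) : Finset (ℕ × ℕ) :=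
  (Finset.range 2 ×ˢ Finset.range (n + 1)).filter fun x =>
    k ≤ x.2 ∧ x.2 + x.1 ≤ n ∧ seg v u x.1 x.2 ∈ rest G M

lemma mem_arc {k l i : ℕ} :
    (l, i) ∈ arc G M v u n k ↔ l ≤ 1 ∧ k ≤ i ∧ i + l ≤ n ∧ seg v u l i ∈ rest G M := by
  simp only [arc, Finset.mem_filter, Finset.mem_product, Finset.mem_range]
  constructor
  · rintro ⟨h1, h2, h3, h4⟩
    exact ⟨by omega, h2, h3, h4⟩
  · rintro ⟨h1, h2, h3, h4⟩
    exact ⟨by omega, h2, h3, h4⟩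

lemma seg_notMem_base (l i : ℕ) : seg v u l i ∉ base G M v := fun h =>
  (Finset.mem_filter.1 h).2 i (by rw [seg]; split_ifs <;> simp)

lemma Frame.card_conf_seg_le_six (h : Frame G n v u) (hn : 4 ≤ n) (h3 : ∀ x, G.degree x = 3)
    {A : Finset (Sym2 V)} (hA : ∀ e ∈ A, e ∈ G.edgeSet) (h2 : ∀ t, (inc A t).card ≤ 2) {l i : ℕ}
    (hl : l ≤ 1) (ht : inc A (v (i + l + 1)) = ∅) : (conf G A (seg v u l i)).card ≤ 6 := by
  obtain rfl | rfl : l = 0 ∨ l = 1 := by omega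
  · rw [seg_zero]
    refine card_conf_le_six hA h2 (Or.inr ⟨?_, _, ?_, ht⟩)
    · have := card_nbrs_le (h.adj_spoke i)
      rw [h3, h3] at this
      omega
    · exact mem_nbrs.2 (Or.inl ⟨(h.u_ne_v hn _ _).symm, h.cyc.adj i⟩)
  · rw [seg_one]
    refine card_conf_le_six hA h2 (Or.inr ⟨?_, _, ?_, ht⟩)
    · have := card_nbrs_le (h.cyc.adj i)
      rw [h3, h3] at this
      omega
    · exact mem_nbrs.2 (Or.inr ⟨(h.cyc.ne i (i + 2) (by omega) (by omega)).symm, h.cyc.adj (i + 1)⟩)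

lemma card_filter_subtype_le {α : Type*} {R : Finset α} (P : {x // x ∈ R} → Prop) (T : Finset α)
    {k : ℕ} (hT : T.card ≤ k) (h : ∀ r, P r → r.1 ∈ T) : (Finset.univ.filter P).card ≤ k :=
  (Finset.card_le_card_of_injOn Subtype.val (fun r hr => h r (by simpa using hr))
    Subtype.val_injective.injOn).trans hT

/-- Colour the edges near a short segment of the cycle by the gadget with forced boundary, and the
other edges at the cycle one after another. -/
lemma PerfectIn.exists_goodColoring_of_gadget (hM : PerfectIn G M) (h3 : ∀ x, G.degree x = 3)
    (hG : Reduced G) (h : Frame G n v u) {k : ℕ} (hk : 2 ≤ k) (hkn : k + 4 ≤ n) (hn : 7 ≤ n)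
    (h12 : M.Adj (v 1) (v 2)) (hkk : M.Adj (v k) (v (k + 1))) {m : ℕ} (pg : Fin m → ℕ × ℕ)
    (es : List (Fin m × Fin m)) (d : Fin m → ℕ) {y p q z : Fin m} (hqz : q ≠ z)
    (hforced : ∀ tr : Fin 4, ∀ tq : Fin 2, ForcedOn es (List.replicate 3 (true, y) ++ [(true, p)] ++
      List.replicate tq (false, q) ++ List.replicate tr (false, z)) d)
    (hy : pg y = (1, 0)) (hp : pg p = (0, 1)) (hq : pg q = (0, k + 1)) (hz : pg z = (1, k + 1))
    (hpg : ∀ g, (pg g).1 ≤ 1) (hinj : Function.Injective pg)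
    (hmid : ∀ g, g = y ∨ g = p ∨ g = q ∨ g = z ∨ 2 ≤ (pg g).2 ∧ (pg g).2 + (pg g).1 ≤ k)
    (hes : ∀ g g', g ≠ g' → Close (k + 4) (pg g) (pg g') → (g, g') ∈ es ∨ (g', g) ∈ es)
    (hcov : ∀ l j, l ≤ 1 → 0 < j → j ≤ k + 1 → seg v u l j ∈ rest G M → ∃ g, pg g = (l, j))
    (hL : ∀ g, (conf G (base G M v) (seg v u (pg g).1 (pg g).2)).card + d g ≤ 6) :
    ∃ c, GoodColoring G c := by
  have hu : ∀ i j, i < j → j < i + n → u i ≠ u j := fun i j hij hj => h.u_ne (by omega) hij hj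
  have hbound : ∀ g, (pg g).2 + (pg g).1 ≤ k + 2 := by
    intro g
    rcases hmid g with rfl | rfl | rfl | rfl | h
    · simp [hy]
    · simp [hp]
    · simp [hq]
    · simp [hz]
    · omega
  have hpos : ∀ g, (pg g).2 = 0 → (pg g).1 = 1 := by
    intro g
    rcases hmid g with rfl | rfl | rfl | rfl | h
    · simp [hy]
    · simp [hp]
    · simp [hq]
    · simp [hz]
    · omega
  have hpq : ∀ g, (pg g).2 ≤ k + 1 := by
    intro g
    rcases hmid g with rfl | rfl | rfl | rfl | h
    · simp [hy]
    · simp [hp]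
    · simp [hq]
    · simp [hz]
    · omega
  have eseg : seg v u 0 n = seg v u 0 0 := by simpa using h.seg_add 0 0
  have hqr : seg v u 0 (k + 1) ∈ rest G M :=
    mem_rest.2 ⟨h.adj_spoke _, hM.not_spoke h (by omega) hkk.symm⟩
  have hzr : seg v u 1 (k + 1) ∈ rest G M := mem_rest.2 ⟨h.cyc.adj _,
    hM.not_adj_of_ne hkk.symm (h.cyc.ne _ _ (by omega) (by omega))⟩
  have h01 : ¬ M.Adj (v n) (v (n + 1)) := by
    rw [show n + 1 = 1 + n by omega, h.cyc.periodic]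
    exact fun h' => hM.not_adj_of_ne h12 (h.cyc.ne 2 n (by omega) (by omega)) h'.symm
  have hlast : seg v u 0 n ∉ rest G M ∨ seg v u 1 (n - 1) ∉ rest G M := by
    by_contra! hcon
    have h1 := hM.spoke_of_not h (i := n - 1) (mem_rest.1 hcon.2).2 (by
      rwa [show n - 1 + 1 = n by omega, show n - 1 + 2 = n + 1 by omega])
    rw [show n - 1 + 1 = n by omega] at h1
    exact (mem_rest.1 hcon.1).2 h1
  have hfirst : seg v u 0 (k + 2) ∉ rest G M ∨ seg v u 1 (k + 2) ∉ rest G M := by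
    by_contra! hcon
    exact (mem_rest.1 hcon.1).2 (hM.spoke_of_not h (i := k + 1) (mem_rest.1 hzr).2
      (mem_rest.1 hcon.2).2)
  have hex : ∃ x, x ∈ arc G M v u n (k + 2) := by
    by_cases h0 : M.Adj (v n) (u n)
    · refine ⟨(1, n - 1), mem_arc.2 ⟨le_rfl, by omega, by omega, mem_rest.2 ⟨h.cyc.adj _, ?_⟩⟩⟩
      rw [show n - 1 + 1 = n by omega]
      exact fun h' => hM.not_adj_of_ne h0 (h.u_ne_v (by omega) _ _) h'.symm
    · exact ⟨(0, n), mem_arc.2 ⟨by omega, by omega, by omega, mem_rest.2 ⟨h.adj_spoke _, h0⟩⟩⟩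
  have harc : ∀ r : {x // x ∈ arc G M v u n (k + 2)},
      r.1.1 ≤ 1 ∧ k + 2 ≤ r.1.2 ∧ r.1.2 + r.1.1 ≤ n ∧ seg v u r.1.1 r.1.2 ∈ rest G M :=
    fun r => mem_arc.1 r.2
  have hgr : ∀ (g : Fin m) (r : {x // x ∈ arc G M v u n (k + 2)}),
      Near G (seg v u (pg g).1 (pg g).2) (seg v u r.1.1 r.1.2) →
      ∃ x y, (x = (pg g).2 ∨ x = (pg g).2 + (pg g).1) ∧ (y = r.1.2 ∨ y = r.1.2 + r.1.1) ∧
        (y ≤ x + 1 ∨ n ≤ y - x + 1) := by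
    intro g r hn'
    have hr := harc r
    have hg := hbound g
    rcases h.near_seg (by omega) hu (hpg g) hr.1 (by omega) hr.2.2.1 hn' with
      ⟨x, y, hx, hy, hxy⟩ | ⟨hl, -, hadj⟩
    · exact ⟨x, y, hx, hy, by omega⟩
    · have := hpos g
      have := hpq g
      exact absurd hadj (h.not_adj_u hn (by omega) (by omega))
  have : Nonempty {x // x ∈ arc G M v u n (k + 2)} := ⟨⟨_, hex.choose_spec⟩⟩
  obtain ⟨c, hc⟩ := hM.exists_properOn_base h3 hG v
  have hside : ∀ (l j : ℕ), seg v u l j ∉ rest G M →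
      ∀ r : {x // x ∈ arc G M v u n (k + 2)}, ¬ (r.1.1 = l ∧ r.1.2 = j) := by
    rintro l j hlj r ⟨rfl, rfl⟩
    exact hlj (harc r).2.2.2
  refine Exists.elim (hc.extend_of_forcedOn (fun g => seg v u (pg g).1 (pg g).2)
    (fun r : {x // x ∈ arc G M v u n (k + 2)} => seg v u r.1.1 r.1.2) ?_
    (fun r => 2 * r.1.2 + r.1.1) ?_ es d hqz hforced ?_ ?_ ?_ ?_ ?_ ?_ ?_ hL ?_) fun c' hc' => ?_
  · have hcross : ∀ (g : Fin m) (r : {x // x ∈ arc G M v u n (k + 2)}),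
        seg v u (pg g).1 (pg g).2 ≠ seg v u r.1.1 r.1.2 := by
      intro g r he
      have hr := harc r
      have hg := hbound g
      have := h.eq_or_of_seg_eq (by omega) (hpg g) hr.1 (by omega) (by omega) he
      have := hpos g
      have := hpq g
      omega
    rintro (g | r) (g' | r') he
    · have hg := hbound g
      have hg' := hbound g'
      have := h.eq_or_of_seg_eq (by omega) (hpg g) (hpg g') (by omega) (by omega) he
      exact congrArg _ (hinj (Prod.ext this.1 (by omega)))
    · exact absurd he (hcross g r')
    · exact absurd he.symm (hcross g' r)
    · have hr := harc r
      have hr' := harc r'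
      have := h.eq_or_of_seg_eq (by omega) hr.1 hr'.1 (by omega) (by omega) he
      exact congrArg _ (Subtype.ext (Prod.ext this.1 (by omega)))
  · intro r r' he
    have hr := harc r
    have hr' := harc r'
    have he' : 2 * r.1.2 + r.1.1 = 2 * r'.1.2 + r'.1.1 := he
    exact Subtype.ext (Prod.ext (by omega) (by omega))
  · intro g g' hne hn'
    have hg := hbound g
    have hg' := hbound g'
    refine hes g g' hne ?_
    rcases h.near_seg (by omega) hu (hpg g) (hpg g') (by omega) (by omega) hn' with
      ⟨x, y, hx, hy, hxy⟩ | ⟨hl, hl', hadj⟩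
    · exact ⟨x, by simpa using hx, y, by simpa using hy, by omega⟩
    · exfalso
      rcases lt_trichotomy (pg g).2 (pg g').2 with hlt | heq | hlt
      · exact h.not_adj_u hn hlt (by omega) hadj
      · exact hadj.ne (congrArg u heq)
      · exact h.not_adj_u hn hlt (by omega) hadj.symm
  · intro g r hn'
    obtain ⟨x, y, hx, hy, hxy⟩ := hgr g r hn'
    have hr := harc r
    have := hmid g
    by_contra hcon
    push Not at hcon
    have hg := (((this.resolve_left hcon.1).resolve_left hcon.2.1).resolve_left
      hcon.2.2.1).resolve_left hcon.2.2.2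
    omega
  · rcases hlast with hl | hl
    · refine card_filter_subtype_le _ {(0, n - 1), (1, n - 2), (1, n - 1)} Finset.card_le_three
        fun r hn' => ?_
      obtain ⟨x, w, hx, hw, hxw⟩ := hgr y r hn'
      have hr := harc r
      have := hside _ _ hl r
      simp only [hy] at hx
      simp only [Finset.mem_insert, Finset.mem_singleton, Prod.ext_iff]
      omega
    · refine card_filter_subtype_le _ {(0, n - 1), (1, n - 2), (0, n)} Finset.card_le_three
        fun r hn' => ?_
      obtain ⟨x, w, hx, hw, hxw⟩ := hgr y r hn'
      have hr := harc r
      have := hside _ _ hl r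
      simp only [hy] at hx
      simp only [Finset.mem_insert, Finset.mem_singleton, Prod.ext_iff]
      omega
  · rcases hlast with hl | hl
    · refine card_filter_subtype_le _ {(1, n - 1)} (by simp) fun r hn' => ?_
      obtain ⟨x, w, hx, hw, hxw⟩ := hgr p r hn'
      have hr := harc r
      have := hside _ _ hl r
      simp only [hp] at hx
      simp only [Finset.mem_singleton, Prod.ext_iff]
      omega
    · refine card_filter_subtype_le _ {(0, n)} (by simp) fun r hn' => ?_
      obtain ⟨x, w, hx, hw, hxw⟩ := hgr p r hn'
      have hr := harc r
      have := hside _ _ hl r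
      simp only [hp] at hx
      simp only [Finset.mem_singleton, Prod.ext_iff]
      omega
  · rcases hfirst with hl | hl
    · refine card_filter_subtype_le _ {(1, k + 2)} (by simp) fun r hn' => ?_
      obtain ⟨x, w, hx, hw, hxw⟩ := hgr q r hn'
      have hr := harc r
      have := hside _ _ hl r
      simp only [hq] at hx
      simp only [Finset.mem_singleton, Prod.ext_iff]
      omega
    · refine card_filter_subtype_le _ {(0, k + 2)} (by simp) fun r hn' => ?_
      obtain ⟨x, w, hx, hw, hxw⟩ := hgr q r hn'
      have hr := harc r
      have := hside _ _ hl r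
      simp only [hq] at hx
      simp only [Finset.mem_singleton, Prod.ext_iff]
      omega
  · rcases hfirst with hl | hl
    · refine card_filter_subtype_le _ {(1, k + 2), (0, k + 3), (1, k + 3)} Finset.card_le_three
        fun r hn' => ?_
      obtain ⟨x, w, hx, hw, hxw⟩ := hgr z r hn'
      have hr := harc r
      have := hside _ _ hl r
      simp only [hz] at hx
      simp only [Finset.mem_insert, Finset.mem_singleton, Prod.ext_iff]
      omega
    · refine card_filter_subtype_le _ {(0, k + 2), (0, k + 3), (1, k + 3)} Finset.card_le_three
        fun r hn' => ?_
      obtain ⟨x, w, hx, hw, hxw⟩ := hgr z r hn'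
      have hr := harc r
      have := hside _ _ hl r
      simp only [hz] at hx
      simp only [Finset.mem_insert, Finset.mem_singleton, Prod.ext_iff]
      omega
  · rintro (g | r)
    · exact seg_notMem_base _ _
    · exact seg_notMem_base _ _
  · intro r
    have hr := harc r
    have hsub : base G M v ∪ (((Finset.univ : Finset {x // x ∈ arc G M v u n (k + 2)}).filter
        fun r' => 2 * r'.1.2 + r'.1.1 < 2 * r.1.2 + r.1.1).image (fun r' => seg v u r'.1.1 r'.1.2) ∪
        {seg v u (pg q).1 (pg q).2, seg v u (pg z).1 (pg z).2}) ⊆ rest G M := by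
      intro e he
      simp only [Finset.mem_union, Finset.mem_image, Finset.mem_insert, Finset.mem_singleton] at he
      rcases he with he | ⟨r', -, rfl⟩ | rfl | rfl
      · exact base_subset he
      · exact (harc r').2.2.2
      · rwa [hq]
      · rwa [hz]
    refine h.card_conf_seg_le_six (by omega) h3 (fun e he => edge_of_mem_rest (hsub he))
      (hM.card_inc_le h3 hsub) hr.1 ?_
    have key : ∀ l j, l ≤ 1 → k + 1 ≤ j → j + l ≤ r.1.2 + r.1.1 →
        v (r.1.2 + r.1.1 + 1) ∉ seg v u l j := by
      intro l j hl hj hjr hmem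
      rcases mem_seg hl hmem with he | ⟨-, he⟩ | ⟨-, he⟩
      · exact h.cyc.ne j _ (by omega) (by omega) he.symm
      · exact h.u_ne_v (by omega) _ _ he.symm
      · exact h.cyc.ne (j + l) _ (by omega) (by omega) he.symm
    rw [Finset.eq_empty_iff_forall_notMem]
    intro e he
    obtain ⟨he, hmem⟩ := mem_inc.1 he
    simp only [Finset.mem_union, Finset.mem_image, Finset.mem_insert, Finset.mem_singleton,
      Finset.mem_filter] at he
    rcases he with he | ⟨r', ⟨-, hlt⟩, rfl⟩ | rfl | rfl
    · exact (Finset.mem_filter.1 he).2 _ hmem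
    · have hr' := harc r'
      exact key _ _ hr'.1 (by omega) (by omega) hmem
    · rw [hq] at hmem
      exact key 0 (k + 1) (by omega) le_rfl (by omega) hmem
    · rw [hz] at hmem
      exact key 1 (k + 1) le_rfl le_rfl (by omega) hmem
  · refine hM.exists_goodColoring_of_seg h3 h hc' fun l j hl hj hlj => Finset.mem_image.2 ?_
    have hr : ∀ i, k + 2 ≤ i → i + l ≤ n → seg v u l i = seg v u l j →
        ∃ a ∈ Finset.univ, Sum.elim (fun g => seg v u (pg g).1 (pg g).2)
          (fun r : {x // x ∈ arc G M v u n (k + 2)} => seg v u r.1.1 r.1.2) a = seg v u l j :=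
      fun i h1 h2 he =>
        ⟨Sum.inr ⟨(l, i), mem_arc.2 ⟨hl, h1, h2, he ▸ hlj⟩⟩, Finset.mem_univ _, he⟩
    rcases Nat.eq_zero_or_pos j with rfl | hj0
    · obtain rfl | rfl : l = 0 ∨ l = 1 := by omega
      · exact hr n (by omega) (by omega) eseg
      · exact ⟨Sum.inl y, Finset.mem_univ _, by simp [hy]⟩
    · by_cases hjk : j ≤ k + 1
      · obtain ⟨g, hg⟩ := hcov l j hl hj0 hjk hlj
        exact ⟨Sum.inl g, Finset.mem_univ _, by simp [hg]⟩
      · exact hr j (by omega) (by omega) rfl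

end LongCycles

section CubicGraphs

open Classical

variable {V : Type} [Fintype V] {G M : SimpleGraph V} {n : ℕ} {v u : ℕ → V}

/-- The edges outside the matching near a cycle segment whose two matching edges are at distance
one. -/
def shortGadget : Fin 7 → ℕ × ℕ := ![(1,0),(0,1),(0,2),(1,2),(0,3),(0,4),(1,4)]

/-- The edges outside the matching near a cycle segment whose two matching edges are at distance
two. -/
def longGadget : Fin 8 → ℕ × ℕ := ![(1,0),(0,1),(0,2),(1,2),(1,3),(0,4),(0,5),(1,5)]

lemma PerfectIn.exists_goodColoring_of_dist_one (hM : PerfectIn G M) (h3 : ∀ x, G.degree x = 3)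
    (hG : Reduced G) (h : Frame G n v u) (hn : 7 ≤ n) (h12 : M.Adj (v 1) (v 2))
    (h34 : M.Adj (v 3) (v 4)) : ∃ c, GoodColoring G c := by
  have hq := hM.card_conf_spoke_le h3 h
  have s1 := hM.card_inc_base_u h3 h (hM.not_spoke h (by omega) h12)
  have s2 := hM.card_inc_base_u h3 h (hM.not_spoke h (by omega) h12.symm)
  have s3 := hM.card_inc_base_u h3 h (hM.not_spoke h (by omega) h34)
  have s4 := hM.card_inc_base_u h3 h (hM.not_spoke h (by omega) h34.symm)
  have s0 := hM.card_inc_le h3 (base_subset (v := v)) (u 0)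
  have s5 := hM.card_inc_le h3 (base_subset (v := v)) (u 5)
  have z0 := h.card_conf_cycle_edge (M := M) 0
  have z2 := h.card_conf_cycle_edge (M := M) 2
  have z4 := h.card_conf_cycle_edge (M := M) 4
  simp only [Nat.reduceAdd] at z0 z2 z4
  refine hM.exists_goodColoring_of_gadget h3 hG h (k := 3) (by omega) (by omega) hn h12 h34
    shortGadget _ _ (y := 0) (p := 1) (q := 5) (z := 6) (by decide) forcedOn_short rfl rfl rfl rfl
    (by decide) (by decide) (by decide) (by decide) ?_ ?_
  · intro l j hl hj hj' hlj
    interval_cases l <;> interval_cases j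
    · exact ⟨1, rfl⟩
    · exact ⟨2, rfl⟩
    · exact ⟨4, rfl⟩
    · exact ⟨5, rfl⟩
    · exact absurd h12 (mem_rest.1 hlj).2
    · exact ⟨3, rfl⟩
    · exact absurd h34 (mem_rest.1 hlj).2
    · exact ⟨6, rfl⟩
  · intro a
    fin_cases a
    · change (conf G (base G M v) (seg v u 1 0)).card + 3 ≤ 6
      omega
    · exact Nat.add_le_add_right (hq 1) 2
    · exact Nat.add_le_add_right (hq 2) 2
    · change (conf G (base G M v) (seg v u 1 2)).card + 4 ≤ 6
      omega
    · exact (Nat.add_le_add_right (hq 3) 1).trans (by omega)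
    · exact Nat.add_le_add_right (hq 4) 2
    · change (conf G (base G M v) (seg v u 1 4)).card + 3 ≤ 6
      omega

lemma PerfectIn.exists_goodColoring_of_dist_two (hM : PerfectIn G M) (h3 : ∀ x, G.degree x = 3)
    (hG : Reduced G) (h : Frame G n v u) (hn : 8 ≤ n) (h12 : M.Adj (v 1) (v 2))
    (h45 : M.Adj (v 4) (v 5)) (hs3 : M.Adj (v 3) (u 3)) : ∃ c, GoodColoring G c := by
  have hq := hM.card_conf_spoke_le h3 h
  have s1 := hM.card_inc_base_u h3 h (hM.not_spoke h (by omega) h12)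
  have s2 := hM.card_inc_base_u h3 h (hM.not_spoke h (by omega) h12.symm)
  have s4 := hM.card_inc_base_u h3 h (hM.not_spoke h (by omega) h45)
  have s5 := hM.card_inc_base_u h3 h (hM.not_spoke h (by omega) h45.symm)
  have s0 := hM.card_inc_le h3 (base_subset (v := v)) (u 0)
  have s3 := hM.card_inc_le h3 (base_subset (v := v)) (u 3)
  have s6 := hM.card_inc_le h3 (base_subset (v := v)) (u 6)
  have z0 := h.card_conf_cycle_edge (M := M) 0
  have z2 := h.card_conf_cycle_edge (M := M) 2
  have z3 := h.card_conf_cycle_edge (M := M) 3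
  have z5 := h.card_conf_cycle_edge (M := M) 5
  simp only [Nat.reduceAdd] at z0 z2 z3 z5
  refine hM.exists_goodColoring_of_gadget h3 hG h (k := 4) (by omega) (by omega) (by omega) h12 h45
    longGadget _ _ (y := 0) (p := 1) (q := 6) (z := 7) (by decide) forcedOn_long rfl rfl rfl rfl
    (by decide) (by decide) (by decide) (by decide) ?_ ?_
  · intro l j hl hj hj' hlj
    interval_cases l <;> interval_cases j
    · exact ⟨1, rfl⟩
    · exact ⟨2, rfl⟩
    · exact absurd hs3 (mem_rest.1 hlj).2
    · exact ⟨5, rfl⟩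
    · exact ⟨6, rfl⟩
    · exact absurd h12 (mem_rest.1 hlj).2
    · exact ⟨3, rfl⟩
    · exact ⟨4, rfl⟩
    · exact absurd h45 (mem_rest.1 hlj).2
    · exact ⟨7, rfl⟩
  · intro a
    fin_cases a
    · change (conf G (base G M v) (seg v u 1 0)).card + 3 ≤ 6
      omega
    · exact Nat.add_le_add_right (hq 1) 2
    · exact Nat.add_le_add_right (hq 2) 2
    · change (conf G (base G M v) (seg v u 1 2)).card + 3 ≤ 6
      omega
    · change (conf G (base G M v) (seg v u 1 3)).card + 2 ≤ 6
      omega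
    · exact Nat.add_le_add_right (hq 4) 2
    · exact Nat.add_le_add_right (hq 5) 2
    · change (conf G (base G M v) (seg v u 1 5)).card + 3 ≤ 6
      omega

lemma Frame.exists_goodColoring_of_seven_le (h : Frame G n v u) (hn : 7 ≤ n)
    (h3 : ∀ x, G.degree x = 3) (hG : Reduced G) : ∃ c, GoodColoring G c := by
  obtain ⟨M, v, u, hM, h, h12, h34 | ⟨h45, hs3⟩⟩ := h.exists_perfectIn (by omega) h3 hG
  · exact hM.exists_goodColoring_of_dist_one h3 hG h hn h12 h34
  · obtain rfl | hn := hn.eq_or_lt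
    · by_cases h67 : M.Adj (v 6) (v 7)
      · exact hM.exists_goodColoring_of_dist_one h3 hG (h.shift 3) le_rfl h45 h67
      · exact hM.exists_goodColoring_of_heptagon h h3 hG h12 h45 hs3 h67
    · exact hM.exists_goodColoring_of_dist_two h3 hG h hn h12 h45 hs3

lemma Reduced.exists_goodColoring_of_cubic [Nonempty V] (hG : Reduced G)
    (h3 : ∀ x, G.degree x = 3) (ih : ∀ H < G, ∃ c, GoodColoring H c) :
    ∃ c, GoodColoring G c := by
  obtain ⟨n, v, u, h⟩ := exists_frame hG h3
  have hn := h.cyc.three_le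
  by_cases h7 : 7 ≤ n
  · exact h.exists_goodColoring_of_seven_le h7 h3 hG
  · interval_cases n
    · exact h.exists_goodColoring_of_triangle h3 hG
    · exact h.exists_goodColoring_of_four h3 hG ih
    · exact h.exists_goodColoring_of_five h3 hG
    · exact h.exists_goodColoring_of_hexagon h3 ih

end CubicGraphs

/-- Every finite subcubic simple graph admits a `(1,2^7)`-packing edge-coloring in which
the 1-color class contains only edges whose endpoints both have degree 3. -/
theorem subcubic_good_coloring {V : Type} [Finite V] (G : SimpleGraph V)
    (hG : Subcubic G) :
    ∃ c : Sym2 V → Fin 8, GoodColoring G c := by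
  classical
  have := Fintype.ofFinite V
  refine exists_goodColoring_of_reduced (fun W _ H _ hH ih => ?_) _ V G hG rfl
  by_cases h2 : ∃ x, H.degree x = 2
  · exact hH.exists_goodColoring_of_degree_two h2
  · exact hH.exists_goodColoring_of_cubic
      (fun x => (hH.degree x).resolve_left fun h => h2 ⟨x, h⟩) ih
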